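/- arXiv:2110.13906 — 2 statements merged into one kernel-verified Lean document; each statement's English description precedes it below -/
import Mathlib

section
/- For all n, k ≥ 1, there exists a bijection φ̂: F_n^k → R_n^k such that, writing F = φ̂(f): area_k(f) = k·inv_k(F), coarea_k(f) = k·coinv_k(F), semiarea_k(f) = k·inv(F), and cosemiarea_k(f) = k·coinv(F). -/
/-- A rooted forest on vertex set `V`, encoded by its parent function:
`parent v = some u` means `u` is the parent of `v` (edges are directed away from
the roots, so `(u,v)` is an edge), and `parent v = none` means `v` is a root.
Acyclicity guarantees that every connected component is a tree with a
distinguished root. -/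
structure RootedForest (V : Type) where
  parent : V → Option V
  acyclic : ∀ v : V, ¬ Relation.TransGen (fun a b : V => parent a = some b) v v

namespace RootedForest

variable {V : Type} [Fintype V] [LinearOrder V]

/-- `F.Desc u v` means `v` is a (strict) descendant of `u`. -/
def Desc (F : RootedForest V) (u v : V) : Prop :=
  Relation.TransGen (fun a b : V => F.parent a = some b) v u

/-- The hook of `u`: `u` together with all of its descendants. -/
def hook (F : RootedForest V) (u : V) : Set V := {v : V | v = u ∨ F.Desc u v}

/-- The hook length `h(u)`. -/
noncomputable def h (F : RootedForest V) (u : V) : ℕ := (F.hook u).ncard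

/-- The left hook length `h_L(u)`: sum of hook lengths of children smaller than `u`. -/
noncomputable def hL (F : RootedForest V) (u : V) : ℕ :=
  ∑ v ∈ Finset.univ.filter (fun v : V => F.parent v = some u ∧ v < u), F.h v

/-- The right hook length `h_R(u)`: sum of hook lengths of children larger than `u`. -/
noncomputable def hR (F : RootedForest V) (u : V) : ℕ :=
  ∑ v ∈ Finset.univ.filter (fun v : V => F.parent v = some u ∧ u < v), F.h v

/-- The major index of a rooted forest. -/
noncomputable def maj (F : RootedForest V) : ℕ := ∑ u : V, F.hL u

/-- The comajor index of a rooted forest. -/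
noncomputable def comaj (F : RootedForest V) : ℕ := ∑ u : V, F.hR u

/-- The number of inversions: pairs `(u,v)` with `v` a descendant of `u` and `v < u`. -/
noncomputable def inv (F : RootedForest V) : ℕ :=
  {p : V × V | F.Desc p.1 p.2 ∧ p.2 < p.1}.ncard

/-- The number of coinversions: pairs `(u,v)` with `v` a descendant of `u` and `v > u`. -/
noncomputable def coinv (F : RootedForest V) : ℕ :=
  {p : V × V | F.Desc p.1 p.2 ∧ p.1 < p.2}.ncard

/-- The number of connected components (= number of roots). -/
def comps (F : RootedForest V) : ℕ :=
  (Finset.univ.filter (fun v : V => F.parent v = none)).card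

end RootedForest

/-- A `k`-forest on vertex set `Fin n` (vertices `1,…,n`): a rooted forest together with a
colour in `{0,…,k-1}` on each edge.  The colour of the edge `(parent v, v)` is recorded
at the vertex `v`; roots carry the dummy colour `0`. -/
structure KForest (n k : ℕ) extends RootedForest (Fin n) where
  colour : Fin n → ℕ
  colour_lt : ∀ v, colour v < k
  colour_root : ∀ v, parent v = none → colour v = 0

namespace KForest

variable {n k : ℕ}

/-- The chromatic depth `chr_k(F) = ∑_{(u,v) ∈ E(F)} κ(u,v)·h(v)`. -/
noncomputable def chr (F : KForest n k) : ℕ :=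
  ∑ v ∈ Finset.univ.filter (fun v : Fin n => F.parent v ≠ none),
    F.colour v * F.toRootedForest.h v

/-- The chromatic codepth `cochr_k(F) = ∑_{(u,v) ∈ E(F)} (k-1-κ(u,v))·h(v)`. -/
noncomputable def cochr (F : KForest n k) : ℕ :=
  ∑ v ∈ Finset.univ.filter (fun v : Fin n => F.parent v ≠ none),
    (k - 1 - F.colour v) * F.toRootedForest.h v

/-- `maj_k = maj + chr_k`. -/
noncomputable def majk (F : KForest n k) : ℕ := F.toRootedForest.maj + F.chr

/-- `comaj_k = comaj + cochr_k`. -/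
noncomputable def comajk (F : KForest n k) : ℕ := F.toRootedForest.comaj + F.cochr

/-- `inv_k = inv + chr_k`. -/
noncomputable def invk (F : KForest n k) : ℕ := F.toRootedForest.inv + F.chr

/-- `coinv_k = coinv + cochr_k`. -/
noncomputable def coinvk (F : KForest n k) : ℕ := F.toRootedForest.coinv + F.cochr

end KForest

/-- A minimal factorization of the long cycle `(0 1 ⋯ n)` on `{0,1,…,n}` into `n`
transpositions `(aᵢ bᵢ)` with `aᵢ < bᵢ`, multiplied left to right (the leftmost factor
is applied first, which corresponds to the reversed product in Mathlib's convention). -/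
structure MinFact (n : ℕ) where
  a : Fin n → Fin (n+1)
  b : Fin n → Fin (n+1)
  ab_lt : ∀ i, a i < b i
  prod_eq : (List.ofFn (fun i => Equiv.swap (a i) (b i))).reverse.prod = finRotate (n+1)

namespace MinFact

variable {n : ℕ}

/-- `area(f) = C(n,2) - ∑ aᵢ`. -/
def area (f : MinFact n) : ℤ := (n.choose 2 : ℤ) - ∑ i : Fin n, ((f.a i : ℕ) : ℤ)

/-- `coarea(f) = ∑ (bᵢ - 1) - C(n,2)`. -/
def coarea (f : MinFact n) : ℤ :=
  (∑ i : Fin n, (((f.b i : ℕ) : ℤ) - 1)) - (n.choose 2 : ℤ)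

end MinFact

/-- A minimal `k`-factorization of the long cycle `(0 1 ⋯ kn)` on `{0,1,…,kn}` into `n`
cycles of length `k+1`: the `j`-th factor is the cycle `(a j 0, a j 1, …, a j k)`
(sending `a j 0 ↦ a j 1 ↦ ⋯ ↦ a j k ↦ a j 0`), presented with its least element first,
and the factors are multiplied left to right (leftmost applied first). -/
structure MinKFact (n k : ℕ) where
  a : Fin n → Fin (k+1) → Fin (k*n+1)
  inj : ∀ j, Function.Injective (a j)
  min_first : ∀ j i, a j 0 ≤ a j i
  prod_eq :
    (List.ofFn (fun j => (List.ofFn (a j)).formPerm)).reverse.prod = finRotate (k*n+1)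

namespace MinKFact

variable {n k : ℕ}

/-- `area_k(f) = C(kn,2) - n·C(k,2) - k·∑_j a_j^0`. -/
def areak (f : MinKFact n k) : ℤ :=
  ((k*n).choose 2 : ℤ) - n * (k.choose 2 : ℤ) - k * ∑ j : Fin n, ((f.a j 0 : ℕ) : ℤ)

/-- `coarea_k(f) = k·∑_j (a_j^k - 1) - C(kn,2) - n·C(k,2)`. -/
def coareak (f : MinKFact n k) : ℤ :=
  k * (∑ j : Fin n, (((f.a j (Fin.last k) : ℕ) : ℤ) - 1))
    - ((k*n).choose 2 : ℤ) - n * (k.choose 2 : ℤ)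

/-- `semiarea_k(f) = C(kn,2) - ∑_{i=0}^{k-1} ∑_j a_j^i`. -/
def semiareak (f : MinKFact n k) : ℤ :=
  ((k*n).choose 2 : ℤ) - ∑ i : Fin k, ∑ j : Fin n, ((f.a j i.castSucc : ℕ) : ℤ)

/-- `cosemiarea_k(f) = ∑_{i=1}^{k} ∑_j (a_j^i - 1) - C(kn,2)`. -/
def cosemiareak (f : MinKFact n k) : ℤ :=
  (∑ i : Fin k, ∑ j : Fin n, (((f.a j i.succ : ℕ) : ℤ) - 1)) - ((k*n).choose 2 : ℤ)

end MinKFact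

/-- `p` is a `k`-parking function: its nondecreasing rearrangement `b = p ∘ sort p`
satisfies `b i ≤ k * i` (with 0-indexed `i`, matching `bᵢ ≤ k(i-1)` for 1-indexed `i`). -/
def IsParkingFunction (k : ℕ) {n : ℕ} (p : Fin n → ℕ) : Prop :=
  ∀ i : Fin n, p (Tuple.sort p i) ≤ k * i

/-- The displacement `disp_k(p) = k·C(n,2) - ∑ᵢ aᵢ` of a `k`-parking function. -/
def dispk (k : ℕ) {n : ℕ} (p : Fin n → ℕ) : ℤ :=
  k * (n.choose 2 : ℤ) - ∑ i : Fin n, (p i : ℤ)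


namespace RootedForest

section basics

open scoped Classical

variable {n : ℕ} (F : RootedForest (Fin n))

/-- `F.anc v u` : `u` is a weak ancestor of `v`, i.e. `v ∈ hook u`. -/
def anc (v u : Fin n) : Prop := Relation.ReflTransGen (fun a b => F.parent a = some b) v u

theorem anc_refl (v : Fin n) : F.anc v v := Relation.ReflTransGen.refl

theorem anc_iff (v u : Fin n) : F.anc v u ↔ v = u ∨ F.Desc u v := by
  unfold anc Desc
  rw [Relation.reflTransGen_iff_eq_or_transGen]
  constructor <;> rintro (h | h) <;> simp [h]

theorem desc_iff (u v : Fin n) : F.Desc u v ↔ ∃ c, F.anc v c ∧ F.parent c = some u := by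
  unfold anc Desc
  rw [Relation.TransGen.tail'_iff]

theorem anc_tail {v c u : Fin n} (h : F.anc v c) (hc : F.parent c = some u) : F.anc v u :=
  Relation.ReflTransGen.tail h hc

theorem anc_trans {v c u : Fin n} (h : F.anc v c) (hc : F.anc c u) : F.anc v u :=
  Relation.ReflTransGen.trans h hc

theorem anc_antisymm {v u : Fin n} (h : F.anc v u) (h' : F.anc u v) : v = u := by
  rw [anc_iff] at h
  rcases h with h | h
  · exact h
  · exact absurd (Relation.TransGen.trans_left h h') (F.acyclic v)

theorem not_anc_parent {c u : Fin n} (hc : F.parent c = some u) : ¬ F.anc u c := by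
  intro h
  exact F.acyclic u (Relation.TransGen.tail' h hc)

theorem anc_total {v a b : Fin n} (ha : F.anc v a) (hb : F.anc v b) : F.anc a b ∨ F.anc b a := by
  refine Relation.ReflTransGen.total_of_right_unique ?_ ha hb
  intro x y z hy hz
  rw [hy] at hz
  exact Option.some.inj hz

theorem sib_anc {a b : Fin n} (hp : F.parent a = F.parent b) (h : F.anc a b) : a = b := by
  rcases (Relation.ReflTransGen.cases_head_iff.1 h) with h | ⟨c, hc, hcb⟩
  · exact h
  · exfalso
    have hb : F.parent b = some c := by rw [← hp]; exact hc
    exact F.not_anc_parent hb hcb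

theorem sib_unique {v a b : Fin n} (hp : F.parent a = F.parent b) (ha : F.anc v a)
    (hb : F.anc v b) : a = b := by
  rcases F.anc_total ha hb with h | h
  · exact F.sib_anc hp h
  · exact (F.sib_anc hp.symm h).symm

theorem parent_induction (P : Fin n → Prop)
    (root : ∀ v, F.parent v = none → P v)
    (step : ∀ v u, F.parent v = some u → P u → P v) : ∀ v, P v := by
  have wf : WellFounded (fun a b : Fin n => F.Desc a b) := by
    have : IsTrans (Fin n) (fun a b : Fin n => F.Desc a b) :=
      ⟨fun a b c h1 h2 => Relation.TransGen.trans h2 h1⟩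
    have : Std.Irrefl (fun a b : Fin n => F.Desc a b) := ⟨fun a h => F.acyclic a h⟩
    exact Finite.wellFounded_of_trans_of_irrefl _
  intro v
  induction v using wf.induction with
  | _ v ih =>
    rcases hv : F.parent v with _ | u
    · exact root v hv
    · exact step v u hv (ih u (Relation.TransGen.single hv))

theorem exists_root (v : Fin n) : ∃ r, F.parent r = none ∧ F.anc v r := by
  refine F.parent_induction (fun v => ∃ r, F.parent r = none ∧ F.anc v r) ?_ ?_ v
  · exact fun v hv => ⟨v, hv, F.anc_refl v⟩
  · rintro v u hv ⟨r, hr, hur⟩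
    exact ⟨r, hr, Relation.ReflTransGen.head hv hur⟩

theorem h_eq (u : Fin n) : F.h u = ∑ v, if F.anc v u then 1 else 0 := by
  unfold h hook
  rw [Finset.sum_boole, Set.ncard_eq_toFinset_card']
  simp only [Nat.cast_id]
  congr 1
  ext v
  simp [anc_iff]

theorem sum_children_root : ∑ c with F.parent c = none, F.h c = n := by
  simp only [h_eq]
  rw [Finset.sum_comm]
  have : ∀ v : Fin n, (∑ c with F.parent c = none, if F.anc v c then 1 else 0) = 1 := by
    intro v
    obtain ⟨r, hr, hvr⟩ := F.exists_root v
    rw [Finset.sum_eq_single r]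
    · simp [hvr]
    · intro b hb hbr
      rw [if_neg]
      intro hvb
      exact hbr (F.sib_unique (by simp at hb; rw [hb, hr]) hvb hvr)
    · intro h; simp [hr] at h
  simp [this]

theorem sum_children (u : Fin n) : (∑ c with F.parent c = some u, F.h c) + 1 = F.h u := by
  simp only [h_eq]
  rw [Finset.sum_comm]
  have : ∀ v : Fin n, (∑ c with F.parent c = some u, if F.anc v c then 1 else 0)
      + (if v = u then 1 else 0) = if F.anc v u then 1 else 0 := by
    intro v
    by_cases hvu : v = u
    · subst hvu
      rw [Finset.sum_eq_zero]
      · simp [F.anc_refl]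
      · intro c hc
        rw [if_neg]
        exact F.not_anc_parent (by simpa using hc)
    · rw [if_neg hvu]
      by_cases hd : F.anc v u
      · rw [if_pos hd]
        have := (F.anc_iff v u).1 hd
        obtain ⟨r, hvr, hr⟩ := (F.desc_iff u v).1 (this.resolve_left hvu)
        rw [Finset.sum_eq_single r]
        · simp [hvr]
        · intro b hb hbr
          rw [if_neg]
          intro hvb
          exact hbr (F.sib_unique (by simp at hb; rw [hb, hr]) hvb hvr)
        · intro h; simp [hr] at h
      · rw [if_neg hd, Finset.sum_eq_zero]
        intro c hc
        rw [if_neg]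
        intro hvc
        exact hd (F.anc_tail hvc (by simpa using hc))
  rw [← Finset.sum_congr rfl (fun v _ => this v), Finset.sum_add_distrib]
  simp

theorem h_pos (u : Fin n) : 0 < F.h u := by
  rw [← F.sum_children u]; omega

/-- sum over all vertices, grouped by parent -/
theorem sum_by_parent (g : Fin n → ℤ) :
    ∑ c, g c = (∑ c with F.parent c = none, g c) + ∑ u, ∑ c with F.parent c = some u, g c := by
  have h1 : ∑ c, g c = ∑ q : Option (Fin n), ∑ c with F.parent c = q, g c := by
    rw [Finset.sum_fiberwise]
  rw [h1, Fintype.sum_option]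

/-- the value of `g` at the parent, `0` at roots. -/
def atParent (g : Fin n → ℤ) (v : Fin n) : ℤ := (F.parent v).elim 0 g

theorem telescope (g : Fin n → ℤ) :
    ∑ c, (F.h c : ℤ) * (g c - F.atParent g c) = ∑ c, g c := by
  simp only [mul_sub, Finset.sum_sub_distrib]
  rw [F.sum_by_parent (fun c => (F.h c : ℤ) * F.atParent g c)]
  rw [Finset.sum_eq_zero (s := Finset.univ.filter (fun c => F.parent c = none))]
  · have : ∀ u, (∑ c with F.parent c = some u, (F.h c : ℤ) * F.atParent g c)
        = (F.h u : ℤ) * g u - g u := by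
      intro u
      have h1 : (F.h u : ℤ) = (∑ c with F.parent c = some u, (F.h c : ℤ)) + 1 := by
        rw [← F.sum_children u]; push_cast; rfl
      rw [h1, add_mul, Finset.sum_mul, one_mul, add_sub_cancel_right]
      apply Finset.sum_congr rfl
      intro c hc
      have hc : F.parent c = some u := by simpa using hc
      simp [atParent, hc]
    simp only [this, Finset.sum_sub_distrib]
    ring
  · intro c hc
    have hc : F.parent c = none := by simpa using hc
    simp [atParent, hc]

theorem sum_nonroot_h :
    (∑ v with F.parent v ≠ none, (F.h v : ℤ)) = ∑ u, ((F.h u : ℤ) - 1) := by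
  have h := F.sum_by_parent (fun c => if F.parent c ≠ none then (F.h c : ℤ) else 0)
  rw [Finset.sum_filter, h, Finset.sum_eq_zero, zero_add]
  · apply Finset.sum_congr rfl
    intro u _
    rw [← F.sum_children u]
    push_cast
    rw [add_sub_cancel_right]
    apply Finset.sum_congr rfl
    intro c hc
    have hc : F.parent c = some u := by simpa using hc
    simp [hc]
  · intro c hc
    have hc : F.parent c = none := by simpa using hc
    simp [hc]

end basics

end RootedForest


namespace RootedForest

section rotation

open scoped Classical

variable {n : ℕ} (F : RootedForest (Fin n))

/-- local major index at `u` of the labelling `w` -/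
noncomputable def majv (w : Equiv.Perm (Fin n)) (u : Fin n) : ℤ :=
  ∑ v with F.parent v = some u, if w v < w u then (F.h v : ℤ) else 0

/-- local inversion number at `u` of the labelling `w` -/
noncomputable def invv (w : Equiv.Perm (Fin n)) (u : Fin n) : ℤ :=
  ∑ v, if F.Desc u v ∧ w v < w u then (1 : ℤ) else 0

/-- rotated key -/
def rkey (x s : Fin n) : ℕ := if s < x then s.val + n else s.val

theorem rkey_inj (x : Fin n) : Function.Injective (rkey x) := by
  intro s t h
  unfold rkey at h
  have := s.isLt
  have := t.isLt
  ext
  split_ifs at h <;> omega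

theorem rot_exists (S : Finset (Fin n)) (x : Fin n) : ∃ r : Equiv.Perm (Fin n),
    (∀ s, s ∉ S → r s = s) ∧ (∀ s, s ∈ S → r s ∈ S) ∧
    (∀ s ∈ S, ∀ t ∈ S, (r s < r t ↔ rkey x s < rkey x t)) := by
  let S' : Finset ℕ := S.image (rkey x)
  have hc : S'.card = S.card := Finset.card_image_of_injective _ (rkey_inj x)
  let i1 := S'.orderIsoOfFin hc
  let i2 := S.orderIsoOfFin rfl
  let e0 : S → S' := fun s => ⟨rkey x s.1, Finset.mem_image_of_mem _ s.2⟩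
  have he0 : Function.Bijective e0 := by
    constructor
    · intro s t h
      exact Subtype.ext (rkey_inj x (congrArg Subtype.val h))
    · rintro ⟨y, hy⟩
      obtain ⟨s, hs, rfl⟩ := Finset.mem_image.1 hy
      exact ⟨⟨s, hs⟩, rfl⟩
  let e : Equiv.Perm S := (Equiv.ofBijective e0 he0).trans (i1.symm.toEquiv.trans i2.toEquiv)
  have key : ∀ s t : S, e s < e t ↔ rkey x s.1 < rkey x t.1 := by
    intro s t
    show i2 (i1.symm (e0 s)) < i2 (i1.symm (e0 t)) ↔ _
    rw [OrderIso.lt_iff_lt, OrderIso.lt_iff_lt]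
    rfl
  refine ⟨Equiv.Perm.ofSubtype e, ?_, ?_, ?_⟩
  · intro s hs
    exact Equiv.Perm.ofSubtype_apply_of_not_mem e hs
  · intro s hs
    rw [Equiv.Perm.ofSubtype_apply_of_mem e hs]
    exact (e ⟨s, hs⟩).2
  · intro s hs t ht
    rw [Equiv.Perm.ofSubtype_apply_of_mem e hs, Equiv.Perm.ofSubtype_apply_of_mem e ht]
    exact key ⟨s, hs⟩ ⟨t, ht⟩

noncomputable def rot (S : Finset (Fin n)) (x : Fin n) : Equiv.Perm (Fin n) :=
  (rot_exists S x).choose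

theorem rot_of_notMem {S : Finset (Fin n)} {x s : Fin n} (hs : s ∉ S) : rot S x s = s :=
  (rot_exists S x).choose_spec.1 s hs

theorem rot_mem {S : Finset (Fin n)} {x s : Fin n} (hs : s ∈ S) : rot S x s ∈ S :=
  (rot_exists S x).choose_spec.2.1 s hs

theorem rot_mem_iff {S : Finset (Fin n)} {x s : Fin n} : rot S x s ∈ S ↔ s ∈ S := by
  constructor
  · intro h
    by_contra hs
    rw [rot_of_notMem hs] at h
    exact hs h
  · exact rot_mem

theorem rot_lt {S : Finset (Fin n)} {x s t : Fin n} (hs : s ∈ S) (ht : t ∈ S) :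
    rot S x s < rot S x t ↔ rkey x s < rkey x t :=
  (rot_exists S x).choose_spec.2.2 s hs t ht

/-- labels below `u` -/
noncomputable def lset (u : Fin n) (w : Equiv.Perm (Fin n)) : Finset (Fin n) :=
  Finset.univ.filter (fun x => F.Desc u (w.symm x))

theorem mem_lset {u : Fin n} {w : Equiv.Perm (Fin n)} {x : Fin n} :
    x ∈ F.lset u w ↔ F.Desc u (w.symm x) := by simp [lset]

theorem not_desc_self (u : Fin n) : ¬ F.Desc u u := F.acyclic u

theorem label_notMem_lset (u : Fin n) (w : Equiv.Perm (Fin n)) : w u ∉ F.lset u w := by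
  simp [mem_lset, not_desc_self]

/-- the rotated labelling -/
noncomputable def rotw (u : Fin n) (w : Equiv.Perm (Fin n)) : Equiv.Perm (Fin n) :=
  w.trans (rot (F.lset u w) (w u))

theorem rotw_apply (u : Fin n) (w : Equiv.Perm (Fin n)) (v : Fin n) :
    F.rotw u w v = rot (F.lset u w) (w u) (w v) := rfl

theorem rotw_of_not_desc {u : Fin n} {w : Equiv.Perm (Fin n)} {v : Fin n} (hv : ¬ F.Desc u v) :
    F.rotw u w v = w v := by
  rw [rotw_apply, rot_of_notMem]
  simpa [mem_lset] using hv

theorem rotw_self (u : Fin n) (w : Equiv.Perm (Fin n)) : F.rotw u w u = w u :=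
  F.rotw_of_not_desc (F.not_desc_self u)

theorem lset_of_comp (u : Fin n) (w r : Equiv.Perm (Fin n))
    (hr : ∀ x, r x ∈ F.lset u w ↔ x ∈ F.lset u w) : F.lset u (w.trans r) = F.lset u w := by
  ext x
  have := hr (r.symm x)
  rw [Equiv.apply_symm_apply] at this
  rw [this, mem_lset, mem_lset]
  rfl

/-- rotation at `u` as a bijection on labellings -/
noncomputable def rotE (u : Fin n) : Equiv.Perm (Fin n) ≃ Equiv.Perm (Fin n) where
  toFun w := F.rotw u w
  invFun w := w.trans (rot (F.lset u w) (w u)).symm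
  left_inv w := by
    have h1 : F.lset u (F.rotw u w) = F.lset u w :=
      F.lset_of_comp u w _ (fun x => rot_mem_iff)
    have h2 := F.rotw_self u w
    show (F.rotw u w).trans (rot (F.lset u (F.rotw u w)) ((F.rotw u w) u)).symm = w
    rw [h1, h2]
    ext v
    simp [rotw_apply]
  right_inv w := by
    have hr : ∀ x, (rot (F.lset u w) (w u)).symm x ∈ F.lset u w ↔ x ∈ F.lset u w := by
      intro x
      rw [← rot_mem_iff (x := w u), Equiv.apply_symm_apply]
    have h1 := F.lset_of_comp u w (rot (F.lset u w) (w u)).symm hr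
    have h2 : (w.trans (rot (F.lset u w) (w u)).symm) u = w u := by
      rw [Equiv.trans_apply, Equiv.symm_apply_eq]
      exact (rot_of_notMem (F.label_notMem_lset u w)).symm
    show F.rotw u (w.trans (rot (F.lset u w) (w u)).symm) = w
    unfold rotw
    rw [h1, h2]
    ext v
    simp

theorem rotE_apply (u : Fin n) (w : Equiv.Perm (Fin n)) : F.rotE u w = F.rotw u w := rfl

theorem rotw_lt {u : Fin n} {w : Equiv.Perm (Fin n)} {a b : Fin n} (ha : F.Desc u a)
    (hb : F.Desc u b) : F.rotw u w a < F.rotw u w b ↔ rkey (w u) (w a) < rkey (w u) (w b) := by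
  rw [rotw_apply, rotw_apply, rot_lt] <;> simpa [mem_lset]

theorem desc_of_child {u z c : Fin n} (hz : F.Desc u z) (hc : F.parent c = some z) :
    F.Desc u c := Relation.TransGen.head hc hz

theorem desc_iff_of_desc {u z v : Fin n} (hv : F.Desc u v) (hz : ¬ F.Desc u z) :
    F.Desc z v ↔ F.anc u z := by
  constructor
  · intro h
    rcases F.anc_total ((F.anc_iff v z).2 (Or.inr h)) ((F.anc_iff v u).2 (Or.inr hv)) with h1 | h1
    · rcases (F.anc_iff _ _).1 h1 with h2 | h2
      · rw [h2]; exact F.anc_refl u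
      · exact absurd h2 hz
    · exact h1
  · intro h
    exact Relation.TransGen.trans_left hv h

theorem desc_parent_iff {u c z : Fin n} (hc : F.parent c = some z) :
    F.Desc u c ↔ z = u ∨ F.Desc u z := by
  constructor
  · intro h
    rcases Relation.TransGen.head'_iff.1 h with ⟨y, hy, hyu⟩
    rw [hc] at hy
    have := Option.some.inj hy
    subst this
    exact (F.anc_iff _ _).1 hyu
  · rintro (rfl | h)
    · exact Relation.TransGen.single hc
    · exact F.desc_of_child h hc

theorem not_desc_root {u c : Fin n} (hc : F.parent c = none) : ¬ F.Desc u c := by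
  intro h
  rcases Relation.TransGen.head'_iff.1 h with ⟨y, hy, _⟩
  rw [hc] at hy
  cases hy

theorem majv_rotw_of {u z : Fin n} (w : Equiv.Perm (Fin n)) (h1 : z ≠ u) (h2 : ¬ F.Desc u z) :
    F.majv (F.rotw u w) z = F.majv w z := by
  unfold majv
  apply Finset.sum_congr rfl
  intro c hc
  have hc : F.parent c = some z := by simpa using hc
  rw [F.rotw_of_not_desc h2, F.rotw_of_not_desc]
  rw [F.desc_parent_iff hc]
  tauto

theorem invv_rotw_of {u z : Fin n} (w : Equiv.Perm (Fin n)) (h2 : ¬ F.Desc u z) :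
    F.invv (F.rotw u w) z = F.invv w z := by
  unfold invv
  rw [F.rotw_of_not_desc h2]
  let π : Equiv.Perm (Fin n) := (F.rotw u w).trans w.symm
  have hπ : ∀ v, F.rotw u w v = w (π v) := by intro v; simp [π]
  rw [← Equiv.sum_comp π (fun v => if F.Desc z v ∧ w v < w z then (1 : ℤ) else 0)]
  apply Finset.sum_congr rfl
  intro v _
  rw [hπ]
  have : F.Desc z v ↔ F.Desc z (π v) := by
    by_cases hv : F.Desc u v
    · have : F.Desc u (π v) := by
        have : F.rotw u w v ∈ F.lset u w := by
          rw [rotw_apply, rot_mem_iff]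
          simpa [mem_lset] using hv
        exact F.mem_lset.1 this
      rw [F.desc_iff_of_desc hv h2, F.desc_iff_of_desc this h2]
    · have : π v = v := by
        show w.symm (F.rotw u w v) = v
        rw [F.rotw_of_not_desc hv]; simp
      rw [this]
  rw [this]

theorem sum_majv (w : Equiv.Perm (Fin n)) (u : Fin n) :
    ∑ z, F.majv w z = F.invv w u + ∑ z, if z = u then 0 else F.majv (F.rotw u w) z := by
  let g : Fin n → ℤ := fun v => if F.Desc u v ∧ w v < w u then 1 else 0
  have ht := F.telescope g
  have hi : F.invv w u = ∑ c, g c := rfl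
  rw [hi, ← ht, F.sum_by_parent (fun c => (F.h c : ℤ) * (g c - F.atParent g c))]
  rw [Finset.sum_eq_zero (s := Finset.univ.filter (fun c => F.parent c = none)), zero_add,
    ← Finset.sum_add_distrib]
  · apply Finset.sum_congr rfl
    intro z _
    by_cases hzu : z = u
    · rw [if_pos hzu, add_zero]
      subst hzu
      unfold majv
      apply Finset.sum_congr rfl
      intro c hc
      have hc : F.parent c = some z := by simpa using hc
      have hd : F.Desc z c := Relation.TransGen.single hc
      simp [atParent, hc, g, hd, F.not_desc_self]
    · rw [if_neg hzu]
      unfold majv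
      rw [← Finset.sum_add_distrib]
      apply Finset.sum_congr rfl
      intro c hc
      have hc : F.parent c = some z := by simpa using hc
      have hdc : F.Desc u c ↔ F.Desc u z := by
        rw [F.desc_parent_iff hc]; tauto
      by_cases hd : F.Desc u z
      · have hd' := hdc.2 hd
        have hne : ∀ v, F.Desc u v → w v ≠ w u := by
          intro v hv h
          rw [w.injective h] at hv
          exact F.not_desc_self u hv
        have h1 := hne z hd
        have h2 := hne c hd'
        simp only [F.rotw_lt hd' hd, atParent, hc, g, hd, hd', true_and, Option.elim]
        have := (w z).isLt
        have := (w c).isLt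
        unfold rkey
        simp only [Fin.lt_def, ne_eq, Fin.ext_iff] at *
        split_ifs <;> omega
      · have hd' : ¬ F.Desc u c := fun h => hd (hdc.1 h)
        rw [F.rotw_of_not_desc hd, F.rotw_of_not_desc hd']
        simp [atParent, hc, g, hd, hd']
  · intro c hc
    have hc : F.parent c = none := by simpa using hc
    simp [atParent, hc, g, F.not_desc_root hc]

theorem h_lt_parent {c u : Fin n} (hc : F.parent c = some u) : F.h c < F.h u := by
  rw [← F.sum_children u]
  have : F.h c ≤ ∑ c with F.parent c = some u, F.h c :=
    Finset.single_le_sum (f := F.h) (fun _ _ => Nat.zero_le _) (by simpa using hc)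
  omega

theorem h_lt_desc {c u : Fin n} (hc : F.Desc u c) : F.h c < F.h u := by
  induction hc with
  | single h => exact F.h_lt_parent h
  | tail _ h ih => exact ih.trans (F.h_lt_parent h)

theorem exists_psi (m : ℕ) : ∀ (U : Finset (Fin n)), U.card = m →
    (∀ v ∈ U, ∀ u, F.parent v = some u → u ∈ U) →
    ∃ Ψ : Equiv.Perm (Fin n) ≃ Equiv.Perm (Fin n), ∀ w,
      (∑ z, if z ∈ U then F.invv (Ψ w) z else F.majv (Ψ w) z) = ∑ z, F.majv w z := by
  induction m with
  | zero =>
    intro U hU _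
    rw [Finset.card_eq_zero] at hU
    subst hU
    exact ⟨Equiv.refl _, fun w => by simp⟩
  | succ m ih =>
    intro U hU hup
    have hne : U.Nonempty := by
      rw [← Finset.card_pos]; omega
    obtain ⟨u, huU, hmin⟩ := Finset.exists_min_image U F.h hne
    have hnd : ∀ v ∈ U, ¬ F.Desc u v := fun v hv hd =>
      absurd (F.h_lt_desc hd) (not_lt.2 (hmin v hv))
    obtain ⟨Ψ, hΨ⟩ := ih (U.erase u) (by rw [Finset.card_erase_of_mem huU, hU]; rfl) (by
      intro v hv z hz
      have hvU := Finset.mem_of_mem_erase hv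
      refine Finset.mem_erase.2 ⟨?_, hup v hvU z hz⟩
      rintro rfl
      exact hnd v hvU (Relation.TransGen.single hz))
    refine ⟨Ψ.trans (F.rotE u), fun w => ?_⟩
    rw [← hΨ w]
    show (∑ z, if z ∈ U then F.invv (F.rotw u (Ψ w)) z else F.majv (F.rotw u (Ψ w)) z) = _
    generalize Ψ w = x
    have hs := F.sum_majv x u
    have hi : F.invv x u = F.invv (F.rotw u x) u := (F.invv_rotw_of x (F.not_desc_self u)).symm
    have e1 : ∀ z, (if z ∈ U then F.invv (F.rotw u x) z else F.majv (F.rotw u x) z) =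
        (if z ∈ U.erase u then F.invv x z else F.majv x z) - F.majv x z
        + (if z = u then F.invv x u else 0) + (if z = u then 0 else F.majv (F.rotw u x) z) := by
      intro z
      by_cases hzu : z = u
      · subst hzu
        simp [huU, hi]
      · by_cases hzU : z ∈ U
        · simp [hzU, hzu, F.invv_rotw_of x (hnd z hzU), F.majv_rotw_of x hzu (hnd z hzU)]
        · simp [hzU, hzu]
    rw [Finset.sum_congr rfl (fun z _ => e1 z), Finset.sum_add_distrib, Finset.sum_add_distrib,
      Finset.sum_sub_distrib, hs, Finset.sum_ite_eq' Finset.univ u]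
    simp only [Finset.mem_univ, if_true]
    ring

theorem exists_inv_maj : ∃ Ψ : Equiv.Perm (Fin n) ≃ Equiv.Perm (Fin n), ∀ w,
      (∑ z, F.invv (Ψ w) z) = ∑ z, F.majv w z := by
  obtain ⟨Ψ, h⟩ := F.exists_psi _ Finset.univ rfl (fun _ _ _ _ => Finset.mem_univ _)
  exact ⟨Ψ, fun w => by simpa using h w⟩

end rotation

end RootedForest


section permLabs

open scoped Classical

variable {n k : ℕ}

theorem KForest.ext' {F G : KForest n k} (h1 : F.parent = G.parent) (h2 : F.colour = G.colour) :
    F = G := by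
  obtain ⟨⟨p, hp⟩, c, hc, hr⟩ := F
  obtain ⟨⟨p', hp'⟩, c', hc', hr'⟩ := G
  simp only at h1 h2
  subst h1 h2
  rfl

instance KForest.instFinite : Finite (KForest n k) := by
  let f : KForest n k → (Fin n → Option (Fin n)) × (Fin n → Fin k) :=
    fun F => (F.parent, fun v => ⟨F.colour v, F.colour_lt v⟩)
  apply Finite.of_injective f
  intro F G h
  apply KForest.ext'
  · exact congrArg Prod.fst h
  · funext v
    exact congrArg (fun x : Fin k => x.val) (congrFun (congrArg Prod.snd h) v)

theorem permLab_rel (p : Fin n → Option (Fin n)) (w : Equiv.Perm (Fin n)) (a b : Fin n) :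
    (p (w.symm a)).map w = some b ↔ p (w.symm a) = some (w.symm b) := by
  rw [Option.map_eq_some_iff]
  constructor
  · rintro ⟨x, hx, rfl⟩
    simpa using hx
  · intro h
    exact ⟨_, h, by simp⟩

theorem permLab_transGen (p : Fin n → Option (Fin n)) (w : Equiv.Perm (Fin n)) (a b : Fin n) :
    Relation.TransGen (fun a b : Fin n => (p (w.symm a)).map w = some b) a b ↔
    Relation.TransGen (fun a b : Fin n => p a = some b) (w.symm a) (w.symm b) := by
  constructor
  · intro h
    exact Relation.TransGen.lift (p := fun a b : Fin n => p a = some b) w.symm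
      (fun x y hxy => (permLab_rel p w x y).1 hxy) _ _ h
  · intro h
    have := Relation.TransGen.lift (p := fun a b : Fin n => (p (w.symm a)).map w = some b) w
      (fun x y hxy => (permLab_rel p w _ _).2 (by simpa using hxy)) _ _ h
    simpa [Function.onFun] using this

/-- permLab a `k`-forest along a permutation of the vertices -/
def KForest.permLab (F : KForest n k) (w : Equiv.Perm (Fin n)) : KForest n k where
  parent v := (F.parent (w.symm v)).map w
  acyclic v h := F.acyclic _ ((permLab_transGen F.parent w v v).1 h)
  colour v := F.colour (w.symm v)
  colour_lt v := F.colour_lt _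
  colour_root v hv := F.colour_root _ (by simpa using hv)

namespace KForest

variable (F : KForest n k) (w : Equiv.Perm (Fin n))

theorem permLab_parent_iff (a b : Fin n) :
    (F.permLab w).parent a = some b ↔ F.parent (w.symm a) = some (w.symm b) :=
  permLab_rel _ _ _ _

theorem permLab_desc (u v : Fin n) :
    (F.permLab w).toRootedForest.Desc u v ↔ F.toRootedForest.Desc (w.symm u) (w.symm v) :=
  permLab_transGen _ _ _ _

theorem permLab_h (u : Fin n) :
    (F.permLab w).toRootedForest.h u = F.toRootedForest.h (w.symm u) := by
  rw [RootedForest.h_eq, RootedForest.h_eq, ← Equiv.sum_comp w]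
  apply Finset.sum_congr rfl
  intro v _
  simp only [RootedForest.anc_iff, permLab_desc, Equiv.symm_apply_apply, Equiv.eq_symm_apply]

theorem permLab_colour (u : Fin n) : (F.permLab w).colour u = F.colour (w.symm u) := rfl

theorem chr_eq (F : KForest n k) :
    F.chr = ∑ v, F.colour v * F.toRootedForest.h v := by
  unfold chr
  rw [Finset.sum_filter]
  apply Finset.sum_congr rfl
  intro v _
  split_ifs with h
  · rfl
  · rw [F.colour_root v (by simpa using h)]; simp

theorem permLab_chr : (F.permLab w).chr = F.chr := by
  rw [chr_eq, chr_eq, ← Equiv.sum_comp w]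
  simp [permLab_h, permLab_colour]

theorem permLab_cochr : (F.permLab w).cochr = F.cochr := by
  unfold cochr
  rw [Finset.sum_filter, Finset.sum_filter, ← Equiv.sum_comp w]
  apply Finset.sum_congr rfl
  intro v _
  have hp : (F.permLab w).parent (w v) ≠ none ↔ F.parent v ≠ none := by simp [permLab]
  rw [permLab_h, permLab_colour]
  simp [hp]

theorem permLab_bij : Function.Bijective (fun F : KForest n k => F.permLab w) := by
  rw [Function.bijective_iff_has_inverse]
  refine ⟨fun F => F.permLab w.symm, ?_, ?_⟩
  · intro F
    apply KForest.ext'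
    · funext v
      simp [permLab]
    · funext v
      simp [permLab]
  · intro F
    apply KForest.ext'
    · funext v
      simp [permLab]
    · funext v
      simp [permLab]

end KForest

namespace RootedForest

theorem inv_eq (F : RootedForest (Fin n)) :
    (F.inv : ℤ) = ∑ u, ∑ v, if F.Desc u v ∧ v < u then (1 : ℤ) else 0 := by
  unfold inv
  rw [Set.ncard_eq_toFinset_card', ← Fintype.sum_prod_type', Finset.sum_boole]
  congr 2
  ext ⟨a, b⟩
  simp

theorem coinv_eq (F : RootedForest (Fin n)) :
    (F.coinv : ℤ) = ∑ u, ∑ v, if F.Desc u v ∧ u < v then (1 : ℤ) else 0 := by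
  unfold coinv
  rw [Set.ncard_eq_toFinset_card', ← Fintype.sum_prod_type', Finset.sum_boole]
  congr 2
  ext ⟨a, b⟩
  simp

theorem maj_eq (F : RootedForest (Fin n)) :
    (F.maj : ℤ) = ∑ u, ∑ v with F.parent v = some u, if v < u then (F.h v : ℤ) else 0 := by
  unfold maj hL
  push_cast
  apply Finset.sum_congr rfl
  intro u _
  rw [← Finset.sum_filter, Finset.filter_filter]

theorem comaj_eq (F : RootedForest (Fin n)) :
    (F.comaj : ℤ) = ∑ u, ∑ v with F.parent v = some u, if u < v then (F.h v : ℤ) else 0 := by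
  unfold comaj hR
  push_cast
  apply Finset.sum_congr rfl
  intro u _
  rw [← Finset.sum_filter, Finset.filter_filter]

theorem inv_add_coinv (F : RootedForest (Fin n)) :
    (F.inv : ℤ) + F.coinv = ∑ u, ((F.h u : ℤ) - 1) := by
  rw [inv_eq, coinv_eq, ← Finset.sum_add_distrib]
  apply Finset.sum_congr rfl
  intro u _
  rw [← Finset.sum_add_distrib, h_eq]
  push_cast
  have : (1 : ℤ) = ∑ v : Fin n, if v = u then (1 : ℤ) else 0 := by simp
  conv_rhs => rw [this]
  rw [← Finset.sum_sub_distrib]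
  apply Finset.sum_congr rfl
  intro v _
  by_cases hvu : v = u
  · subst hvu
    simp [F.anc_refl]
  · have : v < u ∨ u < v := lt_or_gt_of_ne hvu
    by_cases hd : F.Desc u v
    · rcases this with h | h <;> simp [anc_iff, hd, h, hvu, h.le]
    · simp [anc_iff, hd, hvu]

theorem maj_add_comaj (F : RootedForest (Fin n)) :
    (F.maj : ℤ) + F.comaj = ∑ u, ((F.h u : ℤ) - 1) := by
  rw [maj_eq, comaj_eq, ← Finset.sum_add_distrib]
  apply Finset.sum_congr rfl
  intro u _
  rw [← Finset.sum_add_distrib, ← F.sum_children u]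
  push_cast
  rw [add_sub_cancel_right]
  apply Finset.sum_congr rfl
  intro v hv
  have hv : F.parent v = some u := by simpa using hv
  have hne : v ≠ u := by
    rintro rfl
    exact F.not_anc_parent hv (F.anc_refl v)
  rcases lt_or_gt_of_ne hne with h | h <;> simp [h, h.le]

end RootedForest

namespace KForest

variable (F : KForest n k) (w : Equiv.Perm (Fin n))

theorem permLab_maj : ((F.permLab w).toRootedForest.maj : ℤ)
    = ∑ u, F.toRootedForest.majv w u := by
  rw [RootedForest.maj_eq, ← Equiv.sum_comp w]
  apply Finset.sum_congr rfl
  intro u _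
  unfold RootedForest.majv
  rw [Finset.sum_filter, ← Equiv.sum_comp w, Finset.sum_filter]
  apply Finset.sum_congr rfl
  intro v _
  simp [permLab_parent_iff, permLab_h]

theorem permLab_inv : ((F.permLab w).toRootedForest.inv : ℤ)
    = ∑ u, F.toRootedForest.invv w u := by
  rw [RootedForest.inv_eq, ← Equiv.sum_comp w]
  apply Finset.sum_congr rfl
  intro u _
  unfold RootedForest.invv
  rw [← Equiv.sum_comp w]
  apply Finset.sum_congr rfl
  intro v _
  simp [permLab_desc]

theorem permLab_sum_h : ∑ u, (((F.permLab w).toRootedForest.h u : ℤ) - 1)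
    = ∑ u, ((F.toRootedForest.h u : ℤ) - 1) := by
  rw [← Equiv.sum_comp w.symm (fun u => ((F.toRootedForest.h u : ℤ) - 1))]
  simp [permLab_h]

/-- statistics before -/
noncomputable def stat1 (F : KForest n k) : ℤ × ℤ × ℕ × ℕ :=
  (F.toRootedForest.maj, F.toRootedForest.comaj, F.chr, F.cochr)

/-- statistics after -/
noncomputable def stat2 (F : KForest n k) : ℤ × ℤ × ℕ × ℕ :=
  (F.toRootedForest.inv, F.toRootedForest.coinv, F.chr, F.cochr)

theorem exists_psi : ∃ Ψ : Equiv.Perm (Fin n) ≃ Equiv.Perm (Fin n), ∀ w,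
    stat2 (F.permLab (Ψ w)) = stat1 (F.permLab w) := by
  obtain ⟨Ψ, h⟩ := F.toRootedForest.exists_inv_maj
  refine ⟨Ψ, fun w => ?_⟩
  have h1 := h w
  rw [← permLab_inv, ← permLab_maj] at h1
  have h2 := (F.permLab (Ψ w)).toRootedForest.inv_add_coinv
  have h3 := (F.permLab w).toRootedForest.maj_add_comaj
  rw [permLab_sum_h] at h2 h3
  unfold stat1 stat2
  rw [permLab_chr, permLab_chr, permLab_cochr, permLab_cochr, h1]
  have : ((F.permLab (Ψ w)).toRootedForest.coinv : ℤ) = (F.permLab w).toRootedForest.comaj := by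
    linarith
  rw [this]

theorem exists_equiv_maj_inv : ∃ e : KForest n k ≃ KForest n k, ∀ F, stat2 (e F) = stat1 F := by
  have : Fintype (KForest n k) := Fintype.ofFinite _
  have key : ∀ T, Fintype.card {F : KForest n k // stat1 F = T}
      = Fintype.card {F : KForest n k // stat2 F = T} := by
    intro T
    have gen : ∀ st : KForest n k → ℤ × ℤ × ℕ × ℕ,
        ∑ F : KForest n k, ∑ w : Equiv.Perm (Fin n), (if st (F.permLab w) = T then 1 else 0)
        = Fintype.card (Equiv.Perm (Fin n)) * Fintype.card {F : KForest n k // st F = T} := by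
      intro st
      rw [Finset.sum_comm]
      have : ∀ w : Equiv.Perm (Fin n), ∑ F : KForest n k, (if st (F.permLab w) = T then 1 else 0)
          = Fintype.card {F : KForest n k // st F = T} := by
        intro w
        rw [Function.Bijective.sum_comp (permLab_bij w) (fun F => if st F = T then 1 else 0)]
        rw [Fintype.card_subtype, Finset.sum_boole]
        simp
      simp [this]
    have h1 := gen stat1
    have h2 := gen stat2
    have h3 : ∑ F : KForest n k, ∑ w : Equiv.Perm (Fin n),
          (if stat1 (F.permLab w) = T then 1 else 0)
        = ∑ F : KForest n k, ∑ w : Equiv.Perm (Fin n),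
          (if stat2 (F.permLab w) = T then 1 else 0) := by
      apply Finset.sum_congr rfl
      intro F _
      obtain ⟨Ψ, hΨ⟩ := F.exists_psi
      rw [← Equiv.sum_comp Ψ (fun w => if stat2 (F.permLab w) = T then 1 else 0)]
      simp [hΨ]
    rw [h1, h2] at h3
    exact Nat.eq_of_mul_eq_mul_left Fintype.card_pos h3
  let e := Equiv.ofFiberEquiv (f := stat1 (n := n) (k := k)) (g := stat2 (n := n) (k := k))
    (fun T => Fintype.equivOfCardEq (key T))
  exact ⟨e, fun F => Equiv.ofFiberEquiv_map _ F⟩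

end KForest

end permLabs


namespace KForest

section positions

open scoped Classical

variable {n k : ℕ} (F : KForest n k)

/-- level of a vertex among its siblings -/
def lev (c : Fin n) : ℕ :=
  match F.parent c with
  | none => 0
  | some p => 2 * (k - 1 - F.colour c) + if p < c then 1 else 0

theorem lev_root {c : Fin n} (hc : F.parent c = none) : F.lev c = 0 := by
  simp [lev, hc]

theorem lev_child {c p : Fin n} (hc : F.parent c = some p) :
    F.lev c = 2 * (k - 1 - F.colour c) + if p < c then 1 else 0 := by
  simp [lev, hc]

theorem lev_lt (hk : 1 ≤ k) (c : Fin n) : F.lev c < 2 * k := by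
  unfold lev
  split
  · omega
  · split_ifs <;> omega

theorem parent_ne {c p : Fin n} (hc : F.parent c = some p) : p ≠ c := by
  rintro rfl
  exact F.toRootedForest.not_anc_parent hc (F.toRootedForest.anc_refl _)

theorem lev_even {c p : Fin n} (hc : F.parent c = some p) (i : ℕ) (h : F.lev c = 2 * i) :
    c < p := by
  have := F.parent_ne hc
  rw [F.lev_child hc] at h
  split_ifs at h with h1
  · omega
  · exact lt_of_le_of_ne (not_lt.1 h1) this.symm

theorem lev_odd {c p : Fin n} (hc : F.parent c = some p) (i : ℕ) (h : F.lev c = 2 * i + 1) :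
    p < c := by
  rw [F.lev_child hc] at h
  split_ifs at h with h1
  · exact h1
  · omega

/-- total hook length of the children of `q` placed before `(l, t)` -/
noncomputable def Y (q : Option (Fin n)) (l t : ℕ) : ℕ :=
  ∑ c with (F.parent c = q ∧ (F.lev c < l ∨ (F.lev c = l ∧ t ≤ c.val))), F.toRootedForest.h c

theorem Y_mono (q : Option (Fin n)) {l t l' t' : ℕ} (h : l < l' ∨ (l = l' ∧ t' ≤ t)) :
    F.Y q l t ≤ F.Y q l' t' := by
  unfold Y
  apply Finset.sum_le_sum_of_subset
  intro c
  simp only [Finset.mem_filter, Finset.mem_univ, true_and]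
  rintro ⟨h1, h2⟩
  exact ⟨h1, by omega⟩

theorem Y_congr (q : Option (Fin n)) {l t l' t' : ℕ}
    (h : ∀ c, F.parent c = q → ((F.lev c < l ∨ (F.lev c = l ∧ t ≤ c.val)) ↔
      (F.lev c < l' ∨ (F.lev c = l' ∧ t' ≤ c.val)))) :
    F.Y q l t = F.Y q l' t' := by
  unfold Y
  apply Finset.sum_congr _ (fun _ _ => rfl)
  ext c
  simp only [Finset.mem_filter, Finset.mem_univ, true_and]
  exact and_congr_right (h c)

theorem Y_add (c : Fin n) :
    F.Y (F.parent c) (F.lev c) (c.val + 1) + F.toRootedForest.h c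
      = F.Y (F.parent c) (F.lev c) c.val := by
  unfold Y
  rw [add_comm, ← Finset.sum_insert]
  · apply Finset.sum_congr _ (fun _ _ => rfl)
    ext d
    simp only [Finset.mem_filter, Finset.mem_univ, true_and, Finset.mem_insert]
    constructor
    · rintro (rfl | ⟨h1, h2⟩)
      · exact ⟨rfl, by omega⟩
      · exact ⟨h1, by omega⟩
    · rintro ⟨h1, h2⟩
      by_cases hd : d = c
      · exact Or.inl hd
      · have : d.val ≠ c.val := fun h => hd (Fin.ext h)
        exact Or.inr ⟨h1, by omega⟩
  · simp

theorem Y_le_some (u : Fin n) (l t : ℕ) : F.Y (some u) l t + 1 ≤ F.toRootedForest.h u := by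
  rw [← F.toRootedForest.sum_children u]
  unfold Y
  apply Nat.succ_le_succ
  apply Finset.sum_le_sum_of_subset
  intro c
  simp only [Finset.mem_filter, Finset.mem_univ, true_and]
  exact fun h => h.1

theorem Y_le_none (l t : ℕ) : F.Y none l t ≤ n := by
  conv_rhs => rw [← F.toRootedForest.sum_children_root]
  unfold Y
  apply Finset.sum_le_sum_of_subset
  intro c
  simp only [Finset.mem_filter, Finset.mem_univ, true_and]
  exact fun h => h.1

theorem Y_top (hk : 1 ≤ k) (u : Fin n) (t : ℕ) :
    F.Y (some u) (2 * k) t + 1 = F.toRootedForest.h u := by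
  rw [← F.toRootedForest.sum_children u]
  unfold Y
  congr 1
  apply Finset.sum_congr _ (fun _ _ => rfl)
  ext c
  have := F.lev_lt hk c
  simp only [Finset.mem_filter, Finset.mem_univ, true_and]
  exact ⟨fun h => h.1, fun h => ⟨h, Or.inl this⟩⟩

theorem Y_zero (q : Option (Fin n)) : F.Y q 0 n = 0 := by
  unfold Y
  apply Finset.sum_eq_zero
  intro c
  have := c.isLt
  simp only [Finset.mem_filter, Finset.mem_univ, true_and]
  rintro ⟨_, h⟩
  omega

/-- increment of the starting position -/
noncomputable def dpos (c : Fin n) : ℕ :=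
  (F.lev c + 1) / 2 + k * F.Y (F.parent c) (F.lev c) (c.val + 1)

/-- starting position of the polygon `c` -/
noncomputable def s (c : Fin n) : ℕ := ∑ u, if F.toRootedForest.anc c u then F.dpos u else 0

/-- starting position of the parent, `0` at roots -/
noncomputable def base (q : Option (Fin n)) : ℕ := q.elim 0 F.s

theorem s_eq (c : Fin n) : F.s c = F.base (F.parent c) + F.dpos c := by
  rcases hc : F.parent c with _ | p
  · simp only [base, Option.elim, zero_add]
    unfold s
    rw [Finset.sum_eq_single c]
    · simp [F.toRootedForest.anc_refl]
    · intro u _ huc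
      rw [if_neg]
      intro h
      rcases Relation.ReflTransGen.cases_head_iff.1 h with h | ⟨y, hy, _⟩
      · exact huc h.symm
      · rw [hc] at hy; cases hy
    · simp
  · simp only [base, Option.elim]
    unfold s
    have : ∀ u, (if F.toRootedForest.anc c u then F.dpos u else 0)
        = (if F.toRootedForest.anc p u then F.dpos u else 0) + (if u = c then F.dpos c else 0) := by
      intro u
      have h1 : F.toRootedForest.anc c u ↔ c = u ∨ F.toRootedForest.anc p u := by
        constructor
        · intro h
          rcases Relation.ReflTransGen.cases_head_iff.1 h with h | ⟨y, hy, hyu⟩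
          · exact Or.inl h
          · have : F.parent c = some y := hy
            rw [hc] at this
            have := Option.some.inj this
            subst this
            exact Or.inr hyu
        · rintro (rfl | h)
          · exact F.toRootedForest.anc_refl _
          · exact Relation.ReflTransGen.head hc h
      by_cases huc : u = c
      · subst huc
        simp [F.toRootedForest.anc_refl, F.toRootedForest.not_anc_parent hc]
      · have : ¬ c = u := fun h => huc h.symm
        simp [h1, huc, this]
    rw [Finset.sum_congr rfl (fun u _ => this u), Finset.sum_add_distrib]
    simp

/-- boundary points inside the interval of `q` -/
noncomputable def pt (q : Option (Fin n)) (l t : ℕ) : ℕ := F.base q + (l + 1) / 2 + k * F.Y q l t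

theorem pt_mono (q : Option (Fin n)) {l t l' t' : ℕ} (h : l < l' ∨ (l = l' ∧ t' ≤ t)) :
    F.pt q l t + (l' + 1) / 2 ≤ F.pt q l' t' + (l + 1) / 2 := by
  have := Nat.mul_le_mul_left k (F.Y_mono q h)
  unfold pt
  omega

theorem s_pt (c : Fin n) : F.s c = F.pt (F.parent c) (F.lev c) (c.val + 1) := by
  rw [s_eq]
  unfold pt dpos
  omega

theorem e_pt (c : Fin n) : F.s c + k * F.toRootedForest.h c = F.pt (F.parent c) (F.lev c) c.val := by
  rw [s_pt]
  unfold pt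
  rw [← F.Y_add c, mul_add]
  omega

/-- the vertices of the polygon `j` -/
noncomputable def A (j : Fin n) (i : ℕ) : ℕ := F.pt (some j) (2 * i) n

theorem A_zero (j : Fin n) : F.A j 0 = F.s j := by
  unfold A pt
  simp [Y_zero, base]

theorem A_last (hk : 1 ≤ k) (j : Fin n) : F.A j k = F.s j + k * F.toRootedForest.h j := by
  unfold A pt
  rw [← F.Y_top hk j n, mul_add]
  simp only [base, Option.elim]
  omega

theorem A_lt (j : Fin n) {i i' : ℕ} (h : i < i') : F.A j i < F.A j i' := by
  have := F.pt_mono (some j) (l := 2 * i) (l' := 2 * i') (t := n) (t' := n) (by omega)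
  unfold A
  omega

theorem A_ge (j : Fin n) (i : ℕ) : F.s j ≤ F.A j i := by
  unfold A pt
  simp only [base, Option.elim]
  omega

theorem A_le (hk : 1 ≤ k) (j : Fin n) {i : ℕ} (hi : i ≤ k) :
    F.A j i ≤ F.s j + k * F.toRootedForest.h j := by
  rw [← F.A_last hk]
  rcases Nat.lt_or_eq_of_le hi with h | h
  · exact (F.A_lt j h).le
  · rw [h]

theorem kh_pos (hk : 1 ≤ k) (j : Fin n) : 0 < k * F.toRootedForest.h j :=
  Nat.mul_pos hk (F.toRootedForest.h_pos j)

theorem s_child {c u : Fin n} (hc : F.parent c = some u) :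
    F.s u + (F.lev c + 1) / 2 ≤ F.s c := by
  rw [F.s_eq c, hc]
  simp only [base, Option.elim, dpos]
  omega

theorem e_child (hk : 1 ≤ k) {c u : Fin n} (hc : F.parent c = some u) :
    F.s c + k * F.toRootedForest.h c + k
      ≤ F.s u + k * F.toRootedForest.h u + (F.lev c + 1) / 2 := by
  rw [F.e_pt c, hc, ← F.A_last hk, A]
  have := F.lev_lt hk c
  have := F.pt_mono (some u) (l := F.lev c) (l' := 2 * k) (t := c.val) (t' := n) (by omega)
  omega

theorem contain (hk : 1 ≤ k) {t u : Fin n} (h : F.toRootedForest.anc t u) :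
    F.s u ≤ F.s t ∧ F.s t + k * F.toRootedForest.h t ≤ F.s u + k * F.toRootedForest.h u := by
  induction h with
  | refl => exact ⟨le_rfl, le_rfl⟩
  | tail _ hc ih =>
    have h1 := F.s_child hc
    have h2 := F.e_child hk hc
    rename_i c _ _
    have := F.lev_lt hk c
    omega

theorem M1 (hk : 1 ≤ k) {t u : Fin n} (h : F.toRootedForest.anc t u) {i : ℕ}
    (ha : F.A t i = F.s u) : t ≤ u := by
  induction h with
  | refl => exact le_rfl
  | tail hb hc ih =>
    rename_i c v
    have h1 := F.s_child hc
    have h2 := F.contain hk hb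
    have h3 := F.A_ge t i
    exact (ih (by omega)).trans (F.lev_even hc 0 (by omega)).le

theorem M2 (hk : 1 ≤ k) {t u : Fin n} (h : F.toRootedForest.anc t u) {i : ℕ} (hi : i ≤ k)
    (ha : F.A t i = F.s u + k * F.toRootedForest.h u) : u ≤ t := by
  induction h with
  | refl => exact le_rfl
  | tail hb hc ih =>
    rename_i c v
    have h1 := F.e_child hk hc
    have h2 := F.contain hk hb
    have h3 := F.A_le hk t hi
    have h4 := F.lev_lt hk c
    exact (F.lev_odd hc (k - 1) (by omega)).le.trans (ih (by omega))

theorem M3 (hk : 1 ≤ k) (t : Fin n) {i : ℕ} (hi : i ≤ k) (j : Fin n) :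
    ¬ F.toRootedForest.anc t j →
    (F.A t i ≤ F.s j ∨ F.s j + k * F.toRootedForest.h j ≤ F.A t i) ∧
    (F.A t i = F.s j → j < t) ∧ (F.A t i = F.s j + k * F.toRootedForest.h j → t < j) := by
  -- siblings
  have sib : ∀ j c : Fin n, F.parent c = F.parent j → c ≠ j → F.toRootedForest.anc t c →
      (F.A t i ≤ F.s j ∨ F.s j + k * F.toRootedForest.h j ≤ F.A t i) ∧
      (F.A t i = F.s j → j < t) ∧ (F.A t i = F.s j + k * F.toRootedForest.h j → t < j) := by
    intro j c hcj hne htc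
    have h1 := F.contain hk htc
    have h2 := F.A_ge t i
    have h3 := F.A_le hk t hi
    have hj := F.kh_pos hk j
    have sj := F.s_pt j
    have ej := F.e_pt j
    have sc := F.s_pt c
    have ec := F.e_pt c
    rw [hcj] at sc ec
    have hne' : c.val ≠ j.val := fun h => hne (Fin.ext h)
    have eq_case : ∀ x y : Fin n, F.parent x = F.parent y → F.lev x < F.lev y →
        (F.lev x + 1) / 2 = (F.lev y + 1) / 2 → y < x := by
      intro x y hxy hlt heq
      rcases hq : F.parent y with _ | p
      · rw [F.lev_root hq] at hlt; omega
      · rw [hq] at hxy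
        have a1 := F.lev_odd hxy ((F.lev x) / 2) (by omega)
        have a2 := F.lev_even hq ((F.lev y) / 2) (by omega)
        exact a2.trans a1
    by_cases hb : F.lev c < F.lev j ∨ (F.lev c = F.lev j ∧ j.val < c.val)
    · -- `c` before `j`
      have hm := F.pt_mono (F.parent j) (l := F.lev c) (l' := F.lev j) (t := c.val)
        (t' := j.val + 1) (by omega)
      refine ⟨by omega, ?_, by omega⟩
      intro ha
      have hct : c ≤ t := F.M2 hk htc hi (by omega)
      rcases hb with hb | hb
      · exact (eq_case c j hcj hb (by omega)).trans_le hct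
      · exact lt_of_lt_of_le hb.2 hct
    · have hb' : F.lev j < F.lev c ∨ (F.lev j = F.lev c ∧ c.val < j.val) := by omega
      have hm := F.pt_mono (F.parent j) (l := F.lev j) (l' := F.lev c) (t := j.val)
        (t' := c.val + 1) (by omega)
      refine ⟨by omega, by omega, ?_⟩
      intro ha
      have hct : t ≤ c := F.M1 hk htc (i := i) (by omega)
      rcases hb' with hb | hb
      · exact hct.trans_lt (eq_case j c hcj.symm hb (by omega))
      · exact lt_of_le_of_lt hct hb.2
  refine F.toRootedForest.parent_induction (fun j => ¬ F.toRootedForest.anc t j →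
    (F.A t i ≤ F.s j ∨ F.s j + k * F.toRootedForest.h j ≤ F.A t i) ∧
    (F.A t i = F.s j → j < t) ∧ (F.A t i = F.s j + k * F.toRootedForest.h j → t < j)) ?_ ?_ j
  · intro j hj hnt
    obtain ⟨r, hr, htr⟩ := F.toRootedForest.exists_root t
    refine sib j r (by rw [hr, hj]) ?_ htr
    rintro rfl
    exact hnt htr
  · intro j p hp ih hnt
    by_cases htp : F.toRootedForest.anc t p
    · rcases (F.toRootedForest.anc_iff _ _).1 htp with h | h
      · -- t = p
        subst h
        have sj := F.s_pt j
        have ej := F.e_pt j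
        have hj := F.kh_pos hk j
        rw [hp] at sj ej
        by_cases hl : 2 * i ≤ F.lev j
        · have hm := F.pt_mono (some t) (l := 2 * i) (l' := F.lev j) (t := n)
            (t' := j.val + 1) (by omega)
          have hA : F.A t i = F.pt (some t) (2 * i) n := rfl
          refine ⟨by omega, ?_, by omega⟩
          intro ha
          exact F.lev_even hp i (by omega)
        · have hm := F.pt_mono (some t) (l := F.lev j) (l' := 2 * i) (t := j.val)
            (t' := n) (by omega)
          have hA : F.A t i = F.pt (some t) (2 * i) n := rfl
          refine ⟨by omega, by omega, ?_⟩
          intro ha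
          exact F.lev_odd hp (i - 1) (by omega)
      · obtain ⟨c, htc, hc⟩ := (F.toRootedForest.desc_iff _ _).1 h
        refine sib j c (by rw [hc, hp]) ?_ htc
        rintro rfl
        exact hnt htc
    · obtain ⟨i1, i2, i3⟩ := ih htp
      have h1 := F.s_child hp
      have h2 := F.e_child hk hp
      have h3 := F.lev_lt hk j
      have hj := F.kh_pos hk j
      refine ⟨by omega, ?_, ?_⟩
      · intro ha
        exact (F.lev_even hp 0 (by omega)).trans (i2 (by omega))
      · intro ha
        exact (i3 (by omega)).trans (F.lev_odd hp (k - 1) (by omega))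

theorem e_le (hk : 1 ≤ k) (j : Fin n) : F.s j + k * F.toRootedForest.h j ≤ k * n := by
  obtain ⟨r, hr, hjr⟩ := F.toRootedForest.exists_root j
  have h1 := (F.contain hk hjr).2
  have h2 := F.e_pt r
  rw [hr, F.lev_root hr] at h2
  have h3 := Nat.mul_le_mul_left k (F.Y_le_none 0 r.val)
  simp only [pt, base, Option.elim] at h2
  omega

theorem A_lt_bound (hk : 1 ≤ k) (j : Fin n) (i : Fin (k + 1)) : F.A j i < k * n + 1 := by
  have := F.e_le hk j
  have := F.A_le hk j (i := i) (by omega)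
  omega

end positions

end KForest


namespace KForest

section trajectory

open scoped Classical

variable {n k : ℕ} (F : KForest n k)

/-- trajectory of a point under the successive factors -/
noncomputable def tr (j : Fin n) (e t : ℕ) : ℕ :=
  if t ≤ j.val then F.pt (some j) (2 * e) t else F.pt (some j) (2 * e + 1) t

theorem tr_start (j : Fin n) (e : ℕ) : F.tr j e 0 = F.pt (some j) (2 * e) 0 := by
  simp [tr]

theorem tr_end (j : Fin n) (e : ℕ) : F.tr j e n = F.pt (some j) (2 * e) 0 + 1 := by
  have hj := j.isLt
  rw [tr, if_neg (by omega)]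
  have := F.Y_congr (some j) (l := 2 * e + 1) (t := n) (l' := 2 * e) (t' := 0) (by
    intro c _
    have := c.isLt
    omega)
  unfold pt
  rw [this]
  omega

theorem tr_at (j : Fin n) (e : ℕ) : F.tr j e j = F.A j e := by
  rw [tr, if_pos le_rfl]
  have := F.Y_congr (some j) (l := 2 * e) (t := j.val) (l' := 2 * e) (t' := n) (by
    intro c hc
    have := c.isLt
    have h2 := F.lev_even hc e
    rw [Fin.lt_def] at h2
    omega)
  unfold A pt
  rw [this]

theorem tr_at_succ (j : Fin n) (e : ℕ) : F.tr j e (j.val + 1) = F.A j (e + 1) := by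
  rw [tr, if_neg (by omega)]
  have := F.Y_congr (some j) (l := 2 * e + 1) (t := j.val + 1) (l' := 2 * (e + 1)) (t' := n) (by
    intro c hc
    have := c.isLt
    have h2 := F.lev_odd hc e
    rw [Fin.lt_def] at h2
    omega)
  unfold A pt
  rw [this]
  omega

theorem tr_child (hk : 1 ≤ k) {j t : Fin n} {e : ℕ} (hc : F.parent t = some j)
    (hl : F.lev t = 2 * e ∨ F.lev t = 2 * e + 1) :
    F.tr j e t = F.A t k ∧ F.tr j e (t.val + 1) = F.A t 0 := by
  rw [A_zero, A_last _ hk, F.e_pt, F.s_pt, hc]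
  rcases hl with hl | hl
  · have := F.lev_even hc e hl
    rw [Fin.lt_def] at this
    rw [tr, tr, if_pos (by omega), if_pos (by omega), hl]
    exact ⟨rfl, rfl⟩
  · have := F.lev_odd hc e hl
    rw [Fin.lt_def] at this
    rw [tr, tr, if_neg (by omega), if_neg (by omega), hl]
    exact ⟨rfl, rfl⟩

theorem tr_other {j t : Fin n} {e : ℕ} (htj : t ≠ j)
    (hn : ¬ (F.parent t = some j ∧ (F.lev t = 2 * e ∨ F.lev t = 2 * e + 1))) :
    F.tr j e (t.val + 1) = F.tr j e t := by
  have htj' : t.val ≠ j.val := fun h => htj (Fin.ext h)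
  have key : ∀ l, (l = 2 * e ∨ l = 2 * e + 1) →
      F.pt (some j) l (t.val + 1) = F.pt (some j) l t := by
    intro l hl
    unfold pt
    rw [F.Y_congr (some j) (l := l) (t := t.val + 1) (l' := l) (t' := t.val)]
    intro c hc
    by_cases hct : c = t
    · subst hct
      have : ¬ (F.lev c = 2 * e ∨ F.lev c = 2 * e + 1) := fun h => hn ⟨hc, h⟩
      omega
    · have : c.val ≠ t.val := fun h => hct (Fin.ext h)
      omega
  by_cases h : t.val ≤ j.val
  · rw [tr, tr, if_pos h, if_pos (by omega), key _ (Or.inl rfl)]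
  · rw [tr, tr, if_neg h, if_neg (by omega), key _ (Or.inr rfl)]

theorem tr_bounds (j : Fin n) (e t : ℕ) :
    (t ≤ j.val → F.A j e ≤ F.tr j e t ∧ F.tr j e t < F.A j (e + 1)) ∧
    (j.val < t → F.A j e < F.tr j e t ∧ F.tr j e t ≤ F.A j (e + 1)) := by
  constructor
  · intro h
    rw [tr, if_pos h]
    unfold A
    have h1 := F.pt_mono (some j) (l := 2 * e) (l' := 2 * (e + 1)) (t := t) (t' := n) (by omega)
    have h2 : F.pt (some j) (2 * e) n ≤ F.pt (some j) (2 * e) t := by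
      by_cases h : t ≤ n
      · have := F.pt_mono (some j) (l := 2 * e) (l' := 2 * e) (t := n) (t' := t) (by omega)
        omega
      · have := j.isLt
        omega
    omega
  · intro h
    rw [tr, if_neg (by omega)]
    unfold A
    have h1 := F.pt_mono (some j) (l := 2 * e) (l' := 2 * e + 1) (t := n) (t' := t) (by omega)
    have h2 := F.pt_mono (some j) (l := 2 * e + 1) (l' := 2 * (e + 1)) (t := t) (t' := n) (by omega)
    omega

theorem tr_not_mem (hk : 1 ≤ k) {j t : Fin n} {e : ℕ} (he : e < k) (htj : t ≠ j)
    (hn : ¬ (F.parent t = some j ∧ (F.lev t = 2 * e ∨ F.lev t = 2 * e + 1)))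
    {i : ℕ} (hi : i ≤ k) : F.A t i ≠ F.tr j e t := by
  intro ha
  have htj' : t.val ≠ j.val := fun h => htj (Fin.ext h)
  have hb := F.tr_bounds j e t
  have b1 := F.A_ge j e
  have b2 := F.A_le hk j (i := e + 1) (by omega)
  by_cases hanc : F.toRootedForest.anc t j
  · rcases (F.toRootedForest.anc_iff _ _).1 hanc with h | h
    · exact htj h
    obtain ⟨c, htc, hc⟩ := (F.toRootedForest.desc_iff _ _).1 h
    have h1 := F.contain hk htc
    have h2 := F.A_ge t i
    have h3 := F.A_le hk t hi
    have sc := F.s_pt c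
    have ec := F.e_pt c
    have m1 := F.M1 hk htc (i := i)
    have m2 := F.M2 hk htc hi
    have lo := F.lev_odd hc (F.lev c / 2)
    have le := F.lev_even hc (F.lev c / 2)
    rw [hc] at sc ec
    have hct : t.val = c.val → ¬ (F.lev c = 2 * e ∨ F.lev c = 2 * e + 1) := by
      intro h h'
      have h : t = c := Fin.ext h
      subst h
      exact hn ⟨hc, h'⟩
    simp only [Fin.lt_def, Fin.le_def] at lo le m1 m2
    by_cases htlt : t.val ≤ j.val
    · rw [tr, if_pos htlt] at ha
      by_cases hbef : F.lev c < 2 * e ∨ (F.lev c = 2 * e ∧ t.val ≤ c.val)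
      · have hm := F.pt_mono (some j) (l := F.lev c) (l' := 2 * e) (t := c.val) (t' := t.val)
          (by omega)
        omega
      · have hm := F.pt_mono (some j) (l := 2 * e) (l' := F.lev c) (t := t.val) (t' := c.val + 1)
          (by omega)
        omega
    · rw [tr, if_neg htlt] at ha
      by_cases hbef : F.lev c < 2 * e + 1 ∨ (F.lev c = 2 * e + 1 ∧ t.val ≤ c.val)
      · have hm := F.pt_mono (some j) (l := F.lev c) (l' := 2 * e + 1) (t := c.val) (t' := t.val)
          (by omega)
        omega
      · have hm := F.pt_mono (some j) (l := 2 * e + 1) (l' := F.lev c) (t := t.val)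
          (t' := c.val + 1) (by omega)
        omega
  · obtain ⟨i1, i2, i3⟩ := F.M3 hk t hi j hanc
    simp only [Fin.lt_def] at i2 i3
    omega

/-- the units cover everything -/
theorem unit_lt (hk : 1 ≤ k) (j : Fin n) {e : ℕ} (he : e < k) :
    F.A j e ≤ F.pt (some j) (2 * e) 0 ∧ F.pt (some j) (2 * e) 0 + 1 ≤ F.A j (e + 1) := by
  have h1 := (F.tr_bounds j e 0).1 (by omega)
  rw [tr_start] at h1
  omega

theorem unit_not_inside {j c : Fin n} (hc : F.parent c = some j) (e : ℕ) :
    F.pt (some j) (2 * e) 0 + 1 ≤ F.s c ∨ F.s c + k * F.toRootedForest.h c ≤ F.pt (some j) (2 * e) 0 := by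
  have sc := F.s_pt c
  have ec := F.e_pt c
  rw [hc] at sc ec
  by_cases h : F.lev c ≤ 2 * e
  · right
    have := F.pt_mono (some j) (l := F.lev c) (l' := 2 * e) (t := c.val) (t' := 0) (by omega)
    omega
  · left
    have h1 := F.tr_end j e
    rw [tr, if_neg (by omega)] at h1
    have := F.pt_mono (some j) (l := 2 * e + 1) (l' := F.lev c) (t := n) (t' := c.val + 1) (by omega)
    omega

theorem unit_inj (hk : 1 ≤ k) {j j' : Fin n} {e e' : ℕ} (he : e < k) (he' : e' < k)
    (h : F.pt (some j) (2 * e) 0 = F.pt (some j') (2 * e') 0) : j = j' ∧ e = e' := by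
  have u1 := F.unit_lt hk j he
  have u2 := F.unit_lt hk j' he'
  have a1 := F.A_ge j e
  have a2 := F.A_le hk j (i := e + 1) (by omega)
  have a3 := F.A_ge j' e'
  have a4 := F.A_le hk j' (i := e' + 1) (by omega)
  have hdesc : ∀ (j j' : Fin n) (e e' : ℕ), e < k → e' < k →
      F.pt (some j) (2 * e) 0 = F.pt (some j') (2 * e') 0 →
      F.toRootedForest.Desc j j' → False := by
    intro j j' e e' he he' h hd
    obtain ⟨c, htc, hc⟩ := (F.toRootedForest.desc_iff _ _).1 hd
    have h1 := F.contain hk htc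
    have h2 := F.unit_not_inside hc e
    have u2 := F.unit_lt hk j' he'
    have a3 := F.A_ge j' e'
    have a4 := F.A_le hk j' (i := e' + 1) (by omega)
    omega
  by_cases h1 : F.toRootedForest.anc j j'
  · rcases (F.toRootedForest.anc_iff _ _).1 h1 with hh | hh
    · subst hh
      refine ⟨rfl, ?_⟩
      rcases lt_trichotomy e e' with h2 | h2 | h2
      · have : F.A j (e + 1) ≤ F.A j e' := by
          rcases Nat.lt_or_eq_of_le (show e + 1 ≤ e' from h2) with h3 | h3
          · exact (F.A_lt j h3).le
          · rw [h3]
        omega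
      · exact h2
      · have : F.A j (e' + 1) ≤ F.A j e := by
          rcases Nat.lt_or_eq_of_le (show e' + 1 ≤ e from h2) with h3 | h3
          · exact (F.A_lt j h3).le
          · rw [h3]
        omega
    · exact (hdesc _ _ _ _ he' he h.symm hh).elim
  by_cases h2 : F.toRootedForest.anc j' j
  · rcases (F.toRootedForest.anc_iff _ _).1 h2 with hh | hh
    · exact (h1 (hh ▸ F.toRootedForest.anc_refl _)).elim
    · exact (hdesc _ _ _ _ he he' h hh).elim
  exfalso
  have p1 := F.M3 hk j (i := 0) (by omega) j' h1
  have p2 := F.M3 hk j (i := k) (by omega) j' h1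
  have p3 := F.M3 hk j' (i := 0) (by omega) j h2
  have p4 := F.M3 hk j' (i := k) (by omega) j h2
  rw [A_zero] at p1 p3
  rw [A_last _ hk] at p2 p4
  simp only [Fin.lt_def] at p1 p2 p3 p4
  omega

end trajectory

end KForest


namespace KForest

section product

open scoped Classical

theorem prod_trajectory {α : Type*} : ∀ {n : ℕ} (g : Fin n → Equiv.Perm α) (y : ℕ → α)
    (_ : ∀ t : Fin n, g t (y t) = y (t + 1)), (List.ofFn g).reverse.prod (y 0) = y n
  | 0, _, _, _ => by simp
  | n + 1, g, y, h => by
    rw [List.ofFn_succ', List.concat_eq_append, List.reverse_append, List.reverse_singleton,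
      List.singleton_append, List.prod_cons, Equiv.Perm.mul_apply,
      prod_trajectory (fun i => g i.castSucc) y (fun t => h t.castSucc)]
    exact h (Fin.last n)

theorem formPerm_ofFn_apply {α : Type*} [DecidableEq α] {m : ℕ} (a : Fin (m + 1) → α)
    (ha : Function.Injective a) (i : Fin (m + 1)) :
    (List.ofFn a).formPerm (a i) = a (i + 1) := by
  have hi := i.isLt
  have h := List.formPerm_apply_getElem (List.ofFn a) (List.nodup_ofFn.2 ha) i.val (by simpa using Nat.lt_succ_iff.1 hi)
  simp only [List.getElem_ofFn, List.length_ofFn] at h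
  rw [show a i = a ⟨i.val, hi⟩ from rfl, h]
  congr 1
  apply Fin.ext
  rw [Fin.val_add]
  simp

theorem formPerm_ofFn_notMem {α : Type*} [DecidableEq α] {m : ℕ} (a : Fin m → α) (x : α)
    (hx : ∀ i, a i ≠ x) : (List.ofFn a).formPerm x = x := by
  apply List.formPerm_apply_of_notMem
  rw [List.mem_ofFn]
  rintro ⟨i, hi⟩
  exact hx i hi

variable {n k : ℕ} (F : KForest n k)

/-- the polygons as functions into `Fin` -/
noncomputable def poly (hk : 1 ≤ k) (j : Fin n) (i : Fin (k + 1)) : Fin (k * n + 1) :=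
  ⟨F.A j i, F.A_lt_bound hk j i⟩

theorem poly_inj (hk : 1 ≤ k) (j : Fin n) : Function.Injective (F.poly hk j) := by
  intro i i' h
  have h : F.A j i = F.A j i' := congrArg Fin.val h
  apply Fin.ext
  rcases lt_trichotomy i.val i'.val with h1 | h1 | h1
  · have := F.A_lt j h1
    omega
  · exact h1
  · have := F.A_lt j h1
    omega

theorem poly_prod_unit (hk : 1 ≤ k) (j : Fin n) {e : ℕ} (he : e < k) (x : Fin (k * n + 1))
    (hx : x.val = F.pt (some j) (2 * e) 0) :
    ((List.ofFn (fun j => (List.ofFn (F.poly hk j)).formPerm)).reverse.prod x).val = x.val + 1 := by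
  have hb : ∀ t, F.tr j e t < k * n + 1 := by
    intro t
    have h1 := F.tr_bounds j e t
    have h2 := F.A_le hk j (i := e + 1) (by omega)
    have h3 := F.e_le hk j
    omega
  have h := prod_trajectory (fun j => (List.ofFn (F.poly hk j)).formPerm)
    (fun t => (⟨F.tr j e t, hb t⟩ : Fin (k * n + 1))) (by
      intro t
      by_cases htj : t = j
      · subst htj
        have e1 : (⟨F.tr t e t, hb t⟩ : Fin (k * n + 1)) = F.poly hk t ⟨e, by omega⟩ :=
          Fin.ext (F.tr_at t e)
        show (List.ofFn (F.poly hk t)).formPerm _ = _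
        rw [e1, formPerm_ofFn_apply _ (F.poly_inj hk t)]
        apply Fin.ext
        show F.A t _ = F.tr t e (t.val + 1)
        rw [F.tr_at_succ, Fin.val_add_one_of_lt]
        rw [Fin.lt_def]
        exact he
      by_cases hc : F.parent t = some j ∧ (F.lev t = 2 * e ∨ F.lev t = 2 * e + 1)
      · obtain ⟨c1, c2⟩ := F.tr_child hk hc.1 hc.2
        have e1 : (⟨F.tr j e t, hb t⟩ : Fin (k * n + 1)) = F.poly hk t (Fin.last k) :=
          Fin.ext c1
        show (List.ofFn (F.poly hk t)).formPerm _ = _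
        rw [e1, formPerm_ofFn_apply _ (F.poly_inj hk t)]
        apply Fin.ext
        show F.A t _ = F.tr j e (t.val + 1)
        rw [c2, Fin.last_add_one]
        rfl
      · show (List.ofFn (F.poly hk t)).formPerm _ = _
        rw [formPerm_ofFn_notMem]
        · apply Fin.ext
          exact (F.tr_other htj hc).symm
        · intro i hi
          exact F.tr_not_mem hk he htj hc (i := i) (by omega) (congrArg Fin.val hi))
  have e0 : (⟨F.tr j e 0, hb 0⟩ : Fin (k * n + 1)) = x := by
    apply Fin.ext
    rw [hx, ← tr_start]
  simp only [e0] at h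
  rw [h, hx]
  exact F.tr_end j e

theorem unit_surj (hk : 1 ≤ k) (x : ℕ) (hx : x < k * n) :
    ∃ (j : Fin n) (e : ℕ), e < k ∧ x = F.pt (some j) (2 * e) 0 := by
  let f : Fin n × Fin k → Fin (k * n) := fun p => ⟨F.pt (some p.1) (2 * p.2) 0, by
    have h1 := F.unit_lt hk p.1 p.2.isLt
    have h2 := F.A_le hk p.1 (i := p.2 + 1) (by omega)
    have h3 := F.e_le hk p.1
    omega⟩
  have hf : Function.Injective f := by
    intro p q h
    obtain ⟨h1, h2⟩ := F.unit_inj hk p.2.isLt q.2.isLt (congrArg Fin.val h)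
    exact Prod.ext h1 (Fin.ext h2)
  have hb := (Fintype.bijective_iff_injective_and_card f).2 ⟨hf, by simp [mul_comm]⟩
  obtain ⟨p, hp⟩ := hb.2 ⟨x, hx⟩
  exact ⟨p.1, p.2, p.2.isLt, (congrArg Fin.val hp).symm⟩

theorem perm_eq_finRotate {m : ℕ} (P : Equiv.Perm (Fin (m + 1)))
    (h : ∀ x : Fin (m + 1), x.val < m → (P x).val = x.val + 1) : P = finRotate (m + 1) := by
  have h1 : ∀ x : Fin (m + 1), x.val < m → P x = finRotate (m + 1) x := by
    intro x hx
    apply Fin.ext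
    rw [h x hx, finRotate_apply, Fin.val_add_one_of_lt]
    rw [Fin.lt_def]
    exact hx
  ext1 x
  by_cases hx : x.val < m
  · exact h1 x hx
  · have hxl : x = Fin.last m := Fin.ext (by rw [Fin.val_last]; omega)
    obtain ⟨y, hy⟩ := P.surjective (finRotate (m + 1) x)
    by_cases hy' : y.val < m
    · rw [h1 y hy'] at hy
      have := (finRotate (m + 1)).injective hy
      omega
    · have : y = x := Fin.ext (by omega)
      rw [← this, hy, this]

/-- the factorization attached to a forest -/
noncomputable def toFact (hk : 1 ≤ k) : MinKFact n k where
  a := F.poly hk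
  inj := F.poly_inj hk
  min_first := by
    intro j i
    rw [Fin.le_def]
    show F.A j 0 ≤ F.A j i
    rw [A_zero]
    exact F.A_ge j i
  prod_eq := by
    have h := perm_eq_finRotate
      ((List.ofFn (fun j => (List.ofFn (F.poly hk j)).formPerm)).reverse.prod) (by
        intro x hx
        obtain ⟨j, e, he, hxe⟩ := F.unit_surj hk x.val hx
        exact F.poly_prod_unit hk j he x hxe)
    convert h

theorem anc_of_contain (hk : 1 ≤ k) {m j : Fin n} (h1 : F.s j ≤ F.s m)
    (h2 : F.s m + k * F.toRootedForest.h m ≤ F.s j + k * F.toRootedForest.h j) :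
    F.toRootedForest.anc m j := by
  by_contra h
  have p1 := F.M3 hk m (i := 0) (by omega) j h
  have p2 := F.M3 hk m (i := k) (by omega) j h
  have := F.kh_pos hk m
  rw [A_zero] at p1
  rw [A_last _ hk] at p2
  simp only [Fin.lt_def] at p1 p2
  omega

theorem child_slot {c p : Fin n} (hc : F.parent c = some p) :
    F.A p (F.lev c / 2) ≤ F.s c ∧
      F.s c + k * F.toRootedForest.h c ≤ F.A p (F.lev c / 2 + 1) := by
  have sc := F.s_pt c
  have ec := F.e_pt c
  rw [hc] at sc ec
  have h1 := F.pt_mono (some p) (l := 2 * (F.lev c / 2)) (l' := F.lev c) (t := n)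
    (t' := c.val + 1) (by omega)
  have h2 := F.pt_mono (some p) (l := F.lev c) (l' := 2 * (F.lev c / 2 + 1)) (t := c.val)
    (t' := n) (by omega)
  unfold A
  omega

theorem parent_iff_desc (F : RootedForest (Fin n)) (c p : Fin n) :
    F.parent c = some p ↔ F.Desc p c ∧ ∀ q, F.Desc q c → F.anc p q := by
  constructor
  · intro h
    refine ⟨Relation.TransGen.single h, ?_⟩
    intro q hq
    rcases Relation.TransGen.head'_iff.1 hq with ⟨y, hy, hyq⟩
    have : F.parent c = some y := hy
    rw [h] at this
    have := Option.some.inj this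
    subst this
    exact hyq
  · rintro ⟨h1, h2⟩
    rcases Relation.TransGen.head'_iff.1 h1 with ⟨y, hy, hyp⟩
    have hy' : F.parent c = some y := hy
    have := h2 y (Relation.TransGen.single hy')
    rw [hy', F.anc_antisymm hyp this]

theorem toFact_injective (hk : 1 ≤ k) :
    Function.Injective (fun F : KForest n k => F.toFact hk) := by
  intro F G h
  have hA : ∀ j i, i ≤ k → F.A j i = G.A j i := by
    intro j i hi
    have := congrArg (fun f : MinKFact n k => (f.a j ⟨i, by omega⟩).val) h
    exact this
  have hs : ∀ j, F.s j = G.s j := by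
    intro j
    rw [← A_zero, ← A_zero]
    exact hA j 0 (by omega)
  have he : ∀ j, F.s j + k * F.toRootedForest.h j = G.s j + k * G.toRootedForest.h j := by
    intro j
    rw [← A_last _ hk, ← A_last _ hk]
    exact hA j k le_rfl
  have hanc : ∀ m j, F.toRootedForest.anc m j ↔ G.toRootedForest.anc m j := by
    intro m j
    have := hs m
    have := hs j
    have := he m
    have := he j
    constructor
    · intro h
      have := F.contain hk h
      exact G.anc_of_contain hk (by omega) (by omega)
    · intro h
      have := G.contain hk h
      exact F.anc_of_contain hk (by omega) (by omega)
  have hdesc : ∀ u v, F.toRootedForest.Desc u v ↔ G.toRootedForest.Desc u v := by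
    have key : ∀ (F : KForest n k) u v, F.toRootedForest.Desc u v ↔
        F.toRootedForest.anc v u ∧ v ≠ u := by
      intro F u v
      rw [F.toRootedForest.anc_iff]
      constructor
      · intro h
        refine ⟨Or.inr h, ?_⟩
        rintro rfl
        exact F.acyclic _ h
      · rintro ⟨h | h, h'⟩
        · exact (h' h).elim
        · exact h
    intro u v
    rw [key, key, hanc]
  have hpar : ∀ c p, F.parent c = some p ↔ G.parent c = some p := by
    intro c p
    rw [parent_iff_desc, parent_iff_desc, hdesc]
    simp only [hdesc, hanc]
  have hpar' : F.parent = G.parent := by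
    funext c
    exact Option.ext (fun p => by simpa using hpar c p)
  refine KForest.ext' hpar' ?_
  funext c
  rcases hc : F.parent c with _ | p
  · rw [F.colour_root c hc, G.colour_root c (by rw [← hpar', hc])]
  · have hc' := (hpar c p).1 hc
    have s1 := F.child_slot hc
    have s2 := G.child_slot hc'
    have l1 := F.lev_child hc
    have l2 := G.lev_child hc'
    have c1 := F.colour_lt c
    have c2 := G.colour_lt c
    have q1 := F.lev_lt hk c
    have q2 := G.lev_lt hk c
    have f1 := F.kh_pos hk c
    rw [hA p _ (by omega), hA p _ (by omega)] at s1
    have e1 : F.lev c / 2 = G.lev c / 2 := by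
      have mono : ∀ i i', i ≤ i' → G.A p i ≤ G.A p i' := by
        intro i i' h
        rcases Nat.lt_or_eq_of_le h with h3 | h3
        · exact (G.A_lt p h3).le
        · rw [h3]
      have := hs c
      have := he c
      rcases lt_trichotomy (F.lev c / 2) (G.lev c / 2) with h2 | h2 | h2
      · have := mono (F.lev c / 2 + 1) (G.lev c / 2) (by omega)
        omega
      · exact h2
      · have := mono (G.lev c / 2 + 1) (F.lev c / 2) (by omega)
        omega
    split_ifs at l1 l2 <;> omega

end product

end KForest


namespace KForest

section stats

open scoped Classical

variable {n k : ℕ} (F : KForest n k)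

theorem sum_sq : ∑ c, ∑ d, (if F.parent d = F.parent c then
      (F.toRootedForest.h c : ℤ) * F.toRootedForest.h d else 0)
    = (n : ℤ) ^ 2 + ∑ u, ((F.toRootedForest.h u : ℤ) - 1) ^ 2 := by
  rw [F.toRootedForest.sum_by_parent]
  have h0 := F.toRootedForest.sum_children_root
  have h1 := F.toRootedForest.sum_children
  congr 1
  · have : ∀ c ∈ Finset.univ.filter (fun c => F.parent c = none),
        ∑ d, (if F.parent d = F.parent c then
          (F.toRootedForest.h c : ℤ) * F.toRootedForest.h d else 0)
        = (F.toRootedForest.h c : ℤ) * n := by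
      intro c hc
      rw [(Finset.mem_filter.1 hc).2, ← Finset.sum_filter, ← Finset.mul_sum, ← Nat.cast_sum, h0]
    rw [Finset.sum_congr rfl this, ← Finset.sum_mul, ← Nat.cast_sum, h0, sq]
  · apply Finset.sum_congr rfl
    intro u _
    have hu : (∑ d with F.parent d = some u, (F.toRootedForest.h d : ℤ))
        = (F.toRootedForest.h u : ℤ) - 1 := by
      have := h1 u
      rw [← Nat.cast_sum]
      push_cast [← this]
      ring
    have : ∀ c ∈ Finset.univ.filter (fun c => F.parent c = some u),
        ∑ d, (if F.parent d = F.parent c then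
          (F.toRootedForest.h c : ℤ) * F.toRootedForest.h d else 0)
        = (F.toRootedForest.h c : ℤ) * ((F.toRootedForest.h u : ℤ) - 1) := by
      intro c hc
      rw [(Finset.mem_filter.1 hc).2, ← Finset.sum_filter, ← Finset.mul_sum, hu]
    rw [Finset.sum_congr rfl this, ← Finset.sum_mul, hu, sq]

/-- `d` is placed before its sibling `c` -/
def bef (d c : Fin n) : Prop :=
  F.parent d = F.parent c ∧ (F.lev d < F.lev c ∨ (F.lev d = F.lev c ∧ c.val + 1 ≤ d.val))

theorem sibpairs : 2 * ∑ c, (F.toRootedForest.h c : ℤ) * F.Y (F.parent c) (F.lev c) (c.val + 1)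
    = (n : ℤ) ^ 2 + n - 2 * ∑ c, (F.toRootedForest.h c : ℤ) := by
  have e1 : ∑ c, (F.toRootedForest.h c : ℤ) * F.Y (F.parent c) (F.lev c) (c.val + 1)
      = ∑ c, ∑ d, if F.bef d c then (F.toRootedForest.h c : ℤ) * F.toRootedForest.h d else 0 := by
    apply Finset.sum_congr rfl
    intro c _
    have : F.Y (F.parent c) (F.lev c) (c.val + 1)
        = ∑ d with F.bef d c, F.toRootedForest.h d := by
      unfold Y bef
      apply Finset.sum_congr _ (fun _ _ => rfl)
      ext d
      simp only [Finset.mem_filter]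
    rw [this, Nat.cast_sum, Finset.mul_sum, Finset.sum_filter]
  have e2 : ∑ c, (F.toRootedForest.h c : ℤ) * F.Y (F.parent c) (F.lev c) (c.val + 1)
      = ∑ c, ∑ d, if F.bef c d then (F.toRootedForest.h c : ℤ) * F.toRootedForest.h d else 0 := by
    rw [e1, Finset.sum_comm]
    apply Finset.sum_congr rfl
    intro c _
    apply Finset.sum_congr rfl
    intro d _
    rw [mul_comm]
  have e3 : ∑ c, (F.toRootedForest.h c : ℤ) ^ 2
      = ∑ c, ∑ d, if c = d then (F.toRootedForest.h c : ℤ) * F.toRootedForest.h d else 0 := by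
    apply Finset.sum_congr rfl
    intro c _
    simp [sq]
  have e4 := F.sum_sq
  have e5 : ∑ c, ∑ d, (if F.parent d = F.parent c then
      (F.toRootedForest.h c : ℤ) * F.toRootedForest.h d else 0)
      = (∑ c, ∑ d, if F.bef d c then (F.toRootedForest.h c : ℤ) * F.toRootedForest.h d else 0)
      + (∑ c, ∑ d, if F.bef c d then (F.toRootedForest.h c : ℤ) * F.toRootedForest.h d else 0)
      + ∑ c, ∑ d, if c = d then (F.toRootedForest.h c : ℤ) * F.toRootedForest.h d else 0 := by
    rw [← Finset.sum_add_distrib, ← Finset.sum_add_distrib]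
    apply Finset.sum_congr rfl
    intro c _
    rw [← Finset.sum_add_distrib, ← Finset.sum_add_distrib]
    apply Finset.sum_congr rfl
    intro d _
    by_cases hp : F.parent d = F.parent c
    · by_cases hcd : c = d
      · subst hcd
        have : ¬ F.bef c c := fun h => by
          have := h.2
          omega
        simp [this]
      · have hcd' : c.val ≠ d.val := fun h => hcd (Fin.ext h)
        by_cases hb : F.bef d c
        · have h2 : ¬ F.bef c d := fun h => by
            have h1 := h.2
            have h2 := hb.2
            omega
          simp [hp, hcd, hb, h2]
        · have h2 : F.bef c d := by
            refine ⟨hp.symm, ?_⟩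
            have : ¬ (F.lev d < F.lev c ∨ (F.lev d = F.lev c ∧ c.val + 1 ≤ d.val)) :=
              fun h => hb ⟨hp, h⟩
            omega
          simp [hp, hcd, hb, h2]
    · have h1 : ¬ F.bef d c := fun h => hp h.1
      have h2 : ¬ F.bef c d := fun h => hp h.1.symm
      have h3 : ¬ c = d := by
        rintro rfl
        exact hp rfl
      simp [hp, h1, h2, h3]
  rw [e4, ← e1, ← e2, ← e3] at e5
  have e6 : ∑ u, ((F.toRootedForest.h u : ℤ) - 1) ^ 2
      = ∑ c, (F.toRootedForest.h c : ℤ) ^ 2 - 2 * ∑ c, (F.toRootedForest.h c : ℤ) + n := by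
    have : ∀ u, ((F.toRootedForest.h u : ℤ) - 1) ^ 2
        = (F.toRootedForest.h u : ℤ) ^ 2 - 2 * (F.toRootedForest.h u : ℤ) + 1 := fun u => by ring
    rw [Finset.sum_congr rfl (fun u _ => this u), Finset.sum_add_distrib,
      Finset.sum_sub_distrib, ← Finset.mul_sum]
    simp
  linarith

theorem half_lev (c : Fin n) : ((F.lev c + 1) / 2 : ℕ)
    = (if F.parent c ≠ none then k - 1 - F.colour c else 0)
      + ∑ u, if F.parent c = some u ∧ u < c then 1 else 0 := by
  rcases hc : F.parent c with _ | p
  · rw [F.lev_root hc]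
    simp
  · rw [F.lev_child hc, Finset.sum_eq_single p]
    · by_cases h : p < c
      · simp [h]
        omega
      · simp [h]
        omega
    · intro u _ hu
      rw [if_neg]
      rintro ⟨h, _⟩
      exact hu (Option.some.inj h).symm
    · simp

theorem sum_half_lev : ∑ c, F.toRootedForest.h c * ((F.lev c + 1) / 2)
    = F.cochr + F.toRootedForest.comaj := by
  simp only [half_lev, mul_add, Finset.sum_add_distrib]
  congr 1
  · unfold cochr
    rw [Finset.sum_filter]
    apply Finset.sum_congr rfl
    intro c _
    split_ifs
    · rw [mul_comm]
    · simp
  · unfold RootedForest.comaj RootedForest.hR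
    simp only [Finset.mul_sum]
    rw [Finset.sum_comm]
    apply Finset.sum_congr rfl
    intro u _
    rw [Finset.sum_filter]
    apply Finset.sum_congr rfl
    intro c _
    simp

theorem sum_s : 2 * ∑ c, (F.s c : ℤ) = 2 * (F.cochr + F.toRootedForest.comaj)
    + k * ((n : ℤ) ^ 2 + n - 2 * ∑ c, (F.toRootedForest.h c : ℤ)) := by
  rw [← F.sibpairs, ← F.toRootedForest.telescope (fun c => (F.s c : ℤ))]
  have h1 : ∀ c, (F.s c : ℤ) - F.toRootedForest.atParent (fun c => (F.s c : ℤ)) c = F.dpos c := by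
    intro c
    rw [F.s_eq c]
    unfold RootedForest.atParent base
    rcases F.parent c with _ | p <;> simp
  simp only [h1]
  have h2 := F.sum_half_lev
  have h3 : ((∑ c, F.toRootedForest.h c * ((F.lev c + 1) / 2) : ℕ) : ℤ)
    = ((F.cochr + F.toRootedForest.comaj : ℕ) : ℤ) := by rw [h2]
  push_cast at h3
  rw [← h3]
  unfold dpos
  push_cast
  simp only [mul_add, Finset.sum_add_distrib]
  congr 1
  simp only [Finset.mul_sum]
  apply Finset.sum_congr rfl
  intro c _
  ring

theorem chr_add_cochr : (F.chr : ℤ) + F.cochr = (k - 1) * ∑ u, ((F.toRootedForest.h u : ℤ) - 1) := by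
  rw [← F.toRootedForest.sum_nonroot_h, Finset.mul_sum]
  unfold chr cochr
  push_cast
  rw [← Finset.sum_add_distrib]
  apply Finset.sum_congr rfl
  intro v _
  have h := F.colour_lt v
  have : ((k - 1 - F.colour v : ℕ) : ℤ) = k - 1 - F.colour v := by
    omega
  rw [this]
  ring

theorem choose2 (m : ℕ) : 2 * (m.choose 2 : ℤ) = (m : ℤ) * (m - 1) := by
  have := Nat.choose_two_right m
  have h2 : m.choose 2 * 2 = m * (m - 1) := by
    rw [this]
    exact Nat.div_mul_cancel (Nat.even_mul_pred_self m).two_dvd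
  rcases m with _ | m
  · simp
  · have : (((m + 1).choose 2 * 2 : ℕ) : ℤ) = (((m + 1) * (m + 1 - 1) : ℕ) : ℤ) := by rw [h2]
    push_cast at this
    push_cast
    linarith

theorem sum_h_sub : ∑ u, ((F.toRootedForest.h u : ℤ) - 1)
    = ∑ u, (F.toRootedForest.h u : ℤ) - n := by
  simp

theorem areak_toFact (hk : 1 ≤ k) : (F.toFact hk).areak = k * (F.toRootedForest.maj + F.chr) := by
  have h0 : ∀ j, (((F.toFact hk).a j 0 : ℕ) : ℤ) = F.s j := by
    intro j
    rw [← A_zero]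
    rfl
  unfold MinKFact.areak
  simp only [h0]
  have h1 := F.sum_s
  have h2 := F.chr_add_cochr
  have h3 := F.toRootedForest.maj_add_comaj
  have h4 := choose2 (k * n)
  have h5 := choose2 k
  rw [sum_h_sub] at h2 h3
  push_cast at h4
  apply mul_left_cancel₀ (two_ne_zero' ℤ)
  have h6 : (F.chr : ℤ) = (k - 1) * (∑ u, (F.toRootedForest.h u : ℤ) - n) - F.cochr := by linarith
  have h7 : (F.toRootedForest.maj : ℤ) = ∑ u, (F.toRootedForest.h u : ℤ) - n - F.toRootedForest.comaj := by linarith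
  rw [h6, h7]
  linear_combination h4 - n * h5 - k * h1

theorem coareak_toFact (hk : 1 ≤ k) :
    (F.toFact hk).coareak = k * (F.toRootedForest.comaj + F.cochr) := by
  have h0 : ∀ j, (((F.toFact hk).a j (Fin.last k) : ℕ) : ℤ) = F.s j + k * F.toRootedForest.h j := by
    intro j
    have : F.A j k = _ := F.A_last hk j
    rw [← Nat.cast_mul, ← Nat.cast_add, ← this]
    rfl
  unfold MinKFact.coareak
  simp only [h0]
  have h1 := F.sum_s
  have h4 := choose2 (k * n)
  have h5 := choose2 k
  push_cast at h4
  rw [Finset.sum_sub_distrib, Finset.sum_add_distrib, ← Finset.mul_sum]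
  simp only [Finset.sum_const, Finset.card_univ, Fintype.card_fin, nsmul_eq_mul, mul_one]
  apply mul_left_cancel₀ (two_ne_zero' ℤ)
  linear_combination k * h1 - h4 - n * h5

theorem Y_sum (j : Fin n) :
    ∑ i : Fin k, F.Y (some j) (2 * i) n
      = ∑ c with F.parent c = some j, F.colour c * F.toRootedForest.h c := by
  have e : ∀ i : Fin k, F.Y (some j) (2 * i) n
      = ∑ c with F.parent c = some j, if k - 1 - F.colour c < i.val then
          F.toRootedForest.h c else 0 := by
    intro i
    unfold Y
    rw [← Finset.sum_filter, Finset.filter_filter]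
    apply Finset.sum_congr _ (fun _ _ => rfl)
    ext c
    simp only [Finset.mem_filter, Finset.mem_univ, true_and]
    apply and_congr_right
    intro hc
    have h1 := F.lev_child hc
    have h2 := c.isLt
    split_ifs at h1 <;> omega
  rw [Finset.sum_congr rfl (fun i _ => e i), Finset.sum_comm]
  apply Finset.sum_congr rfl
  intro c _
  have hc := F.colour_lt c
  rw [← Finset.sum_filter, Finset.sum_const, smul_eq_mul]
  congr 1
  have : (Finset.univ.filter (fun i : Fin k => k - 1 - F.colour c < i.val)).card
      = (Finset.Ioi (⟨k - 1 - F.colour c, by omega⟩ : Fin k)).card := by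
    congr 1
    ext i
    simp [Fin.lt_def]
  rw [this, Fin.card_Ioi]
  simp only
  omega

theorem sum_A : ∑ j, ∑ i : Fin k, (F.A j i : ℤ)
    = k * ∑ j, (F.s j : ℤ) + n * (k.choose 2 : ℤ) + k * F.chr := by
  have hg : ∑ i : Fin k, (i.val : ℤ) = k.choose 2 := by
    have := Finset.sum_range_id k
    rw [← Nat.choose_two_right] at this
    rw [← this, Finset.sum_range]
    push_cast
    rfl
  have e : ∀ j, ∑ i : Fin k, (F.A j i : ℤ) = k * (F.s j : ℤ) + k.choose 2
      + k * ((∑ c with F.parent c = some j, F.colour c * F.toRootedForest.h c : ℕ) : ℤ) := by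
    intro j
    rw [← F.Y_sum, ← hg]
    have : ∀ i : Fin k, (F.A j i : ℤ) = F.s j + i.val + k * F.Y (some j) (2 * i) n := by
      intro i
      unfold A pt base
      simp only [Option.elim]
      have : (2 * i.val + 1) / 2 = i.val := by omega
      rw [this]
      push_cast
      ring
    simp only [this, Finset.sum_add_distrib, ← Finset.mul_sum]
    push_cast
    simp
  simp only [e, Finset.sum_add_distrib, ← Finset.mul_sum]
  have h2 : F.chr = ∑ j, ∑ c with F.parent c = some j, F.colour c * F.toRootedForest.h c := by
    unfold chr
    simp only [Finset.sum_filter]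
    rw [Finset.sum_comm]
    apply Finset.sum_congr rfl
    intro c _
    rcases hc : F.parent c with _ | p
    · simp
    · simp
  rw [h2]
  push_cast
  simp

theorem semiareak_toFact (hk : 1 ≤ k) : (F.toFact hk).semiareak = k * F.toRootedForest.maj := by
  have h1 := F.areak_toFact hk
  have h0 : ∀ j, (((F.toFact hk).a j 0 : ℕ) : ℤ) = F.s j := by
    intro j
    rw [← A_zero]
    rfl
  unfold MinKFact.areak at h1
  simp only [h0] at h1
  unfold MinKFact.semiareak
  rw [Finset.sum_comm]
  have := F.sum_A
  have h2 : ∑ j, ∑ i : Fin k, (((F.toFact hk).a j i.castSucc : ℕ) : ℤ)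
    = ∑ j, ∑ i : Fin k, (F.A j i : ℤ) := rfl
  rw [h2]
  linarith

theorem cosemiareak_toFact (hk : 1 ≤ k) :
    (F.toFact hk).cosemiareak = k * F.toRootedForest.comaj := by
  have h1 := F.semiareak_toFact hk
  have h3 := F.toRootedForest.maj_add_comaj
  unfold MinKFact.semiareak at h1
  rw [Finset.sum_comm] at h1
  unfold MinKFact.cosemiareak
  rw [Finset.sum_comm]
  have e : ∀ j, ∑ i : Fin k, ((((F.toFact hk).a j i.succ : ℕ) : ℤ) - 1)
      = ∑ i : Fin k, (((F.toFact hk).a j i.castSucc : ℕ) : ℤ)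
        + k * ((F.toRootedForest.h j : ℤ) - 1) := by
    intro j
    have a1 := Fin.sum_univ_succ (fun i : Fin (k + 1) => (((F.toFact hk).a j i : ℕ) : ℤ))
    have a2 := Fin.sum_univ_castSucc (fun i : Fin (k + 1) => (((F.toFact hk).a j i : ℕ) : ℤ))
    have a3 : (((F.toFact hk).a j 0 : ℕ) : ℤ) = F.s j := by
      rw [← A_zero]
      rfl
    have a4 : (((F.toFact hk).a j (Fin.last k) : ℕ) : ℤ) = F.s j + k * F.toRootedForest.h j := by
      have : F.A j k = _ := F.A_last hk j
      rw [← Nat.cast_mul, ← Nat.cast_add, ← this]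
      rfl
    rw [Finset.sum_sub_distrib]
    simp only [Finset.sum_const, Finset.card_univ, Fintype.card_fin, nsmul_eq_mul, mul_one]
    linarith
  rw [Finset.sum_congr rfl (fun j _ => e j), Finset.sum_add_distrib, ← Finset.mul_sum, ← h3]
  linarith

end stats

end KForest


namespace MinKFact

section cactus

variable {n k : ℕ}

theorem list_prod_semiconj {α β : Type*} (b : α → β) :
    ∀ {n : ℕ} (g : Fin n → Equiv.Perm α) (g' : Fin n → Equiv.Perm β)
      (_ : ∀ j x, b (g j x) = g' j (b x)) (x : α),
      b ((List.ofFn g).reverse.prod x) = (List.ofFn g').reverse.prod (b x)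
  | 0, _, _, _, x => by simp
  | n + 1, g, g', h, x => by
    rw [List.ofFn_succ', List.concat_eq_append, List.reverse_append, List.reverse_singleton,
      List.singleton_append, List.prod_cons, Equiv.Perm.mul_apply,
      List.ofFn_succ', List.concat_eq_append, List.reverse_append, List.reverse_singleton,
      List.singleton_append, List.prod_cons, Equiv.Perm.mul_apply, h,
      list_prod_semiconj b (fun i => g i.castSucc) (fun i => g' i.castSucc)
        (fun j x => h j.castSucc x)]

theorem fin_induction {m : ℕ} (P : Fin (m + 1) → Prop) (h0 : P 0)
    (hs : ∀ x, P x → P (x + 1)) (x : Fin (m + 1)) : P x := by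
  obtain ⟨x, hx⟩ := x
  induction x with
  | zero => exact h0
  | succ y ih =>
    have h1 := hs _ (ih (by omega))
    have h2 : (⟨y, by omega⟩ : Fin (m + 1)) + 1 = ⟨y + 1, hx⟩ := by
      apply Fin.ext
      rw [Fin.val_add_one_of_lt]
      rw [Fin.lt_def, Fin.val_last]
      show y < m
      omega
    rwa [h2] at h1

variable (f : MinKFact n k)

theorem tau_apply (j : Fin n) (i : Fin (k + 1)) :
    (List.ofFn (f.a j)).formPerm (f.a j i) = f.a j (i + 1) :=
  KForest.formPerm_ofFn_apply _ (f.inj j) i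

theorem tau_notMem (j : Fin n) (x : Fin (k * n + 1)) (hx : ∀ i, f.a j i ≠ x) :
    (List.ofFn (f.a j)).formPerm x = x :=
  KForest.formPerm_ofFn_notMem _ _ hx

/-- a function constant on every polygon is constant -/
theorem const_of_const {β : Type*} (g : Fin (k * n + 1) → β)
    (hg : ∀ j i, g (f.a j i) = g (f.a j 0)) (x : Fin (k * n + 1)) : g x = g 0 := by
  have h1 : ∀ x, g (x + 1) = g x := by
    intro x
    have h := list_prod_semiconj g (fun j => (List.ofFn (f.a j)).formPerm)
      (fun _ => (1 : Equiv.Perm β)) (by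
        intro j x
        rw [Equiv.Perm.one_apply]
        by_cases hx : ∃ i, f.a j i = x
        · obtain ⟨i, rfl⟩ := hx
          rw [f.tau_apply, hg j (i + 1), hg j i]
        · rw [f.tau_notMem]
          intro i hi
          exact hx ⟨i, hi⟩) x
    rw [f.prod_eq, finRotate_apply] at h
    rw [h]
    have : (List.ofFn (fun _ : Fin n => (1 : Equiv.Perm β))).reverse.prod = 1 := by
      apply List.prod_eq_one
      intro y hy
      rw [List.mem_reverse, List.mem_ofFn] at hy
      obtain ⟨_, rfl⟩ := hy
      rfl
    rw [this, Equiv.Perm.one_apply]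
  exact fin_induction (fun x => g x = g 0) rfl (fun x hx => (h1 x).trans hx) x

/-- prescribed differences on all polygons -/
theorem exists_diff (d : Fin n → Fin k → ℚ) : ∃ g : Fin (k * n + 1) → ℚ,
    ∀ j i, g (f.a j (Fin.succ i)) - g (f.a j 0) = d j i := by
  let L : (Fin (k * n + 1) → ℚ) →ₗ[ℚ] (Option (Fin n × Fin k) → ℚ) :=
    { toFun := fun g o => o.elim (g 0) (fun p => g (f.a p.1 (Fin.succ p.2)) - g (f.a p.1 0))
      map_add' := by
        intro g g'
        funext o
        rcases o with _ | p
        · rfl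
        · simp only [Option.elim, Pi.add_apply]
          ring
      map_smul' := by
        intro c g
        funext o
        rcases o with _ | p
        · rfl
        · simp only [Option.elim, Pi.smul_apply, smul_eq_mul, RingHom.id_apply]
          ring }
  have hinj : Function.Injective L := by
    rw [← LinearMap.ker_eq_bot, LinearMap.ker_eq_bot']
    intro g hg
    have h0 : g 0 = 0 := congrFun hg none
    have h1 : ∀ j i, g (f.a j (Fin.succ i)) - g (f.a j 0) = 0 :=
      fun j i => congrFun hg (some (j, i))
    funext x
    rw [f.const_of_const g _ x, h0]
    · rfl
    · intro j i
      refine Fin.cases rfl ?_ i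
      intro i
      exact sub_eq_zero.1 (h1 j i)
  have hsurj : Function.Surjective L :=
    (LinearMap.injective_iff_surjective_of_finrank_eq_finrank (by
      simp [mul_comm])).1 hinj
  obtain ⟨g, hg⟩ := hsurj (fun o => o.elim 0 (fun p => d p.1 p.2))
  exact ⟨g, fun j i => congrFun hg (some (j, i))⟩

theorem exists_br (j : Fin n) : ∃ br : Fin (k * n + 1) → Fin (k + 1),
    (∀ i, br (f.a j i) = i) ∧ ∀ m, m ≠ j → ∀ i, br (f.a m i) = br (f.a m 0) := by
  classical
  obtain ⟨g, hg⟩ := f.exists_diff (fun m i => if m = j then ((i.val : ℚ) + 1) else 0)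
  have hj : ∀ i : Fin (k + 1), g (f.a j i) = g (f.a j 0) + i.val := by
    intro i
    refine Fin.cases (by simp) ?_ i
    intro i
    have := hg j i
    rw [if_pos rfl] at this
    rw [Fin.val_succ]
    push_cast
    linarith
  have hm : ∀ m, m ≠ j → ∀ i, g (f.a m i) = g (f.a m 0) := by
    intro m hm i
    refine Fin.cases rfl ?_ i
    intro i
    have := hg m i
    rw [if_neg hm] at this
    linarith
  have hinj : ∀ i i', g (f.a j i) = g (f.a j i') → i = i' := by
    intro i i' h
    rw [hj i, hj i'] at h
    have : (i.val : ℚ) = i'.val := by linarith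
    exact Fin.ext (by exact_mod_cast this)
  have hall : ∀ x, ∃ i, g x = g (f.a j i) := by
    have h1 : ∀ x, (∃ i, g x = g (f.a j i)) = (∃ i, g 0 = g (f.a j i)) := by
      intro x
      refine f.const_of_const (fun x => ∃ i, g x = g (f.a j i)) ?_ x
      intro m i
      by_cases hmj : m = j
      · subst hmj
        exact propext ⟨fun _ => ⟨0, rfl⟩, fun _ => ⟨i, rfl⟩⟩
      · simp only [hm m hmj i]
    intro x
    rw [h1 x, ← h1 (f.a j 0)]
    exact ⟨0, rfl⟩
  choose br hbr using hall
  refine ⟨br, ?_, ?_⟩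
  · intro i
    exact (hinj _ _ (hbr (f.a j i))).symm
  · intro m hmj i
    apply hinj
    rw [← hbr, ← hbr, hm m hmj i]

/-- branch function of the polygon `j` -/
noncomputable def br (j : Fin n) : Fin (k * n + 1) → Fin (k + 1) := (f.exists_br j).choose

theorem br_self (j : Fin n) (i : Fin (k + 1)) : f.br j (f.a j i) = i :=
  (f.exists_br j).choose_spec.1 i

theorem br_other {j m : Fin n} (h : m ≠ j) (i i' : Fin (k + 1)) :
    f.br j (f.a m i) = f.br j (f.a m i') := by
  have := (f.exists_br j).choose_spec.2 m h
  exact (this i).trans (this i').symm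

/-- polygon vertices, counted from the vertex nearest to `0` -/
noncomputable def B (j : Fin n) (s : Fin (k + 1)) : Fin (k * n + 1) := f.a j (f.br j 0 + s)

theorem br_B (j : Fin n) (s : Fin (k + 1)) : f.br j (f.B j s) = f.br j 0 + s := f.br_self _ _

theorem B_inj (j : Fin n) {s s' : Fin (k + 1)} (h : f.B j s = f.B j s') : s = s' :=
  add_left_cancel (f.inj j h)

theorem a_eq_B (j : Fin n) (i : Fin (k + 1)) : f.a j i = f.B j (i - f.br j 0) := by
  unfold B
  congr 1
  abel

theorem B_other {j m : Fin n} (h : m ≠ j) (i i' : Fin (k + 1)) :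
    f.br j (f.B m i) = f.br j (f.B m i') := f.br_other h _ _

theorem false_of_const (g : Fin (k * n + 1) → Prop) (h0 : ¬ g 0)
    (hg : ∀ j i i', g (f.B j i) → g (f.B j i')) (x : Fin (k * n + 1)) : ¬ g x := by
  have := f.const_of_const g (by
    intro j i
    rw [a_eq_B, a_eq_B]
    exact propext ⟨hg _ _ _, hg _ _ _⟩) x
  rwa [this]

theorem B_succ_ne (j : Fin n) (t : Fin k) : f.B j t.succ ≠ 0 := by
  intro h
  have := f.br_B j t.succ
  rw [h] at this
  exact Fin.succ_ne_zero t (left_eq_add.1 this)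

theorem B_succ_inj {j m : Fin n} {t r : Fin k} (h : f.B j t.succ = f.B m r.succ) :
    j = m ∧ t = r := by
  by_cases hjm : j = m
  · subst hjm
    exact ⟨rfl, Fin.succ_injective _ (f.B_inj j h)⟩
  · exfalso
    refine f.false_of_const (fun x => f.br j x = f.br j 0 + t.succ ∨ f.br m x = f.br m 0 + r.succ)
      ?_ ?_ (f.B j t.succ) (Or.inl (f.br_B _ _))
    · rintro (h | h)
      · exact Fin.succ_ne_zero t (left_eq_add.1 h)
      · exact Fin.succ_ne_zero r (left_eq_add.1 h)
    · intro p i i' hp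
      by_cases hpj : p = j
      · right
        subst hpj
        rw [f.B_other hjm i' t.succ, h, br_B]
      by_cases hpm : p = m
      · left
        subst hpm
        rw [f.B_other (Ne.symm hjm) i' r.succ, ← h, br_B]
      rw [f.B_other hpj i' i, f.B_other hpm i' i]
      exact hp

theorem B_succ_surj (x : Fin (k * n + 1)) (hx : x ≠ 0) :
    ∃ p : Fin n × Fin k, f.B p.1 p.2.succ = x := by
  let ψ : Fin n × Fin k → {x : Fin (k * n + 1) // x ≠ 0} :=
    fun p => ⟨f.B p.1 p.2.succ, f.B_succ_ne _ _⟩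
  have hi : Function.Injective ψ := by
    intro p q h
    have := f.B_succ_inj (congrArg Subtype.val h)
    exact Prod.ext this.1 this.2
  have hb := (Fintype.bijective_iff_injective_and_card ψ).2 ⟨hi, by
    rw [Fintype.card_subtype_compl]
    simp [mul_comm]⟩
  obtain ⟨p, hp⟩ := hb.2 ⟨x, hx⟩
  exact ⟨p, congrArg Subtype.val hp⟩

/-- the pair (polygon, index) leading to `x` -/
noncomputable def up (x : Fin (k * n + 1)) : Option (Fin n × Fin k) :=
  if h : x = 0 then none else some (f.B_succ_surj x h).choose

theorem up_zero : f.up 0 = none := by simp [up]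

theorem up_B (j : Fin n) (t : Fin k) : f.up (f.B j t.succ) = some (j, t) := by
  unfold up
  rw [dif_neg (f.B_succ_ne j t)]
  congr 1
  have := (f.B_succ_surj _ (f.B_succ_ne j t)).choose_spec
  have := f.B_succ_inj this
  exact Prod.ext this.1 this.2

theorem up_some {x : Fin (k * n + 1)} {p : Fin n × Fin k} (h : f.up x = some p) :
    f.B p.1 p.2.succ = x := by
  by_cases hx : x = 0
  · rw [hx, up_zero] at h
    cases h
  · obtain ⟨q, rfl⟩ := f.B_succ_surj x hx
    rw [up_B] at h
    rw [← Option.some.inj h]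

theorem up_none {x : Fin (k * n + 1)} (h : f.up x = none) : x = 0 := by
  by_contra hx
  obtain ⟨q, rfl⟩ := f.B_succ_surj x hx
  rw [up_B] at h
  cases h

/-- descent set of a polygon -/
def Sset (j : Fin n) : Set (Fin (k * n + 1)) := {x | f.br j x ≠ f.br j 0}

theorem Sset_ssubset {j m : Fin n} {t : Fin k} (h : f.B m t.succ = f.B j 0) :
    f.Sset j ⊂ f.Sset m := by
  have hjm : j ≠ m := by
    rintro rfl
    exact Fin.succ_ne_zero t (f.B_inj j h)
  have hm : ∀ i, f.br m (f.B j i) ≠ f.br m 0 := by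
    intro i hi
    rw [f.B_other hjm i 0, ← h, br_B] at hi
    exact Fin.succ_ne_zero t (add_eq_left.1 hi)
  have hj : ∀ i, f.br j (f.B m i) = f.br j 0 := by
    intro i
    rw [f.B_other (Ne.symm hjm) i t.succ, h, br_B, add_zero]
  rw [Set.ssubset_iff_of_subset]
  · refine ⟨f.B j 0, hm 0, ?_⟩
    intro hx
    apply hx
    rw [br_B, add_zero]
  · intro x hx
    by_contra hx'
    have hx' : f.br m x = f.br m 0 := not_not.1 hx'
    refine f.false_of_const (fun x => f.br j x ≠ f.br j 0 ∧ f.br m x = f.br m 0) ?_ ?_ x ⟨hx, hx'⟩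
    · exact fun h => h.1 rfl
    · rintro p i i' ⟨h1, h2⟩
      by_cases hpj : p = j
      · subst hpj
        exact (hm i h2).elim
      by_cases hpm : p = m
      · subst hpm
        exact (h1 (hj i)).elim
      rw [f.B_other hpj i' i, f.B_other hpm i' i]
      exact ⟨h1, h2⟩

/-- the forest of a factorization -/
noncomputable def toForest (hk : 1 ≤ k) : KForest n k where
  parent j := (f.up (f.B j 0)).map Prod.fst
  acyclic := by
    have key : ∀ u v, Relation.TransGen
        (fun a b : Fin n => (f.up (f.B a 0)).map Prod.fst = some b) u v →
        f.Sset u ⊂ f.Sset v := by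
      intro u v h
      have step : ∀ a b, (f.up (f.B a 0)).map Prod.fst = some b → f.Sset a ⊂ f.Sset b := by
        intro a b hab
        rw [Option.map_eq_some_iff] at hab
        obtain ⟨p, hp, rfl⟩ := hab
        exact f.Sset_ssubset (f.up_some hp)
      induction h with
      | single h => exact step _ _ h
      | tail _ h ih => exact ih.trans (step _ _ h)
    intro v h
    exact (key v v h).ne rfl
  colour j := ((f.up (f.B j 0)).map (fun p => p.2.val)).getD 0
  colour_lt := by
    intro j
    rcases f.up (f.B j 0) with _ | p
    · exact hk
    · exact p.2.isLt
  colour_root := by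
    intro j hj
    rw [Option.map_eq_none_iff] at hj
    rw [hj]
    rfl

theorem ext_a {f f' : MinKFact n k} (h : f.a = f'.a) : f = f' := by
  cases f
  cases f'
  cases h
  rfl

theorem toForest_injective (hk : 1 ≤ k) :
    Function.Injective (fun f : MinKFact n k => f.toForest hk) := by
  intro f f' h
  have hup : ∀ j, f.up (f.B j 0) = f'.up (f'.B j 0) := by
    intro j
    have h1 := congrArg (fun F : KForest n k => F.parent j) h
    have h2 := congrArg (fun F : KForest n k => F.colour j) h
    change (f.up (f.B j 0)).map Prod.fst = (f'.up (f'.B j 0)).map Prod.fst at h1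
    change ((f.up (f.B j 0)).map (fun p => p.2.val)).getD 0
      = ((f'.up (f'.B j 0)).map (fun p => p.2.val)).getD 0 at h2
    generalize f.up (f.B j 0) = x at h1 h2 ⊢
    generalize f'.up (f'.B j 0) = y at h1 h2 ⊢
    rcases x with _ | p <;> rcases y with _ | q
    · rfl
    · simp at h1
    · simp at h1
    · simp only [Option.map_some, Option.some.injEq, Option.getD_some] at h1 h2
      congr 1
      exact Prod.ext h1 (Fin.ext h2)
  let b : Fin (k * n + 1) → Fin (k * n + 1) := fun x =>
    (f.up x).elim 0 (fun p => f'.B p.1 p.2.succ)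
  have bB : ∀ j s, b (f.B j s) = f'.B j s := by
    intro j s
    refine Fin.cases ?_ ?_ s
    · show (f.up (f.B j 0)).elim 0 (fun p => f'.B p.1 p.2.succ) = _
      rw [hup]
      rcases hp : f'.up (f'.B j 0) with _ | p
      · exact (f'.up_none hp).symm
      · exact f'.up_some hp
    · intro t
      show (f.up (f.B j t.succ)).elim 0 (fun p => f'.B p.1 p.2.succ) = _
      rw [up_B]
      rfl
  have b0 : b 0 = 0 := by
    show (f.up 0).elim 0 (fun p => f'.B p.1 p.2.succ) = _
    rw [up_zero]
    rfl
  have binj : Function.Injective b := by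
    intro x y hxy
    by_cases hx : x = 0
    · by_cases hy : y = 0
      · rw [hx, hy]
      · obtain ⟨q, rfl⟩ := f.B_succ_surj y hy
        rw [hx, b0, bB] at hxy
        exact (f'.B_succ_ne _ _ hxy.symm).elim
    · obtain ⟨p, rfl⟩ := f.B_succ_surj x hx
      by_cases hy : y = 0
      · rw [hy, b0, bB] at hxy
        exact (f'.B_succ_ne _ _ hxy).elim
      · obtain ⟨q, rfl⟩ := f.B_succ_surj y hy
        rw [bB, bB] at hxy
        have := f'.B_succ_inj hxy
        rw [this.1, this.2]
  have tauB : ∀ (f : MinKFact n k) j s,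
      (List.ofFn (f.a j)).formPerm (f.B j s) = f.B j (s + 1) := by
    intro f j s
    unfold B
    rw [tau_apply, add_assoc]
  have hconj := list_prod_semiconj b (fun j => (List.ofFn (f.a j)).formPerm)
    (fun j => (List.ofFn (f'.a j)).formPerm) (by
      intro j x
      by_cases hx : ∃ i, f.a j i = x
      · obtain ⟨i, rfl⟩ := hx
        rw [a_eq_B, tauB, bB, bB, tauB]
      · rw [tau_notMem, tau_notMem]
        · intro i hi
          rw [a_eq_B, ← bB] at hi
          exact hx ⟨_, binj hi⟩
        · intro i hi
          exact hx ⟨i, hi⟩)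
  rw [f.prod_eq, f'.prod_eq] at hconj
  have hid : ∀ x, b x = x := by
    intro x
    refine fin_induction (fun x => b x = x) b0 ?_ x
    intro x hx
    have := hconj x
    rw [finRotate_apply, finRotate_apply, hx] at this
    exact this
  have hBB : ∀ j s, f.B j s = f'.B j s := by
    intro j s
    rw [← bB, hid]
  apply ext_a
  funext j i
  let d := f'.br j 0 - f.br j 0
  have hd : ∀ i, f.a j i = f'.a j (i + d) := by
    intro i
    rw [a_eq_B, hBB, a_eq_B f']
    congr 1
    show _ = i + (f'.br j 0 - f.br j 0) - _
    abel
  have h1 : f.a j 0 = f'.a j d := by rw [hd, zero_add]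
  have h2 : f.a j (-d) = f'.a j 0 := by rw [hd, neg_add_cancel]
  have h3 : f.a j 0 ≤ f'.a j 0 := by
    rw [← h2]
    exact f.min_first j _
  have h4 : f'.a j 0 ≤ f.a j 0 := by
    rw [h1]
    exact f'.min_first j _
  have h5 : d = 0 := f'.inj j (h1.symm.trans (le_antisymm h3 h4))
  rw [hd i, h5, add_zero]

end cactus

theorem exists_bijection (n k : ℕ) (hk : 1 ≤ k) :
    ∃ φ : MinKFact n k ≃ KForest n k,
      ∀ f : MinKFact n k,
        MinKFact.areak f = k * (KForest.invk (φ f) : ℤ) ∧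
        MinKFact.coareak f = k * (KForest.coinvk (φ f) : ℤ) ∧
        MinKFact.semiareak f = k * ((φ f).toRootedForest.inv : ℤ) ∧
        MinKFact.cosemiareak f = k * ((φ f).toRootedForest.coinv : ℤ) := by
  have hfin : Finite (MinKFact n k) := Finite.of_injective _ (toForest_injective (n := n) hk)
  have hbij : Function.Bijective (fun F : KForest n k => F.toFact hk) := by
    have h1 := KForest.toFact_injective (n := n) hk
    refine (Nat.bijective_iff_injective_and_card _).2 ⟨h1, ?_⟩
    exact le_antisymm (Nat.card_le_card_of_injective _ h1)
      (Nat.card_le_card_of_injective _ (toForest_injective (n := n) hk))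
  obtain ⟨e, he⟩ := KForest.exists_equiv_maj_inv (n := n) (k := k)
  refine ⟨(Equiv.ofBijective _ hbij).symm.trans e, ?_⟩
  intro f
  obtain ⟨F, rfl⟩ := hbij.2 f
  have hF : ((Equiv.ofBijective _ hbij).symm.trans e) (F.toFact hk) = e F := by
    rw [Equiv.trans_apply]
    congr 1
    exact (Equiv.ofBijective _ hbij).symm_apply_apply F
  show MinKFact.areak (F.toFact hk) = _ ∧ MinKFact.coareak (F.toFact hk) = _ ∧
    MinKFact.semiareak (F.toFact hk) = _ ∧ MinKFact.cosemiareak (F.toFact hk) = _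
  simp only [hF]
  have hs := he F
  simp only [KForest.stat1, KForest.stat2, Prod.mk.injEq] at hs
  obtain ⟨s1, s2, s3, s4⟩ := hs
  rw [F.areak_toFact, F.coareak_toFact, F.semiareak_toFact, F.cosemiareak_toFact]
  unfold KForest.invk KForest.coinvk
  push_cast
  rw [s1, s2, s3, s4]
  exact ⟨rfl, rfl, rfl, rfl⟩

end MinKFact

/-- For all `n, k ≥ 1` there is a bijection `φ̂ : F_n^k → R_n^k` such that,
with `F = φ̂ f`: `area_k f = k·inv_k F`, `coarea_k f = k·coinv_k F`,
`semiarea_k f = k·inv F`, and `cosemiarea_k f = k·coinv F`. -/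
theorem stmt2 (n k : ℕ) (hn : 1 ≤ n) (hk : 1 ≤ k) :
    ∃ φ : MinKFact n k ≃ KForest n k,
      ∀ f : MinKFact n k,
        MinKFact.areak f = k * (KForest.invk (φ f) : ℤ) ∧
        MinKFact.coareak f = k * (KForest.coinvk (φ f) : ℤ) ∧
        MinKFact.semiareak f = k * ((φ f).toRootedForest.inv : ℤ) ∧
        MinKFact.cosemiareak f = k * ((φ f).toRootedForest.coinv : ℤ) := by
  exact MinKFact.exists_bijection n k hk
end

section
/- For all n, k ≥ 1, the sum over all minimal k-factorizations f = (τ_1,…,τ_n) ∈ F_n^k of the product ∏_{j=1}^n 1/(a_j^k − a_j^0) equals (k+1)(2k+1)⋯((n−1)k+1)/k^n. -/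
instance (n k : ℕ) : Finite (MinKFact n k) :=
  Finite.of_injective (fun f => f.a) (by
    rintro ⟨a, _, _, _⟩ ⟨b, _, _, _⟩ h
    simp only at h
    subst h
    rfl)

noncomputable instance (n k : ℕ) : Fintype (MinKFact n k) := Fintype.ofFinite _

namespace KF
section conv
variable {α : Type*}

/-- sum over all splittings `l = p ++ q` -/
def sp : (List α → List α → ℚ) → List α → ℚ
  | f, [] => f [] []
  | f, a :: l => f [] (a :: l) + sp (fun p q => f (a :: p) q) l

theorem sp_nil (f : List α → List α → ℚ) : sp f [] = f [] [] := rfl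
theorem sp_cons (f : List α → List α → ℚ) (a : α) (l : List α) :
    sp f (a :: l) = f [] (a :: l) + sp (fun p q => f (a :: p) q) l := rfl

theorem sp_congr (l : List α) : ∀ (f g : List α → List α → ℚ)
    (_ : ∀ p q, p ++ q = l → f p q = g p q), sp f l = sp g l := by
  induction l with
  | nil => intro f g h; exact h [] [] rfl
  | cons a l ih =>
    intro f g h
    rw [sp_cons, sp_cons, h [] (a :: l) rfl,
      ih _ (fun p q => g (a :: p) q) (fun p q hpq => h _ _ (by simp [hpq]))]

theorem sp_zero (l : List α) : sp (fun _ _ => 0) l = 0 := by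
  induction l with
  | nil => rfl
  | cons a l ih => rw [sp_cons, ih]; simp

theorem sp_eq_zero (l : List α) (f : List α → List α → ℚ)
    (h : ∀ p q, p ++ q = l → f p q = 0) : sp f l = 0 := by
  rw [sp_congr l f (fun _ _ => 0) h, sp_zero]

theorem sp_add (l : List α) : ∀ (f g : List α → List α → ℚ),
    sp (fun p q => f p q + g p q) l = sp f l + sp g l := by
  induction l with
  | nil => intro f g; rfl
  | cons a l ih => intro f g; rw [sp_cons, sp_cons, sp_cons, ih]; ring

theorem sp_mul_left (c : ℚ) (l : List α) : ∀ (f : List α → List α → ℚ),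
    sp (fun p q => c * f p q) l = c * sp f l := by
  induction l with
  | nil => intro f; rfl
  | cons a l ih => intro f; rw [sp_cons, sp_cons, ih]; ring

theorem sp_mul_right (c : ℚ) (l : List α) (f : List α → List α → ℚ) :
    sp (fun p q => f p q * c) l = sp f l * c := by
  rw [mul_comm, ← sp_mul_left]; simp only [mul_comm]

theorem sp_assoc (l : List α) : ∀ (f : List α → List α → List α → ℚ),
    sp (fun p q => sp (fun a b => f a b q) p) l =
      sp (fun a r => sp (fun b q => f a b q) r) l := by
  induction l with
  | nil => intro f; rfl
  | cons a l ih =>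
    intro f
    simp only [sp_cons, sp_nil]
    rw [sp_add, ih (fun x => f (a :: x))]
    ring

theorem sp_comm (l₁ : List α) : ∀ (l₂ : List α) (F : List α → List α → List α → List α → ℚ),
    sp (fun a b => sp (fun c d => F a b c d) l₂) l₁ =
      sp (fun c d => sp (fun a b => F a b c d) l₁) l₂ := by
  induction l₁ with
  | nil => intro l₂ F; rfl
  | cons a l ih =>
    intro l₂ F
    simp only [sp_cons]
    rw [sp_add, ih l₂ (fun x => F (a :: x))]

open Classical in
theorem sp_append (A : List α) : ∀ (q : List α) (f : List α → List α → ℚ),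
    sp f (A ++ q) = sp (fun p A' => f p (A' ++ q)) A +
      sp (fun q' r => if q' = [] then 0 else f (A ++ q') r) q := by
  induction A with
  | nil =>
    intro q f
    cases q with
    | nil => simp [sp_nil]
    | cons a q => simp [sp_nil, sp_cons]
  | cons a A ih =>
    intro q f
    simp only [List.cons_append, sp_cons, ih]
    ring

/-- convolution -/
def cv (f g : List α → ℚ) (l : List α) : ℚ := sp (fun p q => f p * g q) l

/-- convolution powers -/
def pw (f : List α → ℚ) : ℕ → List α → ℚ
  | 0, [] => 1
  | 0, _ :: _ => 0
  | i + 1, l => sp (fun p q => f p * pw f i q) l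

theorem pw_succ (f : List α → ℚ) (i : ℕ) (l : List α) :
    pw f (i+1) l = sp (fun p q => f p * pw f i q) l := by simp [pw]

theorem pw_zero_nil (f : List α → ℚ) : pw f 0 [] = 1 := by simp [pw]
theorem pw_zero_of_ne (f : List α → ℚ) {l : List α} (h : l ≠ []) : pw f 0 l = 0 := by
  cases l with
  | nil => exact absurd rfl h
  | cons a l => simp [pw]

theorem sp_pw_zero_left (f : List α → ℚ) (l : List α) :
    ∀ (g : List α → List α → ℚ), sp (fun p q => pw f 0 p * g p q) l = g [] l := by
  intro g
  cases l with
  | nil => simp [sp_nil, pw_zero_nil]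
  | cons a l =>
    rw [sp_cons, sp_eq_zero, pw_zero_nil]
    · ring
    · intro p q _; rw [pw_zero_of_ne _ (by simp)]; ring

theorem sp_pw_zero_right (f : List α → ℚ) (l : List α) :
    ∀ (g : List α → ℚ), sp (fun p q => g p * pw f 0 q) l = g l := by
  induction l with
  | nil => intro g; simp [sp_nil, pw_zero_nil]
  | cons a l ih =>
    intro g
    rw [sp_cons, ih (fun p => g (a :: p)), pw_zero_of_ne _ (by simp)]; ring

theorem pw_one (f : List α → ℚ) (l : List α) : pw f 1 l = f l := by
  rw [pw_succ, sp_pw_zero_right]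

theorem pw_succ' (f : List α → ℚ) (i : ℕ) : ∀ (l : List α),
    pw f (i+1) l = sp (fun p q => pw f i p * f q) l := by
  induction i with
  | zero => intro l; rw [pw_one, sp_pw_zero_left f l (fun _ q => f q)]
  | succ i ih =>
    intro l
    rw [pw_succ]
    rw [sp_congr l _ (fun p r => sp (fun b q => f p * pw f i b * f q) r)
      (fun p q _ => by rw [ih, ← sp_mul_left]; simp only [mul_assoc])]
    rw [← sp_assoc l (fun p b q => f p * pw f i b * f q)]
    apply sp_congr
    intro p q _
    rw [sp_mul_right, pw_succ]

theorem pw_eq_zero (f : List α → ℚ) (h : f [] = 0) (i : ℕ) : ∀ l : List α, l.length < i →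
    pw f i l = 0 := by
  induction i with
  | zero => intro l hl; simp at hl
  | succ i ih =>
    intro l hl
    rw [pw_succ]
    apply sp_eq_zero
    intro p q hpq
    cases p with
    | nil => rw [h]; ring
    | cons a p =>
      rw [ih q]; · ring
      have := congrArg List.length hpq
      simp at this; omega

/-- congruence: with `f [] = 0`, `pw f i l`, `2 ≤ i`, only sees lists shorter than `l`. -/
theorem pw_congr (f g : List α → ℚ) (i : ℕ) : ∀ l : List α,
    (∀ p, p.length ≤ l.length → f p = g p) → pw f i l = pw g i l := by
  induction i with
  | zero => intro l _; cases l <;> simp [pw]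
  | succ i ih =>
    intro l h
    rw [pw_succ, pw_succ]
    apply sp_congr
    intro p q hpq
    have := congrArg List.length hpq
    simp at this
    rw [h p (by omega), ih q (fun p' hp' => h p' (by omega))]

theorem pw_congr_lt (f g : List α → ℚ) (hf : f [] = 0) (hg : g [] = 0) (i : ℕ) (l : List α)
    (h : ∀ p, p.length < l.length → f p = g p) : pw f (i+2) l = pw g (i+2) l := by
  rw [pw_succ, pw_succ]
  apply sp_congr
  intro p q hpq
  have hlen := congrArg List.length hpq
  simp at hlen
  by_cases hp : p = []
  · subst hp; rw [hf, hg]; ring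
  by_cases hq : q = []
  · subst hq; rw [pw_eq_zero f hf _ _ (by simp), pw_eq_zero g hg _ _ (by simp)]; ring
  have h1 := List.length_pos_iff.2 hp
  have h2 := List.length_pos_iff.2 hq
  rw [h p (by omega), pw_congr f g _ q (fun p' hp' => h p' (by omega))]

/-- the removal operator -/
def Op (c : List α → List α → ℚ) (g : List α → ℚ) (l : List α) : ℚ :=
  sp (fun A t => sp (fun m q => c m q * g (A ++ q)) t) l

theorem Op_conv (c : List α → List α → ℚ) (hc0 : ∀ m, c m [] = 0)
    (hc : ∀ m q r, q ≠ [] → c m (q ++ r) = c m q) (f g : List α → ℚ) (l : List α) :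
    Op c (fun l => sp (fun p q => f p * g q) l) l =
      sp (fun p q => Op c f p * g q) l + sp (fun p q => f p * Op c g q) l := by
  classical
  unfold Op
  have e1 : ∀ A t m q : List α, m ++ q = t → c m q * sp (fun p q => f p * g q) (A ++ q) =
      sp (fun p A' => f p * (c m q * g (A' ++ q))) A +
      sp (fun q' r => c m q' * f (A ++ q') * g r) q := by
    intro A t m q _
    rw [sp_append, mul_add, ← sp_mul_left, ← sp_mul_left]
    congr 1
    · apply sp_congr; intros; ring
    · apply sp_congr; intro q' r hq
      by_cases h : q' = []
      · subst h; simp [hc0]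
      · rw [if_neg h, ← hq, hc _ _ _ h]; ring
  rw [sp_congr l _ (fun A t => sp (fun p A' => f p * sp (fun m q => c m q * g (A' ++ q)) t) A +
     sp (fun W r => sp (fun m q' => c m q' * f (A ++ q')) W * g r) t)]
  · rw [sp_add, add_comm]
    congr 1
    · rw [← sp_assoc l (fun A W r => sp (fun m q' => c m q' * f (A ++ q')) W * g r)]
      apply sp_congr; intro p q _
      rw [sp_mul_right]
    · rw [sp_assoc l (fun p A' t => f p * sp (fun m q => c m q * g (A' ++ q)) t)]
      apply sp_congr; intro p q _
      rw [sp_mul_left]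
  · intro A t _
    rw [sp_congr t _ _ (e1 A t), sp_add]
    congr 1
    · rw [sp_comm]
      apply sp_congr; intro p A' _
      rw [sp_mul_left]
    · rw [← sp_assoc t (fun m q' r => c m q' * f (A ++ q') * g r)]
      apply sp_congr; intro p q _
      rw [sp_mul_right]

end conv
end KF

namespace KF
section vee
variable {α : Type*}

def hd (x : α → ℚ) : List α → ℚ
  | [] => 0
  | a :: _ => x a

def la (x : α → ℚ) : List α → ℚ
  | [] => 0
  | [a] => x a
  | _ :: b :: l => la x (b :: l)

theorem hd_append (x : α → ℚ) {m : List α} (hm : m ≠ []) (q : List α) : hd x (m ++ q) = hd x m := by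
  cases m with
  | nil => exact absurd rfl hm
  | cons a m => rfl

theorem la_cons (x : α → ℚ) (a : α) {q : List α} (hq : q ≠ []) : la x (a :: q) = la x q := by
  cases q with
  | nil => exact absurd rfl hq
  | cons b q => rfl

theorem la_append (x : α → ℚ) (m : List α) {q : List α} (hq : q ≠ []) :
    la x (m ++ q) = la x q := by
  induction m with
  | nil => rfl
  | cons a m ih => rw [List.cons_append, la_cons _ _ (by simp [hq]), ih]

theorem la_mem (x : α → ℚ) (q : List α) (hq : q ≠ []) : ∃ a ∈ q, la x q = x a := by
  induction q with
  | nil => exact absurd rfl hq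
  | cons b q ih =>
    by_cases h : q = []
    · subst h; exact ⟨b, by simp, rfl⟩
    · obtain ⟨a, ha, e⟩ := ih h
      exact ⟨a, by simp [ha], by rw [la_cons _ _ h, e]⟩

/-- the span of a list -/
def dl (x : α → ℚ) (l : List α) : ℚ := la x l - hd x l

theorem dl_ne_zero {x : α → ℚ} (hx : Function.Injective x) {l : List α} (hl : l.Nodup)
    (h2 : 2 ≤ l.length) : dl x l ≠ 0 := by
  match l, h2 with
  | a :: b :: l, _ =>
    obtain ⟨z, hz, e⟩ := la_mem x (b :: l) (by simp)
    unfold dl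
    rw [la_cons _ _ (by simp), e]
    simp only [hd]
    intro h
    have : z = a := hx (by linarith)
    subst this
    exact (List.nodup_cons.1 hl).1 hz

def Vf (k : ℕ) (x : α → ℚ) : ℕ → List α → ℚ
  | 0, _ => 0
  | _ + 1, [] => 0
  | _ + 1, [_] => 1
  | n + 1, a :: b :: l => pw (Vf k x n) (k+1) (a :: b :: l) / dl x (a :: b :: l)

def V (k : ℕ) (x : α → ℚ) (l : List α) : ℚ := Vf k x l.length l

theorem Vf_nil (k : ℕ) (x : α → ℚ) (n : ℕ) : Vf k x n [] = 0 := by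
  cases n <;> simp [Vf]

theorem Vf_eq (k : ℕ) (hk : 1 ≤ k) (x : α → ℚ) (M : ℕ) : ∀ (l : List α) (n : ℕ),
    l.length ≤ n → l.length ≤ M → Vf k x n l = V k x l := by
  obtain ⟨k, rfl⟩ : ∃ j, k = j + 1 := ⟨k-1, by omega⟩
  induction M with
  | zero =>
    intro l n _ h
    have : l = [] := List.length_eq_zero_iff.1 (by omega)
    subst this
    simp [V, Vf_nil]
  | succ M ih =>
    intro l n hn hM
    match l, n with
    | [], n => simp [V, Vf_nil]
    | [a], n+1 => simp [V, Vf]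
    | a :: b :: l, n+1 =>
      simp only [V, List.length_cons, Vf]
      congr 1
      apply pw_congr_lt _ _ (Vf_nil _ _ _) (Vf_nil _ _ _)
      intro p hp
      simp only [List.length_cons] at hp hn hM
      rw [ih p n (by omega) (by omega), ih p (l.length+1) (by omega) (by omega)]

theorem V_nil (k : ℕ) (x : α → ℚ) : V k x [] = 0 := Vf_nil _ _ _
theorem V_single (k : ℕ) (x : α → ℚ) (a : α) : V k x [a] = 1 := by simp [V, Vf]

theorem V_spec (k : ℕ) (hk : 1 ≤ k) {x : α → ℚ} (hx : Function.Injective x) {l : List α}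
    (hl : l.Nodup) : dl x l * V k x l = pw (V k x) (k+1) l := by
  match l, hl with
  | [], _ => rw [V_nil, pw_eq_zero _ (V_nil _ _) _ _ (by simp)]; ring
  | [a], _ => 
    rw [V_single, pw_eq_zero _ (V_nil _ _) _ _ (by simp; omega)]; simp [dl, la, hd]
  | a :: b :: l, hl =>
    have h := dl_ne_zero hx hl (by simp)
    obtain ⟨k, rfl⟩ : ∃ j, k = j + 1 := ⟨k-1, by omega⟩
    have : V (k+1) x (a :: b :: l) = pw (V (k+1) x) (k+1+1) (a :: b :: l) / dl x (a :: b :: l) := by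
      conv_lhs => simp only [V, List.length_cons, Vf]
      congr 1
      apply pw_congr_lt _ _ (Vf_nil _ _ _) (V_nil _ _)
      intro p hp
      simp only [List.length_cons] at hp
      exact Vf_eq _ hk x p.length p _ (by omega) le_rfl
    rw [this, mul_div_cancel₀ _ h]

/-- the coefficient of the removal operator -/
def cc (k : ℕ) (x : α → ℚ) : List α → List α → ℚ
  | _, [] => 0
  | m, a :: _ => pw (V k x) k m / (x a - hd x m)

theorem cc_append (k : ℕ) (x : α → ℚ) (m q r : List α) (hq : q ≠ []) :
    cc k x m (q ++ r) = cc k x m q := by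
  cases q with
  | nil => exact absurd rfl hq
  | cons a q => rfl

theorem Op_nil (k : ℕ) (x : α → ℚ) (g : List α → ℚ) : Op (cc k x) g [] = 0 := by
  simp [Op, sp_nil, cc]

theorem Op_single (k : ℕ) (hk : 1 ≤ k) (x : α → ℚ) (g : List α → ℚ) (a : α) :
    Op (cc k x) g [a] = 0 := by
  simp [Op, sp_nil, sp_cons, cc, pw_eq_zero _ (V_nil k x) k [] (by simp; omega)]

theorem Op_pw_zero (k : ℕ) (x : α → ℚ) (f : List α → ℚ) (l : List α) :
    Op (cc k x) (pw f 0) l = 0 := by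
  unfold Op
  apply sp_eq_zero; intro A t _
  apply sp_eq_zero; intro m q _
  cases q with
  | nil => simp [cc]
  | cons a q => rw [pw_zero_of_ne _ (by simp)]; ring

theorem Op_pw_succ (k : ℕ) (x : α → ℚ) (f : List α → ℚ) (i : ℕ) (l : List α) :
    Op (cc k x) (pw f (i+1)) l = sp (fun p q => Op (cc k x) f p * pw f i q) l +
      sp (fun p q => f p * Op (cc k x) (pw f i) q) l := by
  rw [← Op_conv (cc k x) (fun m => by cases m <;> rfl) (cc_append k x)]
  congr 1

theorem Op_congr (k : ℕ) (x : α → ℚ) (f g : List α → ℚ) (l : List α)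
    (h : ∀ p, p.Sublist l → f p = g p) : Op (cc k x) f l = Op (cc k x) g l := by
  unfold Op
  apply sp_congr; intro A t hA
  apply sp_congr; intro m q hm
  rw [h]
  rw [← hA, ← hm]
  exact List.Sublist.append (List.Sublist.refl _) (List.sublist_append_right _ _)

theorem Op_dl (k : ℕ) (hk : 1 ≤ k) {x : α → ℚ} (hx : Function.Injective x) {l : List α}
    (hl : l.Nodup) :
    dl x l * Op (cc k x) (V k x) l =
      Op (cc k x) (fun l => dl x l * V k x l) l + pw (V k x) (k+1) l := by
  have hV := V_nil k x
  have hP : pw (V k x) k [] = 0 := pw_eq_zero _ hV _ _ (by simp; omega)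
  -- the case of an empty left part
  have key : ∀ m q : List α, m ++ q = l → dl x l * (cc k x m q * V k x q) =
      cc k x m q * (dl x q * V k x q) + pw (V k x) k m * V k x q := by
    intro m q hmq
    cases q with
    | nil => simp [cc, hV]
    | cons a q =>
      cases m with
      | nil => simp [cc, hP]
      | cons b m =>
        have : x a - x b ≠ 0 := by
          intro h
          have : a = b := hx (by linarith)
          subst this
          rw [← hmq] at hl
          simp at hl
        rw [← hmq]
        simp only [cc, dl, hd]
        rw [la_append _ _ (by simp)]
        simp only [List.cons_append, hd]
        field_simp
        ring
  unfold Op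
  cases l with
  | nil => simp [sp_nil, cc, pw_eq_zero _ hV (k+1) [] (by simp)]
  | cons a l =>
    rw [sp_cons, sp_cons (fun A t => sp (fun m q => cc k x m q * (dl x (A ++ q) * V k x (A ++ q))) t), pw_succ']
    rw [mul_add, ← sp_mul_left, ← sp_mul_left]
    simp only [← sp_mul_left, List.nil_append]
    rw [sp_congr (a :: l) _ _ key, sp_add]
    rw [add_right_comm]
    congr 2
    apply sp_congr; intro A t hA
    apply sp_congr; intro m q hm
    cases q with
    | nil => simp [cc]
    | cons b q =>
      have : dl x (a :: l) = dl x (a :: A ++ b :: q) := by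
        rw [← hA, ← hm]
        simp only [dl, List.cons_append, hd]
        rw [← List.cons_append, ← List.cons_append, la_append _ _ (by simp), la_append _ _ (by simp), la_append _ _ (by simp)]
      rw [this]; ring

theorem Op_V (k : ℕ) (hk : 1 ≤ k) {x : α → ℚ} (hx : Function.Injective x) (M : ℕ) :
    ∀ l : List α, l.length ≤ M → l.Nodup →
      Op (cc k x) (V k x) l = (((l.length : ℚ) - 1) / k) * V k x l := by
  have hk0 : (k : ℚ) ≠ 0 := by positivity
  induction M with
  | zero =>
    intro l h _
    have : l = [] := List.length_eq_zero_iff.1 (by omega)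
    subst this
    rw [Op_nil, V_nil]; ring
  | succ M ih =>
    -- powers on shorter lists
    have hpow : ∀ i (l : List α), l.length ≤ M → l.Nodup →
        Op (cc k x) (pw (V k x) i) l = (((l.length : ℚ) - i) / k) * pw (V k x) i l := by
      intro i
      induction i with
      | zero =>
        intro l _ _
        rw [Op_pw_zero]
        cases l with
        | nil => simp
        | cons a l => rw [pw_zero_of_ne _ (by simp)]; ring
      | succ i ihi =>
        intro l hM hn
        rw [Op_pw_succ, ← sp_add, pw_succ, ← sp_mul_left]
        apply sp_congr; intro p q hpq
        have hlen := congrArg List.length hpq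
        simp only [List.length_append] at hlen
        rw [← hpq] at hn
        rw [ih p (by omega) hn.of_append_left, ihi q (by omega) hn.of_append_right, ← hlen]
        push_cast
        field_simp
        ring
    intro l hM hn
    match l, hM, hn with
    | [], _, _ => rw [Op_nil, V_nil]; ring
    | [a], _, _ => rw [Op_single k hk]; simp
    | a :: b :: l, hM, hn =>
      have hd0 := dl_ne_zero hx hn (by simp)
      apply mul_left_cancel₀ hd0
      rw [Op_dl k hk hx hn, Op_congr k x _ (pw (V k x) (k+1)) _
        (fun p hp => V_spec k hk hx (hn.sublist hp))]
      rw [mul_left_comm, V_spec k hk hx hn]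
      have : Op (cc k x) (pw (V k x) (k+1)) (a :: b :: l) =
          ((((a :: b :: l).length : ℚ) - (k+1)) / k) * pw (V k x) (k+1) (a :: b :: l) := by
        rw [Op_pw_succ, ← sp_add, pw_succ, ← sp_mul_left]
        apply sp_congr; intro p q hpq
        have hlen := congrArg List.length hpq
        simp only [List.length_append] at hlen
        by_cases hp : p = []
        · subst hp; rw [Op_nil, V_nil]; ring
        by_cases hq : q = []
        · subst hq; rw [Op_nil, pw_eq_zero _ (V_nil k x) k [] (by simp; omega)]; ring
        have h1 := List.length_pos_iff.2 hp
        have h2 := List.length_pos_iff.2 hq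
        rw [← hpq] at hn
        rw [ih p (by omega) hn.of_append_left, hpow k q (by omega) hn.of_append_right, ← hlen]
        push_cast
        field_simp
        ring
      rw [this]
      field_simp
      ring

/-- chain removal weights -/
def R0 (k : ℕ) (x : α → ℚ) (s : ℚ) (A : List α) : List α → ℚ
  | [] => 0
  | a :: q => V k x (A ++ a :: q) / (x a - s)

def R (k : ℕ) (x : α → ℚ) (s : ℚ) (A : List α) : ℕ → List α → ℚ
  | 0, l => R0 k x s A l
  | i+1, l => sp (fun p q => V k x p * R k x s A i q) l

theorem R_nil (k : ℕ) (x : α → ℚ) (s : ℚ) (A : List α) (i : ℕ) : R k x s A i [] = 0 := by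
  induction i with
  | zero => simp [R, R0]
  | succ i ih => simp [R, sp_nil, ih]

theorem R_eq (k : ℕ) (x : α → ℚ) (s : ℚ) (A : List α) (i : ℕ) : ∀ l,
    R k x s A i l = sp (fun m q => pw (V k x) i m * R0 k x s A q) l := by
  induction i with
  | zero => intro l; rw [sp_pw_zero_left _ _ (fun _ q => R0 k x s A q)]; rfl
  | succ i ih =>
    intro l
    simp only [R]
    rw [sp_congr l _ (fun p r => sp (fun b q => V k x p * pw (V k x) i b * R0 k x s A q) r)
      (fun p q _ => by rw [ih, ← sp_mul_left]; simp only [mul_assoc])]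
    rw [← sp_assoc l (fun p b q => V k x p * pw (V k x) i b * R0 k x s A q)]
    apply sp_congr
    intro p q _
    rw [sp_mul_right, pw_succ]

theorem sum_R (k : ℕ) (hk : 1 ≤ k) {x : α → ℚ} (hx : Function.Injective x) (l : List α)
    (hl : l.Nodup) :
    sp (fun A q => R k x (hd x q) A k q) l = (((l.length : ℚ) - 1) / k) * V k x l := by
  rw [← Op_V k hk hx l.length l le_rfl hl]
  unfold Op
  apply sp_congr; intro A t _
  rw [R_eq]
  apply sp_congr; intro m q hm
  by_cases hm0 : m = []
  · subst hm0
    have := pw_eq_zero _ (V_nil k x) k [] (by simp; omega)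
    cases q <;> simp [cc, this]
  · rw [← hm, hd_append _ hm0]
    cases q with
    | nil => simp [R0, cc]
    | cons a q => simp only [R0, cc]; ring

/-- sums over elements of a list as sums over splittings -/
theorem sum_eq_sp (g : α → ℚ) (C : List α) : ∀ (F : List α → List α → ℚ)
    (_ : ∀ p, F p [] = 0) (_ : ∀ B v C', C = B ++ v :: C' → g v = F B (v :: C')),
    (C.map g).sum = sp F C := by
  induction C with
  | nil => intro F h0 _; simp [sp_nil, h0]
  | cons a C ih =>
    intro F h0 h
    rw [List.map_cons, List.sum_cons, sp_cons, h [] a C rfl,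
      ih (fun p q => F (a :: p) q) (fun p => h0 _) (fun B v C' e => h (a :: B) v C' (by simp [e]))]

end vee
end KF

namespace KF
section ap

def sq (k : ℕ) (m : ℕ) : ℚ :=
  if m = 0 then 0 else if m = 1 then 1 else
    if h : k < m ∧ 1 ≤ k then ((m : ℚ) - k) / ((m : ℚ) - 1) * sq k (m - k) else 0
termination_by m
decreasing_by omega

theorem sq_zero (k : ℕ) : sq k 0 = 0 := by rw [sq]; simp
theorem sq_one (k : ℕ) : sq k 1 = 1 := by rw [sq]; simp

theorem sq_rec (k : ℕ) (hk : 1 ≤ k) (m : ℕ) :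
    ((m : ℚ) + k - 1) * sq k (m + k) = m * sq k m := by
  rcases Nat.eq_zero_or_pos m with rfl | hm
  · by_cases h1 : k = 1
    · subst h1; simp
    · rw [sq, if_neg (by omega), if_neg (by omega), dif_neg (by omega)]; simp
  · rw [sq, if_neg (by omega), if_neg (by omega), dif_pos ⟨by omega, hk⟩]
    have h1 : (1:ℚ) ≤ m := by exact_mod_cast hm
    have h2 : (1:ℚ) ≤ k := by exact_mod_cast hk
    have : (m : ℚ) + k - 1 ≠ 0 := by intro h; linarith
    rw [Nat.add_sub_cancel]
    push_cast
    field_simp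
    ring

theorem sq_small (k : ℕ) (m : ℕ) (h : m < k) : ((m : ℚ) - 1) * sq k m = 0 := by
  rw [sq]
  split_ifs with h0 h1 h2
  · simp
  · subst h1; simp
  · omega
  · simp

open PowerSeries in
theorem sq_ode (k : ℕ) (hk : 1 ≤ k) (m : ℕ) :
    ((m : ℚ) - 1) * sq k m = coeff m ((PowerSeries.mk (sq k)) ^ (k+1)) := by
  set S : PowerSeries ℚ := PowerSeries.mk (sq k) with hS
  -- the linear equation
  have h1 : (1 - X ^ k) * (X * derivative ℚ S) = S := by
    ext m
    rw [sub_mul, one_mul, map_sub, coeff_X_pow_mul']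
    have hθ : ∀ j, coeff j (X * derivative ℚ S) = j * sq k j := by
      intro j
      cases j with
      | zero => simp
      | succ j => rw [coeff_succ_X_mul, coeff_derivative, hS, coeff_mk]; push_cast; ring
    rw [hθ]
    split_ifs with h
    · rw [hθ]
      have := sq_rec k hk (m - k)
      rw [Nat.sub_add_cancel h] at this
      rw [← this, hS, coeff_mk, Nat.cast_sub h]; ring
    · have := sq_small k m (by omega)
      rw [hS, coeff_mk]; linarith
  have h2 : (1 - X ^ k) * S ^ k = X ^ k := by
    set y : PowerSeries ℚ := (1 - X ^ k) * S ^ k with hy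
    obtain ⟨j, rfl⟩ : ∃ j, k = j + 1 := ⟨k-1, by omega⟩
    have hθy : X * derivative ℚ y = ((j+1 : ℕ) : PowerSeries ℚ) * y := by
      have e : derivative ℚ y = (1 - X ^ (j+1)) * (((j+1 : ℕ) : PowerSeries ℚ) * S ^ j * derivative ℚ S)
          - ((j+1 : ℕ) : PowerSeries ℚ) * X ^ j * S ^ (j+1) := by
        rw [hy, Derivation.leibniz, map_sub, Derivation.leibniz_pow, Derivation.leibniz_pow]
        simp only [derivative_X, smul_eq_mul, nsmul_eq_mul, Derivation.map_one_eq_zero]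
        simp only [Nat.add_sub_cancel]
        ring
      rw [e, hy]
      linear_combination ((j+1 : ℕ) : PowerSeries ℚ) * S ^ j * h1
    have hc : coeff (j+1) y = 1 := by
      have hST : S = X * PowerSeries.mk (fun i => sq (j+1) (i+1)) := by
        ext i
        cases i with
        | zero => simp [hS, sq_zero]
        | succ i => rw [coeff_succ_X_mul, hS, coeff_mk, coeff_mk]
      rw [hy, sub_mul, one_mul, map_sub, hST, mul_pow, coeff_X_pow_mul', coeff_X_pow_mul']
      simp [sq_one]
    ext m
    rw [coeff_X_pow]
    split_ifs with h
    · rw [h]; exact hc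
    · have := congrArg (coeff m) hθy
      rw [← map_natCast (C (R := ℚ)), coeff_C_mul] at this
      have hm : coeff m (X * derivative ℚ y) = m * coeff m y := by
        cases m with
        | zero => simp
        | succ j => rw [coeff_succ_X_mul, coeff_derivative]; push_cast; ring
      rw [hm] at this
      have h3 : ((m : ℚ) - ((j+1 : ℕ) : ℚ)) ≠ 0 := by
        rw [sub_ne_zero]; exact_mod_cast h
      have : ((m : ℚ) - ((j+1 : ℕ) : ℚ)) * coeff m y = 0 := by linarith
      exact (mul_eq_zero.1 this).resolve_left h3
  have h3 : (1 - X ^ k : PowerSeries ℚ) ≠ 0 := by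
    intro h
    have := congrArg (coeff 0) h
    rw [map_sub, coeff_X_pow, if_neg (by omega)] at this
    simp at this
  have h4 : X * derivative ℚ S - S = S ^ (k+1) := by
    apply mul_left_cancel₀ h3
    linear_combination h1 - S * h2
  rw [← h4, map_sub]
  cases m with
  | zero => simp [hS, sq_zero]
  | succ j => rw [coeff_succ_X_mul, coeff_derivative, hS, coeff_mk]; push_cast; ring

theorem sq_value (k : ℕ) (hk : 1 ≤ k) (n : ℕ) :
    (n.factorial : ℚ) * sq k (k * n + 1) = (∏ i ∈ Finset.range n, ((i * k + 1 : ℕ) : ℚ)) / (k:ℚ) ^ n := by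
  have hk0 : (k : ℚ) ≠ 0 := by positivity
  induction n with
  | zero => simp [sq_one]
  | succ n ih =>
    rw [Finset.prod_range_succ, pow_succ, mul_div_mul_comm, ← ih]
    have := sq_rec k hk (k * n + 1)
    rw [show k * (n+1) + 1 = k * n + 1 + k by ring, Nat.factorial_succ]
    push_cast at this ⊢
    have e : ((k:ℚ) * n + 1 + k - 1) = k * (n + 1) := by ring
    rw [e] at this
    field_simp
    linear_combination this

variable {α : Type*}

theorem sp_length (s t : ℕ → ℚ) (l : List α) :
    sp (fun p q => s p.length * t q.length) l =
      ∑ ij ∈ Finset.HasAntidiagonal.antidiagonal l.length, s ij.1 * t ij.2 := by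
  induction l generalizing s with
  | nil => simp [sp_nil]
  | cons a l ih =>
    rw [sp_cons, List.length_cons, Finset.Nat.sum_antidiagonal_succ, ← ih (fun i => s (i+1))]
    simp

theorem pw_length (s : ℕ → ℚ) (i : ℕ) : ∀ (l : List α),
    pw (fun l => s l.length) i l = PowerSeries.coeff l.length ((PowerSeries.mk s) ^ i) := by
  induction i with
  | zero => intro l; cases l <;> simp [pw, PowerSeries.coeff_one]
  | succ i ih =>
    intro l
    rw [pw_succ, pow_succ', PowerSeries.coeff_mul]
    simp only [ih, PowerSeries.coeff_mk]
    exact sp_length s (fun j => PowerSeries.coeff j ((PowerSeries.mk s) ^ i)) l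

/-- congruence on infixes -/
theorem pw_congr_infix (f g : List α → ℚ) (hf : f [] = 0) (hg : g [] = 0) (i : ℕ) : ∀ (l : List α),
    (∀ p, p <:+: l → f p = g p) → pw f i l = pw g i l := by
  induction i with
  | zero => intro l _; cases l <;> simp [pw]
  | succ i ih =>
    intro l h
    rw [pw_succ, pw_succ]
    apply sp_congr
    intro p q hpq
    rw [h p ⟨[], q, by simpa using hpq⟩, ih q (fun p' hp' => h p' (hp'.trans ⟨p, [], by simpa using hpq⟩))]

theorem pw_congr_infix_lt (f g : List α → ℚ) (hf : f [] = 0) (hg : g [] = 0) (i : ℕ) (l : List α)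
    (h : ∀ p, p <:+: l → p.length < l.length → f p = g p) : pw f (i+2) l = pw g (i+2) l := by
  rw [pw_succ, pw_succ]
  apply sp_congr
  intro p q hpq
  have hlen := congrArg List.length hpq
  simp at hlen
  by_cases hp : p = []
  · subst hp; rw [hf, hg]; ring
  by_cases hq : q = []
  · subst hq; rw [pw_eq_zero f hf _ _ (by simp), pw_eq_zero g hg _ _ (by simp)]; ring
  have h1 := List.length_pos_iff.2 hp
  have h2 := List.length_pos_iff.2 hq
  rw [h p ⟨[], q, by simpa using hpq⟩ (by omega), pw_congr_infix f g hf hg _ q (fun p' hp' =>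
    h p' (hp'.trans ⟨p, [], by simpa using hpq⟩) (by have := hp'.length_le; omega))]

theorem la_ap (x : α → ℚ) (l : List α) (h : l.IsChain (fun a b => x b = x a + 1)) (hl : l ≠ []) :
    la x l = hd x l + l.length - 1 := by
  induction l with
  | nil => exact absurd rfl hl
  | cons a l ih =>
    cases l with
    | nil => simp [la, hd]
    | cons b l =>
      rw [la_cons _ _ (by simp), ih h.tail (by simp)]
      have : x b = x a + 1 := (List.isChain_cons_cons.1 h).1
      simp only [hd, this, List.length_cons]; push_cast; ring

theorem V_ap (k : ℕ) (hk : 1 ≤ k) {x : α → ℚ} (hx : Function.Injective x) (M : ℕ) :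
    ∀ l : List α, l.length ≤ M → l.Nodup → l.IsChain (fun a b => x b = x a + 1) →
      V k x l = sq k l.length := by
  induction M with
  | zero =>
    intro l h _ _
    have : l = [] := List.length_eq_zero_iff.1 (by omega)
    subst this
    simp [V_nil, sq_zero]
  | succ M ih =>
    intro l hM hn hc
    match l, hM, hn, hc with
    | [], _, _, _ => simp [V_nil, sq_zero]
    | [a], _, _, _ => simp [V_single, sq_one]
    | a :: b :: l, hM, hn, hc =>
      have hd0 := dl_ne_zero hx hn (by simp)
      apply mul_left_cancel₀ hd0
      rw [V_spec k hk hx hn]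
      have e : dl x (a :: b :: l) = (((a :: b :: l).length : ℕ) : ℚ) - 1 := by
        unfold dl; rw [la_ap x _ hc (by simp)]; ring
      rw [e, sq_ode k hk, ← pw_length]
      obtain ⟨j, rfl⟩ : ∃ j, k = j + 1 := ⟨k-1, by omega⟩
      apply pw_congr_infix_lt _ _ (V_nil _ _) (by simp [sq_zero])
      intro p hp hlt
      exact ih p (by omega) (hn.sublist hp.sublist) (hc.infix hp)

end ap
end KF

namespace KF
section perm
open Equiv
variable {α : Type} [Fintype α] [LinearOrder α]

structure St (Ls : List (List α)) (π : Perm α) : Prop where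
  nd : Ls.flatten.Nodup
  cov : ∀ a, a ∈ Ls.flatten
  ne : ∀ l ∈ Ls, l ≠ []
  so : ∀ l ∈ Ls, l.Pairwise (· < ·)
  act : ∀ l ∈ Ls, ∀ z ∈ l, π z = l.formPerm z

theorem St.perm {Ls Ls' : List (List α)} {π : Perm α} (h : St Ls π) (hp : Ls.Perm Ls') :
    St Ls' π where
  nd := (hp.flatten.nodup_iff).1 h.nd
  cov a := hp.flatten.mem_iff.1 (h.cov a)
  ne l hl := h.ne l (hp.mem_iff.2 hl)
  so l hl := h.so l (hp.mem_iff.2 hl)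
  act l hl := h.act l (hp.mem_iff.2 hl)

theorem St.nodup {Ls : List (List α)} {π : Perm α} (h : St Ls π) {l : List α} (hl : l ∈ Ls) :
    l.Nodup := (List.nodup_flatten.1 h.nd).1 l hl

theorem St.card {Ls : List (List α)} {π : Perm α} (h : St Ls π) :
    (Ls.map List.length).sum = Fintype.card α := by
  rw [← List.length_flatten, ← List.toFinset_card_of_nodup h.nd, ← Finset.card_univ]
  congr 1
  ext a
  simpa using h.cov a

theorem swap_formPerm (u v : α) (C : List α) : ∀ (B : List α), (u :: B ++ v :: C).Nodup →
    swap u v * (u :: B ++ v :: C).formPerm = (u :: B).formPerm * (v :: C).formPerm := by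
  intro B
  induction B generalizing u with
  | nil =>
    intro _
    simp [List.formPerm_cons_cons, ← mul_assoc]
  | cons b B ih =>
    intro h
    have h' : (b :: B ++ v :: C).Nodup := by
      simp only [List.cons_append, List.nodup_cons] at h ⊢; exact h.2
    have hub : u ≠ b := by rintro rfl; simp at h
    have huv : u ≠ v := by rintro rfl; simp at h
    have hbv : b ≠ v := by rintro rfl; simp at h
    have e := ih b h'
    have e2 : (b :: B ++ v :: C).formPerm = swap b v * ((b :: B).formPerm * (v :: C).formPerm) := by
      rw [← e, ← mul_assoc, swap_mul_self, one_mul]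
    rw [List.cons_append, List.cons_append, List.formPerm_cons_cons, ← List.cons_append, e2,
      List.formPerm_cons_cons]
    simp only [← mul_assoc]
    congr 2
    ext z
    simp only [Perm.mul_apply, swap_apply_def]
    grind

theorem St.split {A B C : List α} {u v : α} {Ls : List (List α)} {π : Perm α}
    (h : St ((A ++ u :: (B ++ v :: C)) :: Ls) π) :
    St ((A ++ v :: C) :: (u :: B) :: Ls) (swap u v * π) := by
  have hnd := h.nodup (List.mem_cons_self)
  have hpm : (A ++ u :: (B ++ v :: C)).Perm ((A ++ v :: C) ++ (u :: B)) := by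
    rw [List.append_assoc]
    apply List.Perm.append_left
    rw [← List.cons_append]
    exact List.perm_append_comm
  have hfl : (List.flatten ((A ++ u :: (B ++ v :: C)) :: Ls)).Perm
      (List.flatten ((A ++ v :: C) :: (u :: B) :: Ls)) := by
    simp only [List.flatten_cons]
    rw [← List.append_assoc (A ++ v :: C)]
    exact hpm.append_right _
  have hnd2 := hpm.nodup_iff.1 hnd
  have hdis : List.Disjoint (A ++ v :: C) (u :: B) := (List.nodup_append'.1 hnd2).2.2
  -- permutation identity
  have hrot : (A ++ u :: (B ++ v :: C)).formPerm = (u :: B ++ v :: (C ++ A)).formPerm := by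
    apply List.formPerm_eq_of_isRotated hnd
    have := List.isRotated_append (l := A) (l' := u :: (B ++ v :: C))
    simpa using this
  have hrot2 : (A ++ v :: C).formPerm = (v :: (C ++ A)).formPerm := by
    apply List.formPerm_eq_of_isRotated (List.nodup_append'.1 hnd2).1
    have := List.isRotated_append (l := A) (l' := v :: C)
    simpa using this
  have hnd3 : (u :: B ++ v :: (C ++ A)).Nodup := by
    have : (A ++ u :: (B ++ v :: C)).Perm (u :: B ++ v :: (C ++ A)) := by
      have := List.perm_append_comm (l₁ := A) (l₂ := u :: (B ++ v :: C))
      simpa using this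
    exact this.nodup_iff.1 hnd
  have key : swap u v * (A ++ u :: (B ++ v :: C)).formPerm =
      (u :: B).formPerm * (A ++ v :: C).formPerm := by
    rw [hrot, hrot2, swap_formPerm u v _ B hnd3]
  have hact := h.act _ List.mem_cons_self
  refine ⟨hfl.nodup_iff.1 h.nd, fun a => hfl.mem_iff.1 (h.cov a), ?_, ?_, ?_⟩
  · intro l hl
    simp only [List.mem_cons] at hl
    rcases hl with rfl | rfl | hl
    · simp
    · simp
    · exact h.ne l (by simp [hl])
  · intro l hl
    have hs := h.so _ List.mem_cons_self
    simp only [List.mem_cons] at hl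
    rcases hl with rfl | rfl | hl
    · refine List.Pairwise.sublist ?_ hs
      apply List.Sublist.append (List.Sublist.refl _)
      apply List.Sublist.cons
      exact List.sublist_append_right _ _
    · refine List.Pairwise.sublist ?_ hs
      rw [← List.cons_append]
      exact (List.sublist_append_left _ _).trans (List.sublist_append_right _ _)
    · exact h.so l (by simp [hl])
  · intro l hl z hz
    simp only [List.mem_cons] at hl
    rcases hl with rfl | rfl | hl
    · rw [Perm.mul_apply, hact z (hpm.mem_iff.2 (List.mem_append_left _ hz)), ← Perm.mul_apply, key,
        Perm.mul_apply, List.formPerm_apply_of_notMem]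
      exact hdis (List.formPerm_apply_mem_of_mem hz)
    · rw [Perm.mul_apply, hact z (hpm.mem_iff.2 (List.mem_append_right _ hz)), ← Perm.mul_apply, key,
        Perm.mul_apply, List.formPerm_apply_of_notMem (l := A ++ v :: C)]
      exact fun hz' => hdis hz' hz
    · rw [Perm.mul_apply, h.act l (by simp [hl]) z hz]
      have hm := List.formPerm_apply_mem_of_mem hz
      have hd : List.Disjoint (A ++ u :: (B ++ v :: C)) l := by
        have := (List.nodup_flatten.1 h.nd).2
        exact (List.pairwise_cons.1 this).1 l hl
      apply swap_apply_of_ne_of_ne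
      · intro e; rw [e] at hm; exact hd (by simp) hm
      · intro e; rw [e] at hm; exact hd (by simp) hm

/-- products of `M` swaps -/
inductive Wd : ℕ → Perm α → Prop
  | one : Wd 0 1
  | step (M : ℕ) (π : Perm α) (u v : α) : Wd M π → Wd (M+1) (swap u v * π)

theorem Wd.inv {M : ℕ} {π : Perm α} {u v : α} (h : Wd M (swap u v * π)) : Wd (M+1) π := by
  have := Wd.step M _ u v h
  rwa [← mul_assoc, swap_mul_self, one_mul] at this

theorem finrank_cut (K : Submodule ℚ (α → ℚ)) (u v : α) :
    ∃ K' : Submodule ℚ (α → ℚ), K' ≤ K ∧ (∀ g ∈ K', g u = g v) ∧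
      Module.finrank ℚ K ≤ Module.finrank ℚ K' + 1 := by
  let f : K →ₗ[ℚ] ℚ := (LinearMap.proj (R := ℚ) (φ := fun _ : α => ℚ) u - LinearMap.proj (R := ℚ) (φ := fun _ : α => ℚ) v).comp K.subtype
  refine ⟨(LinearMap.ker f).map K.subtype, Submodule.map_subtype_le _ _, ?_, ?_⟩
  · rintro g ⟨g', hg', rfl⟩
    have : f g' = 0 := hg'
    simp only [f, LinearMap.comp_apply, LinearMap.sub_apply, LinearMap.proj_apply] at this
    exact sub_eq_zero.1 this
  · rw [Submodule.finrank_map_subtype_eq]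
    have h1 := LinearMap.finrank_range_add_finrank_ker f
    have h2 := Submodule.finrank_le (LinearMap.range f)
    rw [Module.finrank_self] at h2
    omega

theorem Wd.space {M : ℕ} {π : Perm α} (h : Wd M π) : ∃ K : Submodule ℚ (α → ℚ),
    Fintype.card α ≤ Module.finrank ℚ K + M ∧ ∀ g ∈ K, ∀ a, g (π a) = g a := by
  induction h with
  | one => exact ⟨⊤, by simp, by simp⟩
  | step M π u v _ ih =>
    obtain ⟨K, hK, hinv⟩ := ih
    obtain ⟨K', hle, huv, hf⟩ := finrank_cut K u v
    refine ⟨K', by omega, fun g hg a => ?_⟩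
    rw [Perm.mul_apply, ← hinv g (hle hg) a, swap_apply_def]
    split_ifs with h1 h2
    · rw [h1, huv g hg]
    · rw [h2, huv g hg]
    · rfl

theorem const_block {l : List α} (hl : l.Nodup) (hne : l ≠ []) (g : α → ℚ)
    (h : ∀ z ∈ l, g (l.formPerm z) = g z) : ∀ z ∈ l, g z = g (l.head hne) := by
  have : ∀ i (hi : i < l.length), g l[i] = g (l.head hne) := by
    intro i
    induction i with
    | zero => intro hi; rw [List.head_eq_getElem]
    | succ i ih =>
      intro hi
      rw [← List.formPerm_apply_lt_getElem l hl i hi, h _ (List.getElem_mem _), ih]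
  intro z hz
  obtain ⟨i, hi, rfl⟩ := List.getElem_of_mem hz
  exact this i hi

theorem same_block {Ls : List (List α)} {π : Perm α} (h : St Ls π) {M : ℕ} {u v : α}
    (hw : Wd M (swap u v * π)) (hM : Ls.length + M + 1 = Fintype.card α) {l : List α}
    (hl : l ∈ Ls) (hu : u ∈ l) : v ∈ l := by
  obtain ⟨K₀, hK₀, hinv₀⟩ := hw.space
  obtain ⟨K, hle, huv, hf⟩ := finrank_cut K₀ u v
  have hinv : ∀ g ∈ K, ∀ a, g (π a) = g a := by
    intro g hg a
    rw [← hinv₀ g (hle hg) a, Perm.mul_apply, swap_apply_def]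
    split_ifs with h1 h2
    · rw [h1, huv g hg]
    · rw [h2, huv g hg]
    · rfl
  have hconst : ∀ g ∈ K, ∀ i : Fin Ls.length, ∀ z ∈ Ls[i],
      g z = g (Ls[i].head (h.ne _ (List.getElem_mem _))) := by
    intro g hg i
    apply const_block (h.nodup (List.getElem_mem _))
    intro z hz
    rw [← h.act _ (List.getElem_mem _) z hz, hinv g hg]
  let φ : K →ₗ[ℚ] (Fin Ls.length → ℚ) :=
    { toFun := fun g i => g.1 (Ls[i].head (h.ne _ (List.getElem_mem _)))
      map_add' := fun _ _ => rfl
      map_smul' := fun _ _ => rfl }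
  have hφ : Function.Injective φ := by
    rw [← LinearMap.ker_eq_bot, LinearMap.ker_eq_bot']
    intro g hg
    ext a
    obtain ⟨l, hl, ha⟩ := List.mem_flatten.1 (h.cov a)
    obtain ⟨i, hi, rfl⟩ := List.getElem_of_mem hl
    have := hconst g.1 g.2 ⟨i, hi⟩ a ha
    rw [this]
    exact congrFun hg ⟨i, hi⟩
  have hfin : Module.finrank ℚ K = Module.finrank ℚ (Fin Ls.length → ℚ) := by
    have := LinearMap.finrank_le_finrank_of_injective hφ
    rw [Module.finrank_fin_fun] at this ⊢
    omega
  have hsurj : Function.Surjective φ :=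
    (LinearMap.injective_iff_surjective_of_finrank_eq_finrank hfin).1 hφ
  obtain ⟨i, hi, rfl⟩ := List.getElem_of_mem hl
  obtain ⟨g, hg⟩ := hsurj (Pi.single ⟨i, hi⟩ 1)
  obtain ⟨l', hl', hv⟩ := List.mem_flatten.1 (h.cov v)
  obtain ⟨j, hj, rfl⟩ := List.getElem_of_mem hl'
  have e1 : g.1 u = 1 := by
    rw [hconst g.1 g.2 ⟨i, hi⟩ u hu]
    have := congrFun hg ⟨i, hi⟩
    rw [Pi.single_eq_same] at this
    exact this
  have e2 : g.1 v = (Pi.single (M := fun _ => ℚ) (⟨i, hi⟩ : Fin Ls.length) 1 : Fin Ls.length → ℚ) ⟨j, hj⟩ := by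
    rw [hconst g.1 g.2 ⟨j, hj⟩ v hv]
    exact congrFun hg ⟨j, hj⟩
  rw [← huv g.1 g.2, e1] at e2
  by_cases hij : i = j
  · subst hij; exact hv
  · rw [Pi.single_eq_of_ne (by simpa [Fin.ext_iff] using fun e : j = i => hij e.symm)] at e2
    norm_num at e2

end perm
end KF

namespace KF
section fact
open Equiv
variable {α : Type} [Fintype α] [LinearOrder α]

open Classical in
noncomputable def AA (k : ℕ) (x : α → ℚ) : ℕ → Perm α → ℚ
  | 0, π => if π = 1 then 1 else 0
  | n+1, π => ∑ c : Fin (k+1) → α, if (Function.Injective c ∧ ∀ i, c 0 ≤ c i) then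
      1 / (x (c (Fin.last k)) - x (c 0)) * AA k x n ((List.ofFn c).formPerm⁻¹ * π) else 0

noncomputable def BB (G : Perm α → ℚ) (x : α → ℚ) (s : ℚ) : ℕ → Finset α → α → Perm α → ℚ
  | 0, _, u, π => 1 / (x u - s) * G π
  | i+1, av, u, π => ∑ v ∈ avᶜ, BB G x s i (insert v av) v (swap u v * π)

open Classical in
theorem BB_sum (G : Perm α → ℚ) (x : α → ℚ) (s : ℚ) (i : ℕ) : ∀ (av : Finset α) (u : α) (π : Perm α),
    (∑ c : Fin i → α, if (Function.Injective c ∧ ∀ j, c j ∉ av) then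
      1 / (x ((Fin.cons u c : Fin (i+1) → α) (Fin.last i)) - s) *
        G ((List.ofFn (Fin.cons u c : Fin (i+1) → α)).formPerm⁻¹ * π) else 0) = BB G x s i av u π := by
  induction i with
  | zero =>
    intro av u π
    rw [Fintype.sum_unique, if_pos ⟨fun a => a.elim0, fun a => a.elim0⟩]
    simp [BB, List.ofFn_succ]
  | succ i ih =>
    intro av u π
    rw [← (Fin.consEquiv (fun _ : Fin (i+1) => α)).sum_comp, Fintype.sum_prod_type, BB]
    rw [← Finset.sum_subset (Finset.subset_univ avᶜ)]
    · apply Finset.sum_congr rfl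
      intro v hv
      rw [Finset.mem_compl] at hv
      rw [← ih (insert v av) v (swap u v * π)]
      apply Finset.sum_congr rfl
      intro c _
      have e : (Fin.consEquiv (fun _ : Fin (i+1) => α)) (v, c) = (Fin.cons v c : Fin (i+1) → α) := rfl
      rw [e]
      have e1 : (Function.Injective (Fin.cons v c : Fin (i+1) → α) ∧
          ∀ j, (Fin.cons v c : Fin (i+1) → α) j ∉ av) ↔
          (Function.Injective c ∧ ∀ j, c j ∉ insert v av) := by
        rw [Fin.cons_injective_iff, Fin.forall_fin_succ]
        simp only [Fin.cons_zero, Fin.cons_succ, Finset.mem_insert, Set.mem_range]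
        constructor
        · rintro ⟨⟨h1, h2⟩, _, h3⟩
          exact ⟨h2, fun j hj => hj.elim (fun e => h1 ⟨j, e⟩) (h3 j)⟩
        · rintro ⟨h2, h3⟩
          exact ⟨⟨fun ⟨j, e⟩ => h3 j (Or.inl e), h2⟩, hv, fun j hj => h3 j (Or.inr hj)⟩
      simp only [e1]
      congr 2
      congr 1
      · rw [List.ofFn_cons, List.ofFn_cons, List.formPerm_cons_cons, mul_inv_rev, swap_inv, mul_assoc]
    · intro v _ hv
      rw [Finset.mem_compl, not_not] at hv
      apply Finset.sum_eq_zero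
      intro c _
      rw [if_neg]
      rintro ⟨_, h⟩
      exact h 0 hv

theorem AA_succ (k : ℕ) (x : α → ℚ) (n : ℕ) (π : Perm α) :
    AA k x (n+1) π = ∑ s : α, BB (AA k x n) x (x s) k (Finset.univ.filter (· ≤ s)) s π := by
  classical
  rw [AA, ← (Fin.consEquiv (fun _ : Fin (k+1) => α)).sum_comp, Fintype.sum_prod_type]
  apply Finset.sum_congr rfl
  intro s _
  rw [← BB_sum]
  apply Finset.sum_congr rfl
  intro c _
  have e : (Fin.consEquiv (fun _ : Fin (k+1) => α)) (s, c) = (Fin.cons s c : Fin (k+1) → α) := rfl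
  rw [e]
  have e1 : (Function.Injective (Fin.cons s c : Fin (k+1) → α) ∧
      ∀ j, (Fin.cons s c : Fin (k+1) → α) 0 ≤ (Fin.cons s c : Fin (k+1) → α) j) ↔
      (Function.Injective c ∧ ∀ j, c j ∉ Finset.univ.filter (· ≤ s)) := by
    rw [Fin.cons_injective_iff, Fin.forall_fin_succ]
    simp only [Fin.cons_zero, Fin.cons_succ, Finset.mem_filter, Set.mem_range, Finset.mem_univ, true_and, not_le]
    constructor
    · rintro ⟨⟨h1, h2⟩, _, h3⟩
      exact ⟨h2, fun j => lt_of_le_of_ne (h3 j) (fun e => h1 ⟨j, e.symm⟩)⟩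
    · rintro ⟨h2, h3⟩
      exact ⟨⟨fun ⟨j, e⟩ => (h3 j).ne e.symm, h2⟩, le_rfl, fun j => (h3 j).le⟩
  simp only [e1]
  rfl

theorem BB_ne_zero (G : Perm α → ℚ) (x : α → ℚ) (s : ℚ) (M : ℕ) (hG : ∀ π, G π ≠ 0 → Wd M π) (i : ℕ) :
    ∀ (av : Finset α) (u : α) (π : Perm α), BB G x s i av u π ≠ 0 → Wd (M+i) π := by
  induction i with
  | zero => intro av u π h; exact hG π (right_ne_zero_of_mul h)
  | succ i ih =>
    intro av u π h
    obtain ⟨v, _, hv⟩ := Finset.exists_ne_zero_of_sum_ne_zero h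
    exact (ih _ _ _ hv).inv

theorem AA_ne_zero (k : ℕ) (x : α → ℚ) (n : ℕ) : ∀ (π : Perm α), AA k x n π ≠ 0 → Wd (n*k) π := by
  induction n with
  | zero =>
    intro π h
    rw [AA] at h
    have : π = 1 := by by_contra hh; exact h (if_neg hh)
    rw [this, Nat.zero_mul]; exact Wd.one
  | succ n ih =>
    intro π h
    rw [AA_succ] at h
    obtain ⟨v, _, hv⟩ := Finset.exists_ne_zero_of_sum_ne_zero h
    rw [Nat.succ_mul]
    exact BB_ne_zero _ _ _ _ ih _ _ _ _ hv

theorem BB_eval (k : ℕ) (G : Perm α → ℚ) (x : α → ℚ) (s : ℚ) (M : ℕ) (g : ℚ)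
    (hG : ∀ π, G π ≠ 0 → Wd M π)
    (hg : ∀ (Ls : List (List α)) π, St Ls π → Ls.length + M = Fintype.card α →
      G π = g * (Ls.map (V k x)).prod) (i : ℕ) :
    ∀ (A C : List α) (Ls : List (List α)) (av : Finset α) (u : α) (π : Perm α),
      St ((A ++ u :: C) :: Ls) π → Ls.length + 1 + M + i = Fintype.card α →
      (∀ a ∈ A, a ∈ av) → u ∈ av → (∀ a ∈ C, a ∉ av) →
      BB G x s i av u π = g * (Ls.map (V k x)).prod * R k x s A i (u :: C) := by
  induction i with
  | zero =>
    intro A C Ls av u π h hM hA hu hC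
    rw [BB, hg _ π h (by simpa using hM), R, R0]
    simp only [List.map_cons, List.prod_cons]
    ring
  | succ i ih =>
    intro A C Ls av u π h hM hA hu hC
    have hnd := h.nodup List.mem_cons_self
    have hndC : C.Nodup := (List.nodup_cons.1 (List.nodup_append'.1 hnd).2.1).2
    rw [BB, ← Finset.sum_subset (s₁ := C.toFinset)]
    · rw [List.sum_toFinset _ hndC, R, sp_cons, V_nil, zero_mul, zero_add, ← sp_mul_left]
      apply sum_eq_sp
      · intro p; rw [R_nil]; ring
      · intro B v C' e
        subst e
        rw [ih A C' ((u :: B) :: Ls) (insert v av) v (swap u v * π) h.split (by simp; omega)]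
        · simp only [List.map_cons, List.prod_cons]; ring
        · intro a ha; exact Finset.mem_insert_of_mem (hA a ha)
        · exact Finset.mem_insert_self _ _
        · intro a ha hh
          rcases Finset.mem_insert.1 hh with rfl | hh
          · have := (List.nodup_append'.1 hndC).2.1
            exact (List.nodup_cons.1 this).1 ha
          · exact hC a (by simp [ha]) hh
    · intro a ha
      exact Finset.mem_compl.2 (hC a (List.mem_toFinset.1 ha))
    · intro v hv hvC
      by_contra hne
      have hw := BB_ne_zero G x s M hG _ _ _ _ hne
      have hb := same_block h hw (by simp; omega) List.mem_cons_self (by simp)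
      rw [List.mem_toFinset] at hvC
      rw [Finset.mem_compl] at hv
      simp only [List.mem_append, List.mem_cons] at hb
      rcases hb with hb | rfl | hb
      · exact hv (hA v hb)
      · exact hv hu
      · exact hvC hb

theorem AA_eval (k : ℕ) (hk : 1 ≤ k) {x : α → ℚ} (hx : Function.Injective x) (n : ℕ) :
    ∀ (Ls : List (List α)) (π : Perm α), St Ls π → Ls.length + n * k = Fintype.card α →
      AA k x n π = n.factorial * (Ls.map (V k x)).prod := by
  induction n with
  | zero =>
    intro Ls π h hM
    have hc := h.card
    have h1 : ∀ l ∈ Ls, ∃ a, l = [a] := by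
      have key : ∀ L : List (List α), (∀ l ∈ L, l ≠ []) →
          (L.length ≤ (L.map List.length).sum ∧
          ((L.map List.length).sum ≤ L.length → ∀ l ∈ L, ∃ a, l = [a])) := by
        intro L
        induction L with
        | nil => simp
        | cons m L ih =>
          intro hne
          have hm := List.length_pos_of_ne_nil (hne m List.mem_cons_self)
          obtain ⟨i1, i2⟩ := ih (fun l hl => hne l (List.mem_cons_of_mem _ hl))
          simp only [List.map_cons, List.sum_cons, List.length_cons, List.mem_cons]
          refine ⟨by omega, fun hle l hl => ?_⟩
          rcases hl with rfl | hl
          · exact List.length_eq_one_iff.1 (by omega)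
          · exact i2 (by omega) l hl
      exact (key Ls h.ne).2 (by omega)
    have hπ : π = 1 := by
      ext a
      obtain ⟨l, hl, ha⟩ := List.mem_flatten.1 (h.cov a)
      obtain ⟨b, rfl⟩ := h1 l hl
      rw [h.act _ hl a ha]; simp
    have hp : (Ls.map (V k x)).prod = 1 := by
      apply List.prod_eq_one
      intro y hy
      obtain ⟨l, hl, rfl⟩ := List.mem_map.1 hy
      obtain ⟨b, rfl⟩ := h1 l hl
      exact V_single _ _ _
    rw [hp, AA, if_pos hπ]; simp
  | succ n ih =>
    intro Ls π h hM
    rw [AA_succ]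
    set g : α → ℚ := fun s => BB (AA k x n) x (x s) k (Finset.univ.filter (· ≤ s)) s π with hg
    have e1 : ∑ s, g s = (Ls.flatten.map g).sum := by
      rw [← List.sum_toFinset g h.nd]
      apply Finset.sum_congr _ (fun _ _ => rfl)
      ext a; simpa using h.cov a
    have e2 : ∀ l ∈ Ls, (l.map g).sum =
        (n.factorial : ℚ) * (Ls.map (V k x)).prod * (((l.length : ℚ) - 1) / k) := by
      intro l hl
      have hp : Ls.Perm (l :: Ls.erase l) := List.perm_cons_erase hl
      have hlen := hp.length_eq
      simp only [List.length_cons] at hlen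
      have h' := h.perm hp
      have hso := h.so l hl
      rw [(hp.map (V k x)).prod_eq, List.map_cons, List.prod_cons]
      have e3 : (l.map g).sum = sp (fun A q => (n.factorial * ((Ls.erase l).map (V k x)).prod) *
          R k x (hd x q) A k q) l := by
        apply sum_eq_sp
        · intro p; rw [R_nil]; ring
        · intro A s C e
          rw [e] at hso
          have hp1 := List.pairwise_append.1 hso
          have hp2 := List.pairwise_cons.1 hp1.2.1
          exact BB_eval k (AA k x n) x (x s) (n*k) n.factorial (AA_ne_zero k x n) ih k A C
            (Ls.erase l) _ s π (e ▸ h') (by rw [Nat.succ_mul] at hM; omega)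
            (fun a ha => by simpa using (hp1.2.2 a ha s (by simp)).le) (by simp)
            (fun a ha => by simpa using hp2.1 a ha)
      rw [e3, sp_mul_left, sum_R k hk hx l (h.nodup hl)]
      ring
    have e4 : (Ls.flatten.map g).sum = ((n.factorial : ℚ) * (Ls.map (V k x)).prod) *
        (Ls.map (fun l => ((l.length : ℚ) - 1) / k)).sum := by
      rw [List.map_flatten, List.sum_flatten, List.map_map, ← List.sum_map_mul_left]
      congr 1
      apply List.map_congr_left
      intro l hl
      exact e2 l hl
    have e5 : (Ls.map (fun l => ((l.length : ℚ) - 1) / k)).sum = n + 1 := by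
      have : ∀ L : List (List α), (L.map (fun l => ((l.length : ℚ) - 1) / k)).sum =
          (((L.map List.length).sum : ℕ) - (L.length : ℚ)) / k := by
        intro L
        induction L with
        | nil => simp
        | cons m L ih => simp only [List.map_cons, List.sum_cons, List.length_cons, ih]; push_cast; ring
      rw [this, h.card, ← hM]
      have hk0 : (k : ℚ) ≠ 0 := by positivity
      push_cast
      field_simp
      ring
    rw [e1, e4, e5, Nat.factorial_succ]
    push_cast
    ring

open Classical in
theorem AA_sum (k : ℕ) (x : α → ℚ) (n : ℕ) : ∀ π : Perm α,
    (∑ a : Fin n → Fin (k+1) → α, if ((∀ j, Function.Injective (a j)) ∧ (∀ j i, a j 0 ≤ a j i)) ∧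
      (List.ofFn (fun j => (List.ofFn (a j)).formPerm)).reverse.prod = π then
      ∏ j, 1 / (x (a j (Fin.last k)) - x (a j 0)) else 0) = AA k x n π := by
  induction n with
  | zero =>
    intro π
    rw [Fintype.sum_unique, AA]
    simp [eq_comm]
  | succ n ih =>
    intro π
    rw [← (Fin.snocEquiv (fun _ : Fin (n+1) => Fin (k+1) → α)).sum_comp, Fintype.sum_prod_type, AA]
    apply Finset.sum_congr rfl
    intro c _
    split_ifs with hc
    · rw [← ih, Finset.mul_sum]
      apply Finset.sum_congr rfl
      intro a _
      have e : (Fin.snocEquiv (fun _ : Fin (n+1) => Fin (k+1) → α)) (c, a) =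
        (Fin.snoc a c : Fin (n+1) → Fin (k+1) → α) := rfl
      rw [e, mul_ite, mul_zero]
      have e1 : (((∀ j, Function.Injective ((Fin.snoc a c : Fin (n+1) → Fin (k+1) → α) j)) ∧
          (∀ j i, (Fin.snoc a c : Fin (n+1) → Fin (k+1) → α) j 0 ≤
            (Fin.snoc a c : Fin (n+1) → Fin (k+1) → α) j i)) ∧
          (List.ofFn (fun j => (List.ofFn ((Fin.snoc a c : Fin (n+1) → Fin (k+1) → α) j)).formPerm)).reverse.prod = π) ↔
          (((∀ j, Function.Injective (a j)) ∧ (∀ j i, a j 0 ≤ a j i)) ∧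
          (List.ofFn (fun j => (List.ofFn (a j)).formPerm)).reverse.prod =
            (List.ofFn c).formPerm⁻¹ * π) := by
        rw [List.ofFn_succ']
        simp only [Fin.forall_fin_succ', Fin.snoc_castSucc, Fin.snoc_last, List.concat_eq_append,
          List.reverse_append, List.reverse_singleton, List.singleton_append, List.prod_cons,
          eq_inv_mul_iff_mul_eq]
        tauto
      simp only [e1]
      congr 1
      rw [Fin.prod_univ_castSucc]
      simp only [Fin.snoc_castSucc, Fin.snoc_last]
      ring
    · apply Finset.sum_eq_zero
      intro a _
      have e : (Fin.snocEquiv (fun _ : Fin (n+1) => Fin (k+1) → α)) (c, a) =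
        (Fin.snoc a c : Fin (n+1) → Fin (k+1) → α) := rfl
      rw [e, if_neg]
      rintro ⟨⟨h1, h2⟩, _⟩
      apply hc
      have := h1 (Fin.last n)
      have h3 := h2 (Fin.last n)
      rw [Fin.snoc_last] at this h3
      exact ⟨this, h3⟩

theorem St_rot (N : ℕ) : St [List.finRange (N+1)] (finRotate (N+1)) where
  nd := by simpa using List.nodup_finRange _
  cov a := by simp
  ne := by simp
  so l hl := by
    rw [List.mem_singleton] at hl; subst hl
    exact List.pairwise_lt_finRange _
  act l hl z hz := by
    rw [List.mem_singleton] at hl; subst hl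
    have h := List.formPerm_apply_getElem (List.finRange (N+1)) (List.nodup_finRange _) z.1 (by simpa using Nat.lt_succ_iff.1 z.2)
    simp only [List.getElem_finRange, List.length_finRange] at h
    rw [finRotate_apply]
    have h2 : (List.finRange (N+1)).formPerm z = _ := h
    rw [h2]
    ext
    simp [Fin.val_add]

end fact
end KF

/-- For all `n, k ≥ 1`,
`∑_{f ∈ F_n^k} ∏_{j=1}^n 1/(a_j^k - a_j^0) = (k+1)(2k+1)⋯((n-1)k+1)/k^n`. -/
theorem stmt3 (n k : ℕ) (hn : 1 ≤ n) (hk : 1 ≤ k) :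
    ∑ f : MinKFact n k, ∏ j : Fin n,
        (1 : ℚ) / (((f.a j (Fin.last k) : ℕ) : ℚ) - ((f.a j 0 : ℕ) : ℚ))
      = (∏ i ∈ Finset.range (n-1), (((i+1) * k + 1 : ℕ) : ℚ)) / (k : ℚ) ^ n := by
  classical
  have hmain := KF.AA_sum k (fun i : Fin (k*n+1) => ((i : ℕ) : ℚ)) n (finRotate (k*n+1))
  have hx : Function.Injective (fun i : Fin (k*n+1) => ((i : ℕ) : ℚ)) := by
    intro a b h
    exact Fin.ext (Nat.cast_injective h)
  rw [KF.AA_eval k hk hx n _ _ (KF.St_rot (k*n)) (by simp; ring)] at hmain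
  have hV := KF.V_ap k hk hx _ (List.finRange (k*n+1)) le_rfl (List.nodup_finRange _) (by
    rw [List.isChain_iff_getElem]
    intro i hi
    simp)
  rw [List.map_singleton, List.prod_singleton, hV, List.length_finRange, KF.sq_value k hk n] at hmain
  obtain ⟨m, rfl⟩ : ∃ m, n = m + 1 := ⟨n - 1, by omega⟩
  rw [Finset.prod_range_succ'] at hmain
  simp only [Nat.zero_mul, Nat.zero_add, Nat.cast_one, mul_one] at hmain
  rw [Nat.add_sub_cancel, ← hmain, ← Finset.sum_filter]
  refine Finset.sum_bij (fun f _ => f.a) ?_ ?_ ?_ ?_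
  · intro f _
    simp only [Finset.mem_filter, Finset.mem_univ, true_and]
    exact ⟨⟨f.inj, f.min_first⟩, f.prod_eq⟩
  · rintro ⟨a, _, _, _⟩ _ ⟨b, _, _, _⟩ _ h
    simp only at h
    subst h
    rfl
  · intro a ha
    simp only [Finset.mem_filter, Finset.mem_univ, true_and] at ha
    exact ⟨⟨a, ha.1.1, ha.1.2, ha.2⟩, Finset.mem_univ _, rfl⟩
  · intro f _
    rfl
end
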